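/- Let K = ∪_{h=1}^N [a_h,b_h] ⊂ ℝ be a finite union of pairwise disjoint compact intervals, θ > 0 with θ|K| > 1, let k ≥ 2 be an integer and β ∈ (0,1), and let V be continuous on K and belong to C^{k+1/2+β}_loc(∪_h (a_h,b_h)), meaning C^{k,β+1/2}_loc if β ≤ 1/2 and C^{k+1,β−1/2}_loc if β > 1/2. Let μ = ψℋ¹ be the unique minimizer of E_V over 𝓜_{1,θ}(K) and assume V is regular: ψ has a continuous representative, there is c ∈ ℝ such that u(x) := −∫ log|x−t| dμ(t) − c satisfies u ≥ −V on {ψ < θ} ∩ K, u ≤ −V on {ψ > 0}, and {x ∈ K : u(x) = −V(x)} equals the closure of {0 < ψ < θ}; {0 < ψ < θ} is a finite union of open intervals compactly contained in ∪_h (a_h,b_h); and at every p₋ ∈ ∂{ψ > 0} (resp. p₊ ∈ ∂{ψ < θ}) one has ψ(x) = Q₋(x)√|x−p₋| (resp. θ − ψ(x) = Q₊(x)√|x−p₊|) for x ∈ {0 < ψ < θ} near p₋ (resp. p₊), with Q₋, Q₊ bounded between positive constants. Then near each such free boundary point the functions Q₋ and Q₊ can be chosen of class C^{k−1,β}. 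-/

import Mathlib

open MeasureTheory Set

/-- `ψ` is the density of a measure in `𝓜_{s,θ}(K)`: measurable, `0 ≤ ψ ≤ θ` a.e.,
vanishing a.e. outside `K`, with total integral `s`. -/
def AdmissibleDensity (K : Set ℝ) (θ s : ℝ) (ψ : ℝ → ℝ) : Prop :=
  Measurable ψ ∧ (∀ᵐ x ∂(volume : Measure ℝ), 0 ≤ ψ x ∧ ψ x ≤ θ) ∧
  (∀ᵐ x ∂(volume : Measure ℝ), x ∉ K → ψ x = 0) ∧ (∫ x, ψ x) = s

/-- Weighted logarithmic energy of the measure `ψ·ℋ¹`: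
`E_W(ψ) = ∫∫ (W x + W y − log|x−y|) ψ(x) ψ(y) dx dy`. -/
noncomputable def dEnergy (W : ℝ → ℝ) (ψ : ℝ → ℝ) : ℝ :=
  ∫ x, ∫ y, (W x + W y - Real.log |x - y|) * (ψ x * ψ y)

/-- `ψ·ℋ¹` minimizes `E_W` over `𝓜_{s,θ}(K)`. -/
def MinimizesD (W : ℝ → ℝ) (K : Set ℝ) (θ s : ℝ) (ψ : ℝ → ℝ) : Prop :=
  AdmissibleDensity K θ s ψ ∧
    ∀ ψ' : ℝ → ℝ, AdmissibleDensity K θ s ψ' → dEnergy W ψ ≤ dEnergy W ψ'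

/-- Planar logarithmic potential of the measure `ψ·ℋ¹`, shifted by the constant `c`:
`u(x₁,x₂) = −∫ log|(x₁,x₂) − (t,0)| ψ(t) dt − c`. -/
noncomputable def dpot (ψ : ℝ → ℝ) (c x₁ x₂ : ℝ) : ℝ :=
  -(∫ t, Real.log (Real.sqrt ((x₁ - t)^2 + x₂^2)) * ψ t) - c

/-- `V` is of class `C^{k,α}_loc` on the open set `U`: around each point of `U` it is `C^k`
with locally `α`-Hölder `k`-th derivative. -/
def CkAlphaLocOn (k : ℕ) (α : ℝ) (V : ℝ → ℝ) (U : Set ℝ) : Prop :=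
  ∀ x₀ ∈ U, ∃ ε > 0, Metric.ball x₀ ε ⊆ U ∧
    ContDiffOn ℝ k V (Metric.ball x₀ ε) ∧
    ∃ M : ℝ, ∀ x ∈ Metric.ball x₀ ε, ∀ y ∈ Metric.ball x₀ ε,
      |iteratedDerivWithin k V (Metric.ball x₀ ε) x
        - iteratedDerivWithin k V (Metric.ball x₀ ε) y| ≤ M * |x - y| ^ α

/-- `Q` is of class `C^{k,α}` on the interval `[a,b]` (as the restriction of a globally
`C^k` function whose `k`-th derivative is `α`-Hölder on `[a,b]`). -/
def CkAlphaOnIcc (k : ℕ) (α a b : ℝ) (Q : ℝ → ℝ) : Prop :=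
  ContDiff ℝ k Q ∧ ∃ M : ℝ, ∀ x ∈ Set.Icc a b, ∀ y ∈ Set.Icc a b,
    |iteratedDeriv k Q x - iteratedDeriv k Q y| ≤ M * |x - y| ^ α

section
open Filter Topology

/-- `f` is `n` times differentiable on `(p - r, p + r)` with `α`-Hölder `n`-th derivative,
witnessed by an explicit chain of successive derivatives. -/
def DerivChain (n : ℕ) (α : ℝ) (f : ℝ → ℝ) (p r : ℝ) : Prop :=
  ∃ d : ℕ → ℝ → ℝ, d 0 = f ∧
    (∀ j < n, ∀ x ∈ Ioo (p - r) (p + r), HasDerivAt (d j) (d (j + 1) x) x) ∧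
    ∃ M : ℝ, ∀ x ∈ Ioo (p - r) (p + r), ∀ y ∈ Ioo (p - r) (p + r),
      |d n x - d n y| ≤ M * |x - y| ^ α

namespace DerivChain

variable {n : ℕ} {α p r : ℝ} {f g : ℝ → ℝ}

theorem congr (hf : DerivChain n α f p r) (h : ∀ x ∈ Ioo (p - r) (p + r), f x = g x) :
    DerivChain n α g p r := by
  obtain ⟨d, rfl, hd, M, hM⟩ := hf
  refine ⟨fun j => if j = 0 then g else d j, by simp, ?_, M, ?_⟩
  · intro j hj x hx
    rcases Nat.eq_zero_or_pos j with rfl | hj0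
    · simp only [if_true]
      refine (by simpa using hd 0 hj x hx : HasDerivAt (d 0) (d 1 x) x).congr_of_eventuallyEq ?_
      filter_upwards [isOpen_Ioo.mem_nhds hx] with y hy using (h y hy).symm
    · simpa [hj0.ne'] using hd j hj x hx
  · rcases Nat.eq_zero_or_pos n with rfl | hn
    · intro x hx y hy
      simpa [← h x hx, ← h y hy] using hM x hx y hy
    · simpa [hn.ne'] using hM

theorem mono {r' : ℝ} (hf : DerivChain n α f p r) (h : r' ≤ r) : DerivChain n α f p r' := by
  obtain ⟨d, h0, hd, M, hM⟩ := hf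
  have hs : Ioo (p - r') (p + r') ⊆ Ioo (p - r) (p + r) :=
    Ioo_subset_Ioo (by linarith) (by linarith)
  exact ⟨d, h0, fun j hj x hx => hd j hj x (hs hx), M,
    fun x hx y hy => hM x (hs hx) y (hs hy)⟩

theorem add (hf : DerivChain n α f p r) (hg : DerivChain n α g p r) :
    DerivChain n α (fun x => f x + g x) p r := by
  obtain ⟨d, rfl, hd, M, hM⟩ := hf
  obtain ⟨e, rfl, he, L, hL⟩ := hg
  refine ⟨fun j x => d j x + e j x, rfl, fun j hj x hx => (hd j hj x hx).add (he j hj x hx),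
    M + L, fun x hx y hy => ?_⟩
  have h1 := hM x hx y hy
  have h2 := hL x hx y hy
  calc |d n x + e n x - (d n y + e n y)| = |(d n x - d n y) + (e n x - e n y)| := by ring_nf
    _ ≤ |d n x - d n y| + |e n x - e n y| := abs_add_le _ _
    _ ≤ (M + L) * |x - y| ^ α := by linarith

theorem const_mul (c : ℝ) (hf : DerivChain n α f p r) :
    DerivChain n α (fun x => c * f x) p r := by
  obtain ⟨d, rfl, hd, M, hM⟩ := hf
  refine ⟨fun j x => c * d j x, rfl, fun j hj x hx => (hd j hj x hx).const_mul c,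
    |c| * M, fun x hx y hy => ?_⟩
  rw [← mul_sub, abs_mul, mul_assoc]
  exact mul_le_mul_of_nonneg_left (hM x hx y hy) (abs_nonneg c)

theorem cons {f' : ℝ → ℝ} (hf : ∀ x ∈ Ioo (p - r) (p + r), HasDerivAt f (f' x) x)
    (hf' : DerivChain n α f' p r) : DerivChain (n + 1) α f p r := by
  obtain ⟨d, rfl, hd, M, hM⟩ := hf'
  refine ⟨fun j => Nat.casesOn j f d, rfl, ?_, M, hM⟩
  rintro (_ | j) hj x hx
  · exact hf x hx
  · exact hd j (by omega) x hx

theorem comp_affine {σ : ℝ} (hσ : |σ| = 1) (q : ℝ) (hf : DerivChain n α f p r) :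
    DerivChain n α (fun x => f (p + σ * (x - q))) q r := by
  obtain ⟨d, rfl, hd, M, hM⟩ := hf
  have hmem : ∀ x ∈ Ioo (q - r) (q + r), p + σ * (x - q) ∈ Ioo (p - r) (p + r) := by
    intro x hx
    have h1 : |x - q| < r := by rw [abs_lt]; constructor <;> linarith [hx.1, hx.2]
    have h2 : |σ * (x - q)| < r := by rwa [abs_mul, hσ, one_mul]
    rw [abs_lt] at h2
    constructor <;> linarith [h2.1, h2.2]
  refine ⟨fun j x => σ ^ j * d j (p + σ * (x - q)), by simp, fun j hj x hx => ?_, M,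
    fun x hx y hy => ?_⟩
  · have h1 : HasDerivAt (fun x => p + σ * (x - q)) σ x := by
      simpa using (((hasDerivAt_id x).sub_const q).const_mul σ).const_add p
    have h2 := ((hd j hj _ (hmem x hx)).comp x h1).const_mul (σ ^ j)
    exact h2.congr_deriv (by ring)
  · have h1 := hM _ (hmem x hx) _ (hmem y hy)
    rw [← mul_sub, abs_mul, abs_pow, hσ, one_pow, one_mul]
    refine h1.trans (le_of_eq ?_)
    rw [show p + σ * (x - q) - (p + σ * (y - q)) = σ * (x - y) by ring, abs_mul, hσ, one_mul]

theorem of_ckAlphaLocOn {V : ℝ → ℝ} {U : Set ℝ} (h : CkAlphaLocOn n α V U) (hp : p ∈ U) :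
    ∃ r > 0, Ioo (p - r) (p + r) ⊆ U ∧ DerivChain n α V p r := by
  obtain ⟨ε, hε, hU, hV, M, hM⟩ := h p hp
  rw [Real.ball_eq_Ioo] at hU hV hM
  refine ⟨ε, hε, hU, fun j => iteratedDerivWithin j V (Ioo (p - ε) (p + ε)),
    iteratedDerivWithin_zero, fun j hj x hx => ?_, M, hM⟩
  have h1 := hV.differentiableOn_iteratedDerivWithin (m := j) (by exact_mod_cast hj)
    isOpen_Ioo.uniqueDiffOn x hx
  simp only [iteratedDerivWithin_succ]
  exact h1.hasDerivWithinAt.hasDerivAt (isOpen_Ioo.mem_nhds hx)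

theorem continuousOn (hα : 0 < α) (hf : DerivChain n α f p r) :
    ContinuousOn f (Ioo (p - r) (p + r)) := by
  obtain ⟨d, rfl, hd, M, hM⟩ := hf
  rcases Nat.eq_zero_or_pos n with rfl | hn
  · intro x hx
    rw [ContinuousWithinAt, tendsto_iff_norm_sub_tendsto_zero]
    have h1 : Tendsto (fun y => M * |y - x| ^ α) (𝓝[Ioo (p - r) (p + r)] x) (𝓝 0) := by
      have : Continuous (fun y => M * |y - x| ^ α) := by
        have := hα.le
        fun_prop (disch := assumption)
      have h2 := this.tendsto x
      simp only [sub_self, abs_zero, Real.zero_rpow hα.ne', mul_zero] at h2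
      exact h2.mono_left nhdsWithin_le_nhds
    refine squeeze_zero' (Eventually.of_forall fun _ => norm_nonneg _) ?_ h1
    filter_upwards [self_mem_nhdsWithin] with y hy using hM y hy x hx
  · exact fun x hx => (hd 0 hn x hx).continuousAt.continuousWithinAt

theorem ckAlphaOnIcc (hα : 0 < α) (hf : DerivChain n α f p r) {r' : ℝ} (hr' : 0 < r')
    (h : r' < r) : ∃ Q : ℝ → ℝ, (∀ x ∈ Icc (p - r') (p + r'), Q x = f x) ∧
      CkAlphaOnIcc n α (p - r') (p + r') Q := by
  have hcont : ∀ n' ≤ n, ∀ d : ℕ → ℝ → ℝ,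
      (∀ j < n', ∀ x ∈ Ioo (p - r) (p + r), HasDerivAt (d j) (d (j + 1) x) x) →
      ContinuousOn (d n') (Ioo (p - r) (p + r)) →
      ContDiffOn ℝ n' (d 0) (Ioo (p - r) (p + r)) := by
    intro n'
    induction n' with
    | zero => intro _ d _ hc; simpa using hc
    | succ m ih =>
      intro hm d hd hc
      have h1 := ih (by omega) (fun j => d (j + 1)) (fun j hj x hx => hd (j + 1) (by omega) x hx) hc
      push_cast
      rw [contDiffOn_succ_iff_deriv_of_isOpen isOpen_Ioo]
      refine ⟨fun x hx => (hd 0 (by omega) x hx).differentiableAt.differentiableWithinAt,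
        by simp, h1.congr fun x hx => (hd 0 (by omega) x hx).deriv⟩
  obtain ⟨d, rfl, hd, M, hM⟩ := hf
  have htop : ContinuousOn (d n) (Ioo (p - r) (p + r)) :=
    continuousOn (n := 0) hα ⟨fun _ => d n, rfl, by simp, M, hM⟩
  have hC := hcont n le_rfl d hd htop
  obtain ⟨χ⟩ : Nonempty {χ : ContDiffBump p // χ.rIn = (r' + (r' + r) / 2) / 2 ∧
      χ.rOut = (r' + r) / 2} :=
    ⟨⟨⟨(r' + (r' + r) / 2) / 2, (r' + r) / 2, by linarith, by linarith⟩, rfl, rfl⟩⟩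
  obtain ⟨χ, hin, hout⟩ := χ
  have hnear : ∀ x ∈ Icc (p - r') (p + r'), (fun y => χ y * d 0 y) =ᶠ[𝓝 x] d 0 := by
    intro x hx
    have : Metric.ball p χ.rIn ∈ 𝓝 x := by
      refine Metric.isOpen_ball.mem_nhds ?_
      rw [Real.ball_eq_Ioo, hin]
      constructor <;> linarith [hx.1, hx.2]
    filter_upwards [this] with y hy
    rw [χ.one_of_mem_closedBall (Metric.ball_subset_closedBall hy), one_mul]
  have hsub : Icc (p - r') (p + r') ⊆ Ioo (p - r) (p + r) :=
    Icc_subset_Ioo (by linarith) (by linarith)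
  have hit : ∀ j ≤ n, ∀ x ∈ Ioo (p - r) (p + r), iteratedDeriv j (d 0) x = d j x := by
    intro j
    induction j with
    | zero => intro _ x _; simp
    | succ j ih =>
      intro hj x hx
      rw [iteratedDeriv_succ]
      have : iteratedDeriv j (d 0) =ᶠ[𝓝 x] d j := by
        filter_upwards [isOpen_Ioo.mem_nhds hx] with y hy using ih (by omega) y hy
      rw [this.deriv_eq]
      exact (hd j (by omega) x hx).deriv
  refine ⟨fun y => χ y * d 0 y, fun x hx => (hnear x hx).eq_of_nhds, ?_, M, ?_⟩
  · rw [contDiff_iff_contDiffAt]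
    intro x
    by_cases hx : x ∈ Ioo (p - r) (p + r)
    · exact χ.contDiffAt.mul (hC.contDiffAt (isOpen_Ioo.mem_nhds hx))
    · have : (fun y => χ y * d 0 y) =ᶠ[𝓝 x] fun _ => 0 := by
        have h2 : x ∉ Metric.closedBall p χ.rOut := by
          rw [Real.closedBall_eq_Icc, hout]
          intro h3
          exact hx ⟨by linarith [h3.1], by linarith [h3.2]⟩
        filter_upwards [Metric.isClosed_closedBall.isOpen_compl.mem_nhds h2] with y hy
        rw [χ.zero_of_le_dist, zero_mul]
        simpa using (not_le.1 fun h3 => hy (Metric.mem_closedBall.2 h3)).le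
      exact contDiffAt_const.congr_of_eventuallyEq this
  · intro x hx y hy
    rw [(hnear x hx).iteratedDeriv_eq, (hnear y hy).iteratedDeriv_eq,
      hit n le_rfl x (hsub hx), hit n le_rfl y (hsub hy)]
    exact hM x (hsub hx) y (hsub hy)

theorem of_holomorphic {F : ℂ → ℂ} (hα : α ≤ 1) (hF : DifferentiableOn ℂ F (Metric.ball 0 r))
    {r' : ℝ} (h : r' < r) (n : ℕ) : DerivChain n α (fun x => (F x).re) 0 r' := by
  have hA : ∀ j, DifferentiableOn ℂ (iteratedDeriv j F) (Metric.ball 0 r) := by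
    intro j
    induction j with
    | zero => simpa using hF
    | succ j ih => rw [iteratedDeriv_succ]; exact ih.deriv Metric.isOpen_ball
  have hmem : ∀ x ∈ Ioo (0 - r') (0 + r'), (x : ℂ) ∈ Metric.closedBall (0 : ℂ) r' := by
    intro x hx
    simp only [mem_closedBall_zero_iff, Complex.norm_real, Real.norm_eq_abs]
    exact abs_le.2 ⟨by linarith [hx.1], by linarith [hx.2]⟩
  have hsub : Metric.closedBall (0 : ℂ) r' ⊆ Metric.ball 0 r := Metric.closedBall_subset_ball h
  have hD : ∀ j, ∀ x ∈ Ioo (0 - r') (0 + r'), HasDerivAt (fun x : ℝ => (iteratedDeriv j F x).re)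
      (iteratedDeriv (j + 1) F x).re x := by
    intro j x hx
    rw [iteratedDeriv_succ]
    exact ((hA j).differentiableAt (Metric.isOpen_ball.mem_nhds
      (hsub (hmem x hx)))).hasDerivAt.real_of_complex
  refine ⟨fun j x => (iteratedDeriv j F x).re, by simp, fun j _ x hx => hD j x hx, ?_⟩
  obtain ⟨C, hC⟩ := (isCompact_closedBall (0 : ℂ) r').exists_bound_of_continuousOn
    ((hA (n + 1)).continuousOn.mono hsub)
  have hlip : ∀ x ∈ Ioo (0 - r') (0 + r'), ∀ y ∈ Ioo (0 - r') (0 + r'),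
      |(iteratedDeriv n F x).re - (iteratedDeriv n F y).re| ≤ C * |x - y| := by
    intro x hx y hy
    exact Convex.norm_image_sub_le_of_norm_hasDerivWithin_le
      (fun z hz => (hD n z hz).hasDerivWithinAt)
      (fun z hz => (Complex.abs_re_le_norm _).trans (hC _ (hmem z hz))) (convex_Ioo _ _) hy hx
  refine ⟨C * (2 * r') ^ (1 - α), fun x hx y hy => (hlip x hx y hy).trans ?_⟩
  have hC0 : 0 ≤ C := (norm_nonneg _).trans (hC _ (hmem x hx))
  rw [mul_assoc]
  refine mul_le_mul_of_nonneg_left ?_ hC0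
  rcases eq_or_ne x y with rfl | hne
  · simp only [sub_self, abs_zero]
    have : 0 < r' := by linarith [hx.1, hx.2]
    positivity
  · have h0 : 0 < |x - y| := abs_pos.2 (sub_ne_zero.2 hne)
    have h2 : |x - y| ≤ 2 * r' := by
      rw [abs_le]; constructor <;> linarith [hx.1, hx.2, hy.1, hy.2]
    calc |x - y| = |x - y| ^ (1 - α) * |x - y| ^ α := by
          rw [← Real.rpow_add h0]; simp
      _ ≤ _ := by
          refine mul_le_mul_of_nonneg_right ?_ (by positivity)
          exact Real.rpow_le_rpow h0.le h2 (by linarith)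

end DerivChain
end

section
open Filter Topology

/-- On `(-r, r)` the function `f` is the restriction of a holomorphic function on the disc of
radius `r`. -/
def HoloExt (r : ℝ) (f : ℝ → ℝ) : Prop :=
  ∃ F : ℂ → ℂ, DifferentiableOn ℂ F (Metric.ball 0 r) ∧ ∀ x ∈ Ioo (-r) r, F x = (f x : ℂ)

namespace HoloExt

variable {r : ℝ} {f g : ℝ → ℝ}

theorem add (hf : HoloExt r f) (hg : HoloExt r g) : HoloExt r (fun x => f x + g x) := by
  obtain ⟨F, hF, hFf⟩ := hf
  obtain ⟨G, hG, hGg⟩ := hg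
  exact ⟨fun z => F z + G z, hF.add hG, fun x hx => by simp [hFf x hx, hGg x hx]⟩

theorem mul (hf : HoloExt r f) (hg : HoloExt r g) : HoloExt r (fun x => f x * g x) := by
  obtain ⟨F, hF, hFf⟩ := hf
  obtain ⟨G, hG, hGg⟩ := hg
  exact ⟨fun z => F z * G z, hF.mul hG, fun x hx => by simp [hFf x hx, hGg x hx]⟩

theorem const (r c : ℝ) : HoloExt r (fun _ => c) :=
  ⟨fun _ => c, differentiableOn_const _, fun _ _ => rfl⟩

theorem id (r : ℝ) : HoloExt r (fun x => x) :=
  ⟨fun z => z, differentiableOn_id, fun _ _ => rfl⟩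

theorem const_mul (c : ℝ) (hf : HoloExt r f) : HoloExt r (fun x => c * f x) :=
  (const r c).mul hf

theorem sub (hf : HoloExt r f) (hg : HoloExt r g) : HoloExt r (fun x => f x - g x) := by
  simpa [sub_eq_add_neg] using hf.add (hg.const_mul (-1))

theorem comp_neg (hf : HoloExt r f) : HoloExt r (fun x => f (-x)) := by
  obtain ⟨F, hF, hFf⟩ := hf
  refine ⟨fun z => F (-z), hF.comp (differentiableOn_neg _) fun z hz => by simpa using hz,
    fun x hx => ?_⟩
  simpa using hFf (-x) ⟨by linarith [hx.2], by linarith [hx.1]⟩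

theorem log_sub {a : ℝ} (h : r ≤ a) : HoloExt r (fun x => Real.log (a - x)) := by
  refine ⟨fun z => Complex.log (a - z), ?_, fun x hx => ?_⟩
  · refine DifferentiableOn.clog (by fun_prop) fun z hz => Or.inl ?_
    have h1 : z.re < r := (Complex.re_le_norm z).trans_lt (by simpa using hz)
    simp
    linarith
  · rw [Complex.ofReal_log (by linarith [hx.2])]
    simp

theorem inv_sub {a : ℝ} (h : r ≤ a) : HoloExt r (fun x => (a - x)⁻¹) := by
  refine ⟨fun z => (a - z)⁻¹, ?_, fun x hx => by simp⟩
  refine DifferentiableOn.inv (by fun_prop) fun z hz h0 => ?_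
  have h1 : z.re < r := (Complex.re_le_norm z).trans_lt (by simpa using hz)
  have h2 := congrArg Complex.re h0
  simp at h2
  linarith

theorem continuousAt_zero (hr : 0 < r) (hf : HoloExt r f) : ContinuousAt f 0 := by
  obtain ⟨F, hF, hFf⟩ := hf
  have h1 : ContinuousAt F ((0 : ℝ) : ℂ) := by
    simpa using (hF.continuousOn.continuousAt (Metric.ball_mem_nhds 0 hr))
  have h2 : ContinuousAt (fun x : ℝ => (F x).re) 0 :=
    Complex.continuous_re.continuousAt.comp
      (ContinuousAt.comp (f := fun x : ℝ => (x : ℂ)) h1 Complex.continuous_ofReal.continuousAt)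
  refine h2.congr ?_
  filter_upwards [Ioo_mem_nhds (neg_lt_zero.2 hr) hr] with x hx
  simp [hFf x hx]

theorem exists_eq_mul (hr : 0 < r) (hf : HoloExt r f) (h0 : f 0 = 0) :
    ∃ g, HoloExt r g ∧ ∀ x ∈ Ioo (-r) r, f x = x * g x := by
  obtain ⟨F, hF, hFf⟩ := hf
  have hF0 : F 0 = 0 := by simpa [h0] using hFf 0 ⟨by linarith, hr⟩
  have hG := (Complex.differentiableOn_dslope (Metric.ball_mem_nhds (0 : ℂ) hr)).2 hF
  have hre : ∀ x ∈ Ioo (-r) r, (dslope F 0 x) = (((dslope F 0 x).re : ℝ) : ℂ) := by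
    intro x hx
    have hne : ∀ y : ℝ, y ≠ 0 → y ∈ Ioo (-r) r → (dslope F 0 y).im = 0 := by
      intro y hy hyr
      rw [dslope_of_ne _ (by exact_mod_cast hy), slope_def_field, hF0, hFf y hyr]
      rw [sub_zero, sub_zero, ← Complex.ofReal_div, Complex.ofReal_im]
    apply Complex.ext (by simp)
    rw [Complex.ofReal_im]
    rcases eq_or_ne x 0 with rfl | hx0
    · have hc : ContinuousAt (dslope F 0) ((0 : ℝ) : ℂ) := by
        simpa using (hG.continuousOn.continuousAt (Metric.ball_mem_nhds 0 hr))
      have h2 : ContinuousAt (fun x : ℝ => (dslope F 0 x).im) 0 :=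
        Complex.continuous_im.continuousAt.comp
          (ContinuousAt.comp (f := fun x : ℝ => (x : ℂ)) hc Complex.continuous_ofReal.continuousAt)
      have h3 : Tendsto (fun x : ℝ => (dslope F 0 x).im) (𝓝[≠] 0) (𝓝 0) := by
        refine tendsto_const_nhds.congr' ?_
        filter_upwards [self_mem_nhdsWithin, mem_nhdsWithin_of_mem_nhds
          (Ioo_mem_nhds (neg_lt_zero.2 hr) hr)] with y hy hyr using (hne y hy hyr).symm
      exact tendsto_nhds_unique (h2.tendsto.mono_left nhdsWithin_le_nhds) h3
    · exact hne x hx0 hx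
  refine ⟨fun x => (dslope F 0 x).re, ⟨dslope F 0, hG, hre⟩, fun x hx => ?_⟩
  have h1 : (x : ℂ) * dslope F 0 x = f x := by
    have := sub_smul_dslope F 0 (x : ℂ)
    rw [sub_zero, hF0, sub_zero, hFf x hx] at this
    exact this
  rw [hre x hx, ← Complex.ofReal_mul] at h1
  exact (Complex.ofReal_injective h1).symm

theorem derivChain {α : ℝ} (hα : α ≤ 1) (hf : HoloExt r f) {r' : ℝ} (h : r' < r) (n : ℕ) :
    DerivChain n α f 0 r' := by
  obtain ⟨F, hF, hFf⟩ := hf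
  refine (DerivChain.of_holomorphic hα hF h n).congr fun x hx => ?_
  rw [hFf x ⟨by linarith [hx.1], by linarith [hx.2]⟩, Complex.ofReal_re]

theorem integral {μ : Measure ℝ} {K : ℂ → ℝ → ℂ} {k : ℝ → ℝ → ℝ} {b : ℝ → ℝ}
    (hm : ∀ z ∈ Metric.ball (0 : ℂ) r, AEStronglyMeasurable (K z) μ)
    (hb : ∀ᵐ y ∂μ, ∀ z ∈ Metric.ball (0 : ℂ) r, ‖K z y‖ ≤ b y) (hbi : Integrable b μ)
    (hd : ∀ᵐ y ∂μ, DifferentiableOn ℂ (fun z => K z y) (Metric.ball 0 r))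
    (hk : ∀ x ∈ Ioo (-r) r, ∀ᵐ y ∂μ, K x y = k x y) :
    HoloExt r (fun x => ∫ y, k x y ∂μ) := by
  refine ⟨fun z => ∫ y, K z y ∂μ, fun z hz => ?_, fun x hx => ?_⟩
  · have hz' : ‖z‖ < r := by simpa using hz
    obtain ⟨ρ, hρ, hρr⟩ : ∃ ρ > 0, ‖z‖ + 2 * ρ < r := ⟨(r - ‖z‖) / 4, by linarith, by linarith⟩
    have hball : ∀ w ∈ Metric.ball z ρ, Metric.closedBall w ρ ⊆ Metric.ball 0 r := by
      intro w hw u hu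
      simp only [Metric.mem_ball, Metric.mem_closedBall, dist_zero_right] at *
      have h1 : ‖u‖ ≤ ‖z‖ + dist u z := by
        rw [dist_eq_norm]; simpa using norm_add_le z (u - z)
      linarith [dist_triangle u w z]
    have hsub : Metric.ball z ρ ⊆ Metric.ball 0 r := fun w hw =>
      hball w hw (Metric.mem_closedBall_self hρ.le)
    have hda : ∀ᵐ y ∂μ, ∀ w ∈ Metric.ball z ρ,
        HasDerivAt (fun z => K z y) (deriv (fun z => K z y) w) w := by
      filter_upwards [hd] with y hy w hw
      exact (hy.differentiableAt (Metric.isOpen_ball.mem_nhds (hsub hw))).hasDerivAt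
    have key := hasDerivAt_integral_of_dominated_loc_of_deriv_le (μ := μ) (F := K)
      (F' := fun w y => deriv (fun z => K z y) w) (bound := fun y => b y / ρ) (x₀ := z)
      (Metric.ball_mem_nhds z hρ) ?_ ?_ ?_ ?_ (hbi.div_const ρ) hda
    · exact key.2.differentiableAt.differentiableWithinAt
    · filter_upwards [Metric.isOpen_ball.mem_nhds hz] with w hw using hm w hw
    · refine hbi.mono' (hm z hz) ?_
      filter_upwards [hb] with y hy using hy z hz
    · have hh : Tendsto (fun n : ℕ => (z : ℂ) + ((ρ / 2) / ((n : ℝ) + 1) : ℝ)) atTop (𝓝 z) := by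
        have h1 : Tendsto (fun n : ℕ => ((ρ / 2) / ((n : ℝ) + 1) : ℝ)) atTop (𝓝 0) := by
          simpa [div_eq_mul_inv] using
            (tendsto_one_div_add_atTop_nhds_zero_nat (𝕜 := ℝ)).const_mul (ρ / 2)
        have h2 := (Complex.continuous_ofReal.tendsto 0).comp h1
        simpa using h2.const_add z
      have hne : ∀ n : ℕ, (z : ℂ) + ((ρ / 2) / ((n : ℝ) + 1) : ℝ) ≠ z := by
        intro n h
        have h1 : (((ρ / 2) / ((n : ℝ) + 1) : ℝ) : ℂ) = 0 := by simpa using h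
        have h2 : (0 : ℝ) < (ρ / 2) / ((n : ℝ) + 1) := by positivity
        exact h2.ne' (by exact_mod_cast h1)
      have hin : ∀ n : ℕ, (z : ℂ) + ((ρ / 2) / ((n : ℝ) + 1) : ℝ) ∈ Metric.ball z ρ := by
        intro n
        have h2 : (0 : ℝ) < (ρ / 2) / ((n : ℝ) + 1) := by positivity
        rw [Metric.mem_ball, dist_eq_norm, add_sub_cancel_left, Complex.norm_real,
          Real.norm_of_nonneg h2.le]
        have : (ρ / 2) / ((n : ℝ) + 1) ≤ ρ / 2 := div_le_self (by positivity) (by simp)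
        linarith
      refine aestronglyMeasurable_of_tendsto_ae (u := atTop)
        (f := fun (n : ℕ) y => slope (fun z => K z y) z (z + ((ρ / 2) / ((n : ℝ) + 1) : ℝ))) ?_ ?_
      · intro n
        simp only [slope_def_module]
        exact ((hm _ (hsub (hin n))).sub (hm z hz)).const_smul
          ((z + ((ρ / 2) / ((n : ℝ) + 1) : ℝ) - z)⁻¹ : ℂ)
      · filter_upwards [hda] with y hy
        have h1 := (hy z (Metric.mem_ball_self hρ))
        rw [hasDerivAt_iff_tendsto_slope] at h1
        exact h1.comp (tendsto_nhdsWithin_iff.2 ⟨hh, Eventually.of_forall hne⟩)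
    · filter_upwards [hb, hd] with y hy hdy w hw
      refine Complex.norm_deriv_le_of_forall_mem_sphere_norm_le hρ ?_ fun u hu =>
        hy u (hball w hw (Metric.sphere_subset_closedBall hu))
      exact (hdy.mono (hball w hw)).diffContOnCl_ball subset_rfl
  · simp only
    rw [integral_congr_ae (hk x hx), integral_complex_ofReal]

end HoloExt
end

section
open Filter Topology

/-- `g` vanishes for `t ≤ 0`, is `m` times differentiable, and its `m`-th derivative satisfies the
weighted Hölder bound `|g t - g s| ≤ C √t (t - s) ^ β`. -/
def SqrtHolder (β : ℝ) : ℕ → (ℝ → ℝ) → Prop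
  | 0, g => (∀ t ≤ 0, g t = 0) ∧ ∃ C, 0 ≤ C ∧ ∀ s t, s ≤ t → |g t - g s| ≤ C * √t * (t - s) ^ β
  | m + 1, g => (∀ t ≤ 0, g t = 0) ∧ ∃ g₁, (∀ t, HasDerivAt g (g₁ t) t) ∧ SqrtHolder β m g₁

/-- `h` vanishes for `t ≤ 0` and is `n` times differentiable with `β`-Hölder `n`-th derivative. -/
def ZeroHolder (β : ℝ) : ℕ → (ℝ → ℝ) → Prop
  | 0, h => (∀ t ≤ 0, h t = 0) ∧ ∃ C, 0 ≤ C ∧ ∀ s t, s ≤ t → |h t - h s| ≤ C * (t - s) ^ β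
  | n + 1, h => (∀ t ≤ 0, h t = 0) ∧ ∃ h₁, (∀ t, HasDerivAt h (h₁ t) t) ∧ ZeroHolder β n h₁

/-- A Hölder-type bound for `0 ≤ s ≤ t` extends to all `s ≤ t` if the function vanishes on
`(-∞, 0]`. -/
theorem abs_sub_le_of_zero {β : ℝ} (hβ : 0 ≤ β) {g : ℝ → ℝ} {C : ℝ} (hC : 0 ≤ C) {w : ℝ → ℝ}
    (hw : ∀ t, 0 ≤ w t) (hz : ∀ t ≤ 0, g t = 0)
    (h : ∀ s t, 0 ≤ s → s < t → |g t - g s| ≤ C * w t * (t - s) ^ β) (s t : ℝ) (hst : s ≤ t) :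
    |g t - g s| ≤ C * w t * (t - s) ^ β := by
  have hnn : 0 ≤ C * w t * (t - s) ^ β :=
    mul_nonneg (mul_nonneg hC (hw t)) (Real.rpow_nonneg (by linarith) _)
  rcases hst.eq_or_lt with rfl | hst
  · simpa using hnn
  rcases le_or_gt 0 s with hs | hs
  · exact h s t hs hst
  rcases le_or_gt t 0 with ht | ht
  · simpa [hz t ht, hz s hs.le] using hnn
  · have h1 := h 0 t le_rfl ht
    rw [hz 0 le_rfl] at h1
    rw [hz s hs.le]
    refine h1.trans (mul_le_mul_of_nonneg_left ?_ (mul_nonneg hC (hw t)))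
    exact Real.rpow_le_rpow (by linarith) (by linarith) hβ

theorem rpow_mul_div_le {β t d : ℝ} (hβ1 : β ≤ 1) (hd : 0 < d) (h : d ≤ t) :
    t ^ β * (d / t) ≤ d ^ β := by
  have ht : 0 < t := hd.trans_le h
  have h1 : d / t ≤ (d / t) ^ β := by
    simpa using Real.rpow_le_rpow_of_exponent_ge (by positivity) ((div_le_one ht).2 h) hβ1
  calc t ^ β * (d / t) ≤ t ^ β * (d / t) ^ β := by gcongr
    _ = d ^ β := by rw [← Real.mul_rpow ht.le (by positivity), mul_div_cancel₀ _ ht.ne']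

namespace ZeroHolder

variable {β : ℝ} {n : ℕ} {g h : ℝ → ℝ}

theorem eq_zero (hh : ZeroHolder β n h) : ∀ t ≤ 0, h t = 0 := by
  cases n with
  | zero => exact hh.1
  | succ n => exact hh.1

theorem sub_const_mul (c : ℝ) : ∀ {n : ℕ} {g h : ℝ → ℝ}, ZeroHolder β n g → ZeroHolder β n h →
    ZeroHolder β n (fun t => g t - c * h t)
  | 0, g, h, ⟨hg, C, hC, hgC⟩, ⟨hh, D, hD, hhD⟩ => by
    refine ⟨fun t ht => by simp [hg t ht, hh t ht], C + |c| * D, by positivity,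
      fun s t hst => ?_⟩
    calc |g t - c * h t - (g s - c * h s)| = |(g t - g s) - c * (h t - h s)| := by ring_nf
      _ ≤ |g t - g s| + |c| * |h t - h s| := by rw [← abs_mul]; exact abs_sub _ _
      _ ≤ C * (t - s) ^ β + |c| * (D * (t - s) ^ β) :=
        add_le_add (hgC s t hst) (mul_le_mul_of_nonneg_left (hhD s t hst) (abs_nonneg _))
      _ = _ := by ring
  | n + 1, g, h, ⟨hg, g', hg', hg''⟩, ⟨hh, h', hh', hh''⟩ =>
    ⟨fun t ht => by simp [hg t ht, hh t ht], fun t => g' t - c * h' t,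
      fun t => (hg' t).sub ((hh' t).const_mul c), sub_const_mul c hg'' hh''⟩

theorem continuous (hβ : 0 < β) (hh : ZeroHolder β n h) : Continuous h := by
  cases n with
  | zero =>
    obtain ⟨-, C, hC, hhC⟩ := hh
    refine continuous_iff_continuousAt.2 fun x => ?_
    have h1 : ∀ y, |h y - h x| ≤ C * |y - x| ^ β := by
      intro y
      rcases le_total x y with hxy | hxy
      · simpa [abs_of_nonneg (sub_nonneg.2 hxy)] using hhC x y hxy
      · have := hhC y x hxy
        rw [abs_sub_comm, abs_sub_comm y x]
        simpa [abs_of_nonneg (sub_nonneg.2 hxy)] using this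
    have h2 : Tendsto (fun y => C * |y - x| ^ β) (𝓝 x) (𝓝 0) := by
      have : Continuous fun y => C * |y - x| ^ β :=
        continuous_const.mul ((continuous_abs.comp (continuous_id.sub continuous_const)).rpow_const
          fun _ => Or.inr hβ.le)
      simpa [Real.zero_rpow hβ.ne'] using this.tendsto x
    rw [ContinuousAt, tendsto_iff_dist_tendsto_zero]
    exact squeeze_zero (fun _ => dist_nonneg) (fun y => by rw [Real.dist_eq]; exact h1 y) h2
  | succ n =>
    obtain ⟨-, h', hh', -⟩ := hh
    exact continuous_iff_continuousAt.2 fun x => (hh' x).continuousAt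

end ZeroHolder

namespace SqrtHolder

variable {β : ℝ} {m n : ℕ} {g h : ℝ → ℝ}

theorem eq_zero (hh : SqrtHolder β n h) : ∀ t ≤ 0, h t = 0 := by
  cases n with
  | zero => exact hh.1
  | succ n => exact hh.1

theorem growth (hβ : 0 ≤ β) : ∀ {m : ℕ} {g : ℝ → ℝ}, SqrtHolder β m g →
    ∃ C, 0 ≤ C ∧ ∀ t, 0 ≤ t → |g t| ≤ C * t ^ m * √t * t ^ β
  | 0, g, ⟨hg, C, hC, hgC⟩ => ⟨C, hC, fun t ht => by
      simpa [hg 0 le_rfl] using hgC 0 t ht⟩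
  | m + 1, g, ⟨hg, g', hg', hg''⟩ => by
    obtain ⟨C, hC, hb⟩ := growth hβ hg''
    refine ⟨C, hC, fun t ht => ?_⟩
    have h1 := norm_image_sub_le_of_norm_deriv_le_segment' (f := g) (a := 0) (b := t)
      (C := C * t ^ m * √t * t ^ β) (fun x _ => (hg' x).hasDerivWithinAt) (fun x hx => ?_) t
      ⟨ht, le_rfl⟩
    · rw [hg 0 le_rfl, sub_zero, sub_zero, Real.norm_eq_abs] at h1
      calc |g t| ≤ _ := h1
        _ = _ := by ring
    · rw [Real.norm_eq_abs]
      refine (hb x hx.1).trans ?_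
      have h1 := hx.1
      have h2 := hx.2.le
      have h3 : x ^ β ≤ t ^ β := Real.rpow_le_rpow h1 h2 hβ
      have h4 : 0 ≤ x ^ β := Real.rpow_nonneg h1 _
      gcongr

theorem continuous (hβ : 0 < β) (hh : SqrtHolder β n h) : Continuous h := by
  cases n with
  | zero =>
    obtain ⟨-, C, hC, hhC⟩ := hh
    refine continuous_iff_continuousAt.2 fun x => ?_
    have h1 : ∀ y, |h y - h x| ≤ C * √(max x y) * |y - x| ^ β := by
      intro y
      rcases le_total x y with hxy | hxy
      · simpa [abs_of_nonneg (sub_nonneg.2 hxy), hxy] using hhC x y hxy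
      · have := hhC y x hxy
        rw [abs_sub_comm, abs_sub_comm y x]
        simpa [abs_of_nonneg (sub_nonneg.2 hxy), hxy] using this
    have h2 : Tendsto (fun y => C * √(max x y) * |y - x| ^ β) (𝓝 x) (𝓝 0) := by
      have : Continuous fun y => C * √(max x y) * |y - x| ^ β :=
        (continuous_const.mul (Real.continuous_sqrt.comp (continuous_const.max continuous_id))).mul
          ((continuous_abs.comp (continuous_id.sub continuous_const)).rpow_const
          fun _ => Or.inr hβ.le)
      simpa [Real.zero_rpow hβ.ne'] using this.tendsto x
    rw [ContinuousAt, tendsto_iff_dist_tendsto_zero]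
    exact squeeze_zero (fun _ => dist_nonneg) (fun y => by rw [Real.dist_eq]; exact h1 y) h2
  | succ n =>
    obtain ⟨-, h', hh', -⟩ := hh
    exact continuous_iff_continuousAt.2 fun x => (hh' x).continuousAt

theorem primitive (hβ : 0 < β) (hg : SqrtHolder β m g) :
    ∃ G, SqrtHolder β (m + 1) G ∧ ∀ t, HasDerivAt G (g t) t := by
  have hc := hg.continuous hβ
  have hd : ∀ t, HasDerivAt (fun u => ∫ x in (0:ℝ)..u, g x) (g t) t := fun t =>
    intervalIntegral.integral_hasDerivAt_right (hc.intervalIntegrable _ _)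
      hc.aestronglyMeasurable.stronglyMeasurableAtFilter hc.continuousAt
  refine ⟨_, ⟨fun t ht => ?_, g, hd, hg⟩, hd⟩
  rw [intervalIntegral.integral_symm, neg_eq_zero]
  refine intervalIntegral.integral_zero_ae (Eventually.of_forall fun x hx => ?_)
  rw [uIoc_of_le ht] at hx
  exact hg.eq_zero x hx.2

theorem hasDerivAt_div {g' : ℝ → ℝ} (a : ℕ) {t : ℝ} (ht : 0 < t) (hd : HasDerivAt g (g' t) t) :
    HasDerivAt (fun t => g t / (t ^ a * √t))
      (g' t / (t ^ a * √t) - (1 / 2 + a) * (g t / (t ^ (a + 1) * √t))) t := by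
  have hs : 0 < √t := Real.sqrt_pos.2 ht
  have h1 := ((hasDerivAt_pow a t).mul (Real.hasDerivAt_sqrt ht.ne'))
  have h2 := hd.div h1 (by simp; exact ⟨fun h => absurd h ht.ne', hs.ne'⟩)
  refine h2.congr_deriv ?_
  have h3 : √t ^ 2 = t := Real.sq_sqrt ht.le
  rcases Nat.eq_zero_or_pos a with rfl | ha
  · simp only [Pi.mul_apply, pow_zero, Nat.cast_zero]
    field_simp
    rw [h3]
    ring
  · obtain ⟨b, rfl⟩ : ∃ b, a = b + 1 := ⟨a - 1, by omega⟩
    simp only [Pi.mul_apply, Nat.add_sub_cancel]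
    push_cast
    field_simp
    rw [h3]
    ring

theorem zeroHolder_div_zero (hβ : 0 < β) (hβ1 : β ≤ 1) :
    ∀ {a : ℕ} {g : ℝ → ℝ}, SqrtHolder β a g → ZeroHolder β 0 (fun t => g t / (t ^ a * √t))
  | 0, g, ⟨hz, C, hC, hg⟩ => by
    have hz' : ∀ t ≤ 0, g t / (t ^ 0 * √t) = 0 := fun t ht => by simp [hz t ht]
    refine ⟨hz', 2 * C, by positivity, ?_⟩
    have key := abs_sub_le_of_zero hβ.le (C := 2 * C) (by positivity) (w := fun _ => 1)
      (fun _ => zero_le_one) hz' ?_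
    · simpa using key
    intro s t hs hst
    have ht : 0 < t := hs.trans_lt hst
    have hst0 : 0 < √t := Real.sqrt_pos.2 ht
    have e1 : |g t - g s| / √t ≤ C * (t - s) ^ β := by
      rw [div_le_iff₀ hst0]; linarith [hg s t hst.le]
    have hnn : 0 ≤ C * (t - s) ^ β := mul_nonneg hC (Real.rpow_nonneg (by linarith) _)
    simp only [pow_zero, one_mul, mul_one]
    rcases hs.eq_or_lt with rfl | hs
    · simp only [Real.sqrt_zero, div_zero, sub_zero]
      rw [hz 0 le_rfl, sub_zero] at e1
      rw [abs_div, abs_of_pos hst0]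
      simp only [sub_zero] at e1 hnn
      linarith
    have hs0 : 0 < √s := Real.sqrt_pos.2 hs
    have e2 : |g s| / √s ≤ C * s ^ β := by
      rw [div_le_iff₀ hs0]
      have := hg 0 s hs.le
      rw [hz 0 le_rfl, sub_zero, sub_zero] at this
      linarith
    have e3 : (√t - √s) / √t ≤ (t - s) / t := by
      rw [div_le_div_iff₀ hst0 ht]
      have h1 : √t * √t = t := Real.mul_self_sqrt ht.le
      have h2 : √s * √s = s := Real.mul_self_sqrt hs.le
      have h3 : √s ≤ √t := Real.sqrt_le_sqrt hst.le
      nlinarith [mul_nonneg (sub_nonneg.2 h3) (mul_nonneg hs0.le hst0.le)]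
    have e4 : 0 ≤ (√t - √s) / √t :=
      div_nonneg (sub_nonneg.2 (Real.sqrt_le_sqrt hst.le)) hst0.le
    have e5 : s ^ β * ((t - s) / t) ≤ (t - s) ^ β := by
      refine le_trans ?_ (rpow_mul_div_le hβ1 (sub_pos.2 hst) (by linarith : t - s ≤ t))
      have : 0 ≤ (t - s) / t := div_nonneg (by linarith) ht.le
      gcongr
    calc |g t / √t - g s / √s| = |(g t - g s) / √t - (g s / √s) * ((√t - √s) / √t)| := by
          congr 1; field_simp; ring
      _ ≤ |g t - g s| / √t + (|g s| / √s) * ((√t - √s) / √t) := by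
          refine (abs_sub _ _).trans (le_of_eq ?_)
          rw [abs_mul, abs_div, abs_div (g s), abs_of_pos hst0, abs_of_pos hs0, abs_of_nonneg e4]
      _ ≤ C * (t - s) ^ β + (C * s ^ β) * ((t - s) / t) := by
          gcongr
      _ ≤ C * (t - s) ^ β + C * (t - s) ^ β := by
          rw [mul_assoc]; gcongr
      _ = 2 * C * (t - s) ^ β := by ring
  | a + 1, g, hg => by
    obtain ⟨D, hD, hgD⟩ := hg.growth hβ.le
    obtain ⟨hz, g', hg', hg''⟩ := hg
    obtain ⟨C, hC, hgC⟩ := hg''.growth hβ.le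
    have hz' : ∀ t ≤ 0, g t / (t ^ (a + 1) * √t) = 0 := fun t ht => by simp [hz t ht]
    set M := C + (1 / 2 + ((a + 1 : ℕ) : ℝ)) * D with hM
    have hM0 : 0 ≤ M := by positivity
    refine ⟨hz', 4 * D + 2 * M, by positivity, ?_⟩
    have key := abs_sub_le_of_zero hβ.le (C := 4 * D + 2 * M) (by positivity) (w := fun _ => 1)
      (fun _ => zero_le_one) hz' ?_
    · simpa using key
    intro s t hs hst
    have ht : 0 < t := hs.trans_lt hst
    rw [mul_one]
    have hd0 : 0 ≤ (t - s) ^ β := Real.rpow_nonneg (by linarith) _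
    have hF : ∀ u, 0 ≤ u → |g u / (u ^ (a + 1) * √u)| ≤ D * u ^ β := by
      intro u hu
      rcases hu.eq_or_lt with rfl | hu
      · simp [Real.zero_rpow hβ.ne']
      · have : 0 < √u := Real.sqrt_pos.2 hu
        rw [abs_div, abs_of_pos (by positivity : 0 < u ^ (a + 1) * √u), div_le_iff₀ (by positivity)]
        linarith [hgD u hu.le]
    rcases le_total s (t / 2) with hs2 | hs2
    · have h1 : t ^ β ≤ 2 * (t - s) ^ β := by
        calc t ^ β ≤ (2 * (t - s)) ^ β := Real.rpow_le_rpow ht.le (by linarith) hβ.le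
          _ = 2 ^ β * (t - s) ^ β := Real.mul_rpow (by norm_num) (by linarith)
          _ ≤ 2 * (t - s) ^ β := by
            gcongr
            simpa using Real.rpow_le_rpow_of_exponent_le (by norm_num : (1:ℝ) ≤ 2) hβ1
      have h2 : s ^ β ≤ t ^ β := Real.rpow_le_rpow hs hst.le hβ.le
      have h3 := abs_sub (g t / (t ^ (a + 1) * √t)) (g s / (s ^ (a + 1) * √s))
      have h4 := hF t ht.le
      have h5 := hF s hs
      nlinarith [mul_le_mul_of_nonneg_left h1 hD, mul_le_mul_of_nonneg_left h2 hD,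
        mul_nonneg hM0 hd0]
    · have hs0 : 0 < s := by linarith
      have h1 := norm_image_sub_le_of_norm_deriv_le_segment'
        (f := fun t => g t / (t ^ (a + 1) * √t)) (a := s) (b := t)
        (C := 2 * M * (t ^ β / t))
        (fun x hx => (hasDerivAt_div (a + 1) (hs0.trans_le hx.1) (hg' x)).hasDerivWithinAt)
        (fun x hx => ?_) t ⟨hst.le, le_rfl⟩
      · rw [Real.norm_eq_abs] at h1
        refine h1.trans ?_
        have h6 := rpow_mul_div_le hβ1 (sub_pos.2 hst) (by linarith : t - s ≤ t)
        calc 2 * M * (t ^ β / t) * (t - s) = 2 * M * (t ^ β * ((t - s) / t)) := by ring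
          _ ≤ 2 * M * (t - s) ^ β := by gcongr
          _ ≤ _ := by nlinarith
      · have hx0 : 0 < x := hs0.trans_le hx.1
        have hsx : 0 < √x := Real.sqrt_pos.2 hx0
        have h2 : |g' x / (x ^ (a + 1) * √x)| ≤ C * (x ^ β / x) := by
          rw [abs_div, abs_of_pos (by positivity : 0 < x ^ (a + 1) * √x),
            div_le_iff₀ (by positivity)]
          refine (hgC x hx0.le).trans (le_of_eq ?_)
          field_simp
          ring
        have h3 : |g x / (x ^ (a + 1 + 1) * √x)| ≤ D * (x ^ β / x) := by
          rw [abs_div, abs_of_pos (by positivity : 0 < x ^ (a + 1 + 1) * √x),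
            div_le_iff₀ (by positivity)]
          refine (hgD x hx0.le).trans (le_of_eq ?_)
          field_simp
          ring
        have h4 : x ^ β / x ≤ 2 * (t ^ β / t) := by
          rw [mul_div_assoc', div_le_div_iff₀ hx0 ht]
          have h5 : x ^ β ≤ t ^ β := Real.rpow_le_rpow hx0.le hx.2.le hβ.le
          have h6 : 0 ≤ t ^ β := Real.rpow_nonneg ht.le _
          nlinarith [hx.1]
        rw [Real.norm_eq_abs]
        refine (abs_sub _ _).trans ?_
        rw [abs_mul, abs_of_nonneg (by positivity : (0:ℝ) ≤ 1 / 2 + ((a + 1 : ℕ) : ℝ))]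
        calc _ ≤ C * (x ^ β / x) + (1 / 2 + ((a + 1 : ℕ) : ℝ)) * (D * (x ^ β / x)) := by gcongr
          _ = M * (x ^ β / x) := by rw [hM]; ring
          _ ≤ M * (2 * (t ^ β / t)) := by gcongr
          _ = _ := by ring

theorem zeroHolder_div (hβ : 0 < β) (hβ1 : β ≤ 1) : ∀ {n a : ℕ} {g : ℝ → ℝ},
    SqrtHolder β (n + a) g → ZeroHolder β n (fun t => g t / (t ^ a * √t))
  | 0, a, g, hg => zeroHolder_div_zero hβ hβ1 (by rwa [zero_add] at hg)
  | n + 1, a, g, hg => by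
    have hg1 : SqrtHolder β (n + (a + 1)) g := by rwa [show n + (a + 1) = n + 1 + a by ring]
    obtain ⟨C, hC, hb⟩ := hg1.growth hβ.le
    have hgs : SqrtHolder β (n + a + 1) g := hg1
    obtain ⟨hz, g', hg', hg''⟩ := hgs
    refine ⟨fun t ht => by simp [hz t ht],
      fun t => g' t / (t ^ a * √t) - (1 / 2 + a) * (g t / (t ^ (a + 1) * √t)), fun t => ?_,
      (zeroHolder_div hβ hβ1 hg'').sub_const_mul _ (zeroHolder_div hβ hβ1 hg1)⟩
    rcases lt_trichotomy t 0 with ht | rfl | ht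
    · have h0 : g' t / (t ^ a * √t) - (1 / 2 + a) * (g t / (t ^ (a + 1) * √t)) = 0 := by
        simp [hz t ht.le, hg''.eq_zero t ht.le]
      simp only [h0]
      refine (hasDerivAt_const t (0:ℝ)).congr_of_eventuallyEq ?_
      filter_upwards [Iio_mem_nhds ht] with u hu
      simp [hz u (le_of_lt hu)]
    · simp only [Real.sqrt_zero, mul_zero, div_zero, sub_zero]
      rw [hasDerivAt_iff_isLittleO_nhds_zero]
      simp only [Real.sqrt_zero, mul_zero, div_zero, sub_zero, zero_add, smul_zero]
      have h1 : (fun t : ℝ => g t / (t ^ a * √t)) =O[𝓝 0] (fun t : ℝ => |t| ^ β * t) := by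
        refine Asymptotics.IsBigO.of_bound C ?_
        filter_upwards [Ioo_mem_nhds (by norm_num : (-1:ℝ) < 0) (by norm_num : (0:ℝ) < 1)]
          with t ht1
        rcases le_or_gt t 0 with ht | ht
        · rw [hz t ht, zero_div, norm_zero]; positivity
        · have hst : 0 < √t := Real.sqrt_pos.2 ht
          have hp : 0 ≤ t ^ β := Real.rpow_nonneg ht.le _
          rw [Real.norm_eq_abs, Real.norm_eq_abs, abs_div,
            abs_of_pos (by positivity : 0 < t ^ a * √t), div_le_iff₀ (by positivity),
            abs_of_pos ht,
            abs_of_nonneg (by positivity : 0 ≤ t ^ β * t)]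
          refine (hb t ht.le).trans ?_
          have h2 : t ^ (n + (a + 1)) ≤ t ^ (a + 1) :=
            pow_le_pow_of_le_one ht.le ht1.2.le (by omega)
          calc C * t ^ (n + (a + 1)) * √t * t ^ β ≤ C * t ^ (a + 1) * √t * t ^ β := by gcongr
            _ = _ := by ring
      refine h1.trans_isLittleO ?_
      have h2 : (fun t : ℝ => |t| ^ β) =o[𝓝 0] (fun _ => (1:ℝ)) := by
        rw [Asymptotics.isLittleO_one_iff]
        have : Continuous fun t : ℝ => |t| ^ β := continuous_abs.rpow_const fun _ => Or.inr hβ.le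
        simpa [Real.zero_rpow hβ.ne'] using this.tendsto 0
      simpa using h2.mul_isBigO (Asymptotics.isBigO_refl (fun t : ℝ => t) (𝓝 0))
    · exact hasDerivAt_div a ht (hg' t)

end SqrtHolder
end

section
open Filter Topology

theorem DerivChain.exists_deriv {n : ℕ} {α p r : ℝ} {f : ℝ → ℝ} (hf : DerivChain (n + 1) α f p r) :
    ∃ f' : ℝ → ℝ, (∀ x ∈ Ioo (p - r) (p + r), HasDerivAt f (f' x) x) ∧ DerivChain n α f' p r := by
  obtain ⟨d, rfl, hd, hM⟩ := hf
  exact ⟨d 1, hd 0 n.succ_pos, fun j => d (j + 1), rfl, fun j hj => hd (j + 1) (by omega), hM⟩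

theorem Polynomial.exists_derivative_eq (P : Polynomial ℝ) :
    ∃ Q : Polynomial ℝ, Polynomial.derivative Q = P := by
  induction P using Polynomial.induction_on' with
  | add p q hp hq =>
    obtain ⟨p', rfl⟩ := hp
    obtain ⟨q', rfl⟩ := hq
    exact ⟨p' + q', Polynomial.derivative_add⟩
  | monomial n a =>
    refine ⟨Polynomial.monomial (n + 1) (a / (n + 1)), ?_⟩
    rw [Polynomial.derivative_monomial]
    simp only [Nat.add_sub_cancel]
    congr 1
    push_cast
    field_simp

namespace SqrtHolder

variable {β : ℝ} {m n : ℕ} {g h : ℝ → ℝ}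

/-- Taylor-type decomposition: integrating a decomposition of the derivative. -/
theorem decompose_succ (hβ : 0 < β) {f f' : ℝ → ℝ} {δ : ℝ}
    (hf : ∀ t ∈ Icc 0 δ, HasDerivAt f (f' t) t) {P : Polynomial ℝ} (hg : SqrtHolder β m g)
    (h : ∀ t ∈ Icc 0 δ, f' t = P.eval t + g t) :
    ∃ (Q : Polynomial ℝ) (G : ℝ → ℝ), SqrtHolder β (m + 1) G ∧
      ∀ t ∈ Icc 0 δ, f t = Q.eval t + G t := by
  obtain ⟨Q, rfl⟩ := P.exists_derivative_eq
  obtain ⟨G, hG, hGd⟩ := hg.primitive hβ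
  refine ⟨Q + Polynomial.C (f 0 - Q.eval 0 - G 0), G, hG, fun t ht => ?_⟩
  have hD : ∀ u ∈ Icc 0 δ, HasDerivAt (fun u => f u - Q.eval u - G u) 0 u := by
    intro u hu
    refine (((hf u hu).sub (Q.hasDerivAt u)).sub (hGd u)).congr_deriv ?_
    rw [h u hu]; ring
  have := norm_image_sub_le_of_norm_deriv_le_segment' (a := 0) (b := δ) (C := 0)
    (fun u hu => (hD u hu).hasDerivWithinAt) (fun u _ => by simp) t ht
  simp only [zero_mul, norm_le_zero_iff] at this
  simp
  linarith

theorem decompose_zero_of_holder (hβ : 0 < β) {f : ℝ → ℝ} {δ M : ℝ} (hδ : 0 < δ)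
    (hf : ∀ x ∈ Icc 0 δ, ∀ y ∈ Icc 0 δ, |f x - f y| ≤ M * |x - y| ^ (β + 1 / 2)) :
    ∃ (Q : Polynomial ℝ) (G : ℝ → ℝ), SqrtHolder β 0 G ∧
      ∀ t ∈ Icc 0 δ, f t = Q.eval t + G t := by
  refine ⟨Polynomial.C (f 0), fun t => f (max 0 (min t δ)) - f 0, ⟨fun t ht => ?_, |M|,
    abs_nonneg _, ?_⟩, fun t ht => ?_⟩
  · simp only
    rw [max_eq_left ((min_le_left _ _).trans ht), sub_self]
  · refine abs_sub_le_of_zero hβ.le (abs_nonneg M) (fun t => Real.sqrt_nonneg t) (fun t ht => ?_) ?_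
    · rw [max_eq_left ((min_le_left _ _).trans ht), sub_self]
    intro s t hs hst
    have ht : 0 < t := hs.trans_lt hst
    rw [max_eq_right (le_min hs hδ.le), max_eq_right (le_min ht.le hδ.le)]
    have h1 := hf (min t δ) ⟨le_min ht.le hδ.le, min_le_right _ _⟩ (min s δ)
      ⟨le_min hs hδ.le, min_le_right _ _⟩
    have h2 : |min t δ - min s δ| ≤ t - s := by
      have := abs_min_sub_min_le_max t δ s δ
      rw [sub_self, abs_zero, max_eq_left (abs_nonneg _), abs_of_pos (sub_pos.2 hst)] at this
      exact this
    have h3 : |min t δ - min s δ| ^ (β + 1 / 2) ≤ √t * (t - s) ^ β := by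
      calc _ ≤ (t - s) ^ (β + 1 / 2) := Real.rpow_le_rpow (abs_nonneg _) h2 (by linarith)
        _ = √(t - s) * (t - s) ^ β := by
          rw [Real.rpow_add (sub_pos.2 hst), Real.sqrt_eq_rpow, mul_comm]
        _ ≤ _ := by
          have := Real.rpow_nonneg (sub_pos.2 hst).le β
          gcongr
          linarith
    calc _ = |f (min t δ) - f (min s δ)| := by ring_nf
      _ ≤ M * |min t δ - min s δ| ^ (β + 1 / 2) := h1
      _ ≤ |M| * |min t δ - min s δ| ^ (β + 1 / 2) := by
        have := Real.rpow_nonneg (abs_nonneg (min t δ - min s δ)) (β + 1 / 2)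
        gcongr
        exact le_abs_self M
      _ ≤ |M| * (√t * (t - s) ^ β) := by gcongr
      _ = _ := by ring
  · simp only
    rw [min_eq_left ht.2, max_eq_right ht.1]; simp

theorem decompose_zero_of_deriv_holder (hβ : 1 / 2 < β) (hβ1 : β < 1) {f f' : ℝ → ℝ} {δ M : ℝ}
    (hδ : 0 < δ) (hfd : ∀ x ∈ Icc 0 δ, HasDerivAt f (f' x) x)
    (hf : ∀ x ∈ Icc 0 δ, ∀ y ∈ Icc 0 δ, |f' x - f' y| ≤ M * |x - y| ^ (β - 1 / 2)) :
    ∃ (Q : Polynomial ℝ) (G : ℝ → ℝ), SqrtHolder β 0 G ∧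
      ∀ t ∈ Icc 0 δ, f t = Q.eval t + G t := by
  set q : ℝ → ℝ := fun t => f t - f 0 - f' 0 * t with hq
  have hqz : ∀ t ≤ 0, q (max 0 (min t δ)) = 0 := fun t ht => by
    rw [max_eq_left ((min_le_left _ _).trans ht)]; simp [hq]
  have hqd : ∀ x ∈ Icc 0 δ, HasDerivAt q (f' x - f' 0) x := fun x hx => by
    exact (((hfd x hx).sub_const (f 0)).fun_sub
      ((hasDerivAt_id x).const_mul (f' 0))).congr_deriv (by simp)
  refine ⟨Polynomial.C (f 0) + Polynomial.C (f' 0) * Polynomial.X, fun t => q (max 0 (min t δ)),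
    ⟨hqz, |M|, abs_nonneg _, ?_⟩, fun t ht => ?_⟩
  · refine abs_sub_le_of_zero (by linarith) (abs_nonneg M) (fun t => Real.sqrt_nonneg t) hqz ?_
    intro s t hs hst
    have ht : 0 < t := hs.trans_lt hst
    rw [max_eq_right (le_min hs hδ.le), max_eq_right (le_min ht.le hδ.le)]
    have hmm : min s δ ≤ min t δ := min_le_min_right _ hst.le
    have h2 : min t δ - min s δ ≤ t - s := by
      have := abs_min_sub_min_le_max t δ s δ
      rw [sub_self, abs_zero, max_eq_left (abs_nonneg _), abs_of_pos (sub_pos.2 hst)] at this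
      exact (le_abs_self _).trans this
    have hsub : ∀ x ∈ Icc (min s δ) (min t δ), x ∈ Icc 0 δ := fun x hx =>
      ⟨(le_min hs hδ.le).trans hx.1, hx.2.trans (min_le_right _ _)⟩
    have h1 := norm_image_sub_le_of_norm_deriv_le_segment' (a := min s δ) (b := min t δ)
      (C := |M| * t ^ (β - 1 / 2)) (fun u hu => (hqd u (hsub u hu)).hasDerivWithinAt)
      (fun u hu => ?_) (min t δ) ⟨hmm, le_rfl⟩
    · refine h1.trans ?_
      have h3 : (t - s) = (t - s) ^ β * (t - s) ^ (1 - β) := by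
        rw [← Real.rpow_add (sub_pos.2 hst)]; simp
      have h4 : (t - s) ^ (1 - β) ≤ t ^ (1 - β) :=
        Real.rpow_le_rpow (by linarith) (by linarith) (by linarith)
      have h5 : t ^ (β - 1 / 2) * t ^ (1 - β) = √t := by
        rw [← Real.rpow_add ht, Real.sqrt_eq_rpow]; congr 1; ring
      have h6 := Real.rpow_nonneg (sub_pos.2 hst).le β
      have h7 := Real.rpow_nonneg ht.le (β - 1 / 2)
      calc _ ≤ |M| * t ^ (β - 1 / 2) * (t - s) := by gcongr
        _ = |M| * t ^ (β - 1 / 2) * ((t - s) ^ β * (t - s) ^ (1 - β)) := by rw [← h3]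
        _ ≤ |M| * t ^ (β - 1 / 2) * ((t - s) ^ β * t ^ (1 - β)) := by gcongr
        _ = |M| * (t ^ (β - 1 / 2) * t ^ (1 - β)) * (t - s) ^ β := by ring
        _ = _ := by rw [h5]
    · have hu' := hsub u (Ico_subset_Icc_self hu)
      have h3 := hf u hu' 0 ⟨le_rfl, hδ.le⟩
      rw [sub_zero, abs_of_nonneg hu'.1] at h3
      rw [Real.norm_eq_abs]
      refine h3.trans ?_
      have h4 : u ^ (β - 1 / 2) ≤ t ^ (β - 1 / 2) :=
        Real.rpow_le_rpow hu'.1 (hu.2.le.trans (min_le_left _ _)) (by linarith)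
      have h5 := Real.rpow_nonneg hu'.1 (β - 1 / 2)
      gcongr
      exact le_abs_self M
  · simp only
    rw [min_eq_left ht.2, max_eq_right ht.1]
    simp [hq]

theorem decompose (hβ : 0 < β) (hβ1 : β < 1) {r δ : ℝ} (hδ : 0 < δ) (hδr : δ < r) :
    ∀ {k : ℕ} {f : ℝ → ℝ}, (β ≤ 1 / 2 → DerivChain k (β + 1 / 2) f 0 r) →
    (1 / 2 < β → DerivChain (k + 1) (β - 1 / 2) f 0 r) →
    ∃ (Q : Polynomial ℝ) (G : ℝ → ℝ), SqrtHolder β k G ∧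
      ∀ t ∈ Icc 0 δ, f t = Q.eval t + G t
  | 0, f, h1, h2 => by
    have hs : ∀ x ∈ Icc 0 δ, x ∈ Ioo (0 - r) (0 + r) := fun x hx =>
      ⟨by linarith [hx.1], by linarith [hx.2]⟩
    rcases le_or_gt β (1 / 2) with hb | hb
    · obtain ⟨d, rfl, -, M, hM⟩ := h1 hb
      exact decompose_zero_of_holder hβ hδ fun x hx y hy => hM x (hs x hx) y (hs y hy)
    · obtain ⟨f', hf', d, rfl, -, M, hM⟩ := (h2 hb).exists_deriv
      exact decompose_zero_of_deriv_holder hb hβ1 hδ (fun x hx => hf' x (hs x hx))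
        fun x hx y hy => hM x (hs x hx) y (hs y hy)
  | k + 1, f, h1, h2 => by
    have hs : ∀ x ∈ Icc 0 δ, x ∈ Ioo (0 - r) (0 + r) := fun x hx =>
      ⟨by linarith [hx.1], by linarith [hx.2]⟩
    have key : ∃ f' : ℝ → ℝ, (∀ x ∈ Ioo (0 - r) (0 + r), HasDerivAt f (f' x) x) ∧
        (β ≤ 1 / 2 → DerivChain k (β + 1 / 2) f' 0 r) ∧
        (1 / 2 < β → DerivChain (k + 1) (β - 1 / 2) f' 0 r) := by
      rcases le_or_gt β (1 / 2) with hb | hb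
      · obtain ⟨f', hf', hc⟩ := (h1 hb).exists_deriv
        exact ⟨f', hf', fun _ => hc, fun h => absurd hb h.not_ge⟩
      · obtain ⟨f', hf', hc⟩ := (h2 hb).exists_deriv
        exact ⟨f', hf', fun h => absurd hb h.not_gt, fun _ => hc⟩
    obtain ⟨f', hf', hc1, hc2⟩ := key
    obtain ⟨P, g, hg, h⟩ := decompose hβ hβ1 hδ hδr hc1 hc2
    exact decompose_succ hβ (fun t ht => hf' t (hs t ht)) hg h

end SqrtHolder
end

section
open Filter Topology

theorem intervalIntegrable_abs_rpow {r : ℝ} (hr : -1 < r) (a b : ℝ) :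
    IntervalIntegrable (fun x : ℝ => |x| ^ r) volume a b := by
  refine intervalIntegrable_of_even (fun x => by rw [abs_neg]) fun x hx => ?_
  refine (intervalIntegral.intervalIntegrable_rpow' hr (a := 0) (b := x)).congr ?_
  intro y hy
  rw [uIoc_of_le hx.le] at hy
  simp only
  rw [abs_of_pos hy.1]

theorem abs_log_add_one_sub_le {x : ℝ} (hx : 2 ≤ |x|) :
    |Real.log (x + 1) - Real.log x - 1 / x| ≤ 2 * |x| ^ (-2 : ℝ) := by
  have hx0 : 0 < |x| := by linarith
  have hxne : x ≠ 0 := abs_pos.1 hx0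
  have h1 : |-(1 / x)| ≤ 1 / 2 := by
    rw [abs_neg, abs_div, abs_one, div_le_div_iff₀ hx0 (by norm_num)]; linarith
  have h2 := Real.abs_log_sub_add_sum_range_le (x := -(1 / x)) (by linarith) 1
  simp only [Finset.sum_range_one] at h2
  have hne : x + 1 ≠ 0 := fun h => by
    have : x = -1 := by linarith
    rw [this] at hx; norm_num at hx
  have e1 : Real.log (1 - -(1 / x)) = Real.log (x + 1) - Real.log x := by
    rw [← Real.log_div hne hxne]; congr 1; field_simp; ring
  rw [e1] at h2
  calc |Real.log (x + 1) - Real.log x - 1 / x| = _ := by congr 1; push_cast; ring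
    _ ≤ _ := h2
    _ ≤ |-(1 / x)| ^ (1 + 1) / (1 / 2) := by gcongr; linarith
    _ = 2 * |x| ^ (-2 : ℝ) := by
      rw [show (-2 : ℝ) = ((-2 : ℤ) : ℝ) by norm_num, Real.rpow_intCast, abs_neg, abs_div, abs_one]
      simp [zpow_neg]
      field_simp

theorem measurable_abs_rpow (r : ℝ) : Measurable fun x : ℝ => |x| ^ r :=
  (measurable_id.abs).pow_const r

theorem integrable_log_kernel {β : ℝ} (hβ : 0 < β) (hβ1 : β < 1) :
    Integrable fun x : ℝ => (Real.log (x + 1) - Real.log x - 1 / x) * |x| ^ β := by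
  have hmeas : Measurable fun x : ℝ => (Real.log (x + 1) - Real.log x - 1 / x) * |x| ^ β :=
    (((Real.measurable_log.comp (measurable_id.add_const 1)).sub Real.measurable_log).sub
      (measurable_const.div measurable_id)).mul (measurable_abs_rpow β)
  have hpos : IntegrableOn (fun x : ℝ => 2 * x ^ (β - 2)) (Ioi 2) :=
    (integrableOn_Ioi_rpow_of_lt (by linarith) (by norm_num)).const_mul 2
  have hbd : ∀ x : ℝ, 2 < |x| → ‖(Real.log (x + 1) - Real.log x - 1 / x) * |x| ^ β‖ ≤
      2 * |x| ^ (β - 2) := by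
    intro x hx
    rw [norm_mul, Real.norm_eq_abs, Real.norm_eq_abs,
      abs_of_nonneg (Real.rpow_nonneg (abs_nonneg x) β)]
    calc _ ≤ 2 * |x| ^ (-2 : ℝ) * |x| ^ β :=
          mul_le_mul_of_nonneg_right (abs_log_add_one_sub_le hx.le)
            (Real.rpow_nonneg (abs_nonneg x) β)
      _ = _ := by rw [mul_assoc, ← Real.rpow_add (by linarith)]; congr 2; ring
  have h1 : IntegrableOn (fun x : ℝ => (Real.log (x + 1) - Real.log x - 1 / x) * |x| ^ β)
      (Ioi 2) := by
    refine hpos.mono' hmeas.aestronglyMeasurable ?_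
    refine ae_restrict_of_forall_mem measurableSet_Ioi fun x hx => ?_
    have hx' : (2:ℝ) < x := hx
    have := hbd x (by rwa [abs_of_pos (by linarith)])
    rwa [abs_of_pos (show 0 < x by linarith)] at this ⊢
  have h2 : IntegrableOn (fun x : ℝ => (Real.log (x + 1) - Real.log x - 1 / x) * |x| ^ β)
      (Iio (-2)) := by
    have hpos' : IntegrableOn (fun x : ℝ => 2 * x ^ (β - 2)) (Ioi (-(-2 : ℝ))) := by
      rwa [neg_neg]
    refine hpos'.comp_neg_Iio.mono' hmeas.aestronglyMeasurable ?_
    refine ae_restrict_of_forall_mem measurableSet_Iio fun x hx => ?_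
    have hx' : x < -2 := hx
    have := hbd x (by rw [abs_of_neg (by linarith)]; linarith)
    rwa [abs_of_neg (show x < 0 by linarith)] at this ⊢
  have h3 : IntegrableOn (fun x : ℝ => (Real.log (x + 1) - Real.log x - 1 / x) * |x| ^ β)
      (Icc (-2) 2) := by
    rw [← intervalIntegrable_iff_integrableOn_Icc_of_le (by norm_num)]
    have hlog : IntervalIntegrable (fun x : ℝ => Real.log (x + 1) - Real.log x) volume (-2) 2 :=
      (by simpa using (intervalIntegral.intervalIntegrable_log'
        (a := -2 + 1) (b := 2 + 1)).comp_add_right 1 :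
        IntervalIntegrable (fun x : ℝ => Real.log (x + 1)) volume (-2) 2).sub
        intervalIntegral.intervalIntegrable_log'
    have hc : Continuous fun x : ℝ => |x| ^ β := continuous_abs.rpow_const fun _ => Or.inr hβ.le
    have ha := hlog.mul_continuousOn hc.continuousOn
    have hb : IntervalIntegrable (fun x : ℝ => 1 / x * |x| ^ β) volume (-2) 2 := by
      refine (intervalIntegrable_abs_rpow (r := β - 1) (by linarith) (-2) 2).mono_fun
        ((measurable_const.div measurable_id).mul (measurable_abs_rpow β)).aestronglyMeasurable
        (Eventually.of_forall fun x => ?_)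
      simp only
      rw [norm_mul, Real.norm_eq_abs, Real.norm_eq_abs, Real.norm_eq_abs,
        abs_of_nonneg (Real.rpow_nonneg (abs_nonneg x) β),
        abs_of_nonneg (Real.rpow_nonneg (abs_nonneg x) (β - 1)), abs_div, abs_one]
      rcases eq_or_ne x 0 with rfl | hx
      · simp [Real.zero_rpow hβ.ne', Real.rpow_nonneg]
      · rw [Real.rpow_sub_one (abs_pos.2 hx).ne']
        exact le_of_eq (by ring)
    refine (ha.sub hb).congr fun x _ => ?_
    ring
  have hu : (Iio (-2) ∪ Icc (-2) 2) ∪ Ioi 2 = (univ : Set ℝ) := by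
    ext x
    simp only [mem_union, mem_Iio, mem_Icc, mem_Ioi, mem_univ, iff_true]
    rcases lt_or_ge x (-2) with h | h
    · exact Or.inl (Or.inl h)
    · rcases le_or_gt x 2 with h' | h'
      · exact Or.inl (Or.inr ⟨h, h'⟩)
      · exact Or.inr h'
  rw [← integrableOn_univ, ← hu]
  exact (h2.union h3).union h1

theorem exists_log_kernel_bound {β : ℝ} (hβ : 0 < β) (hβ1 : β < 1) :
    ∃ κ, 0 ≤ κ ∧ ∀ X X₀ : ℝ, X ≠ X₀ → 
      Integrable (fun t => |(Real.log (X - t) - Real.log (X₀ - t) - (X - X₀) / (X₀ - t))| *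
        |X₀ - t| ^ β) ∧
      ∫ t, |(Real.log (X - t) - Real.log (X₀ - t) - (X - X₀) / (X₀ - t))| * |X₀ - t| ^ β
        ≤ κ * |X - X₀| ^ (1 + β) := by
  have hI := (integrable_log_kernel hβ hβ1).abs
  refine ⟨∫ x, |(Real.log (x + 1) - Real.log x - 1 / x) * |x| ^ β|,
    integral_nonneg fun _ => abs_nonneg _, fun X X₀ hne => ?_⟩
  set η := X - X₀ with hη
  have hη0 : η ≠ 0 := sub_ne_zero.2 hne
  have hI2 := (hI.comp_div hη0).comp_sub_left X₀
  have hae : (fun t => |(Real.log (X - t) - Real.log (X₀ - t) - η / (X₀ - t))| * |X₀ - t| ^ β)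
      =ᵐ[volume] fun t => |η| ^ β * |(Real.log ((X₀ - t) / η + 1) - Real.log ((X₀ - t) / η) -
        1 / ((X₀ - t) / η)) * |(X₀ - t) / η| ^ β| := by
    have h0 : ∀ᵐ t ∂(volume : Measure ℝ), t ∉ ({X, X₀} : Set ℝ) :=
      measure_eq_zero_iff_ae_notMem.1 ((Set.toFinite _).measure_zero _)
    filter_upwards [h0] with t ht
    simp only [mem_insert_iff, mem_singleton_iff, not_or] at ht
    have h1 : X - t ≠ 0 := sub_ne_zero.2 (Ne.symm ht.1)
    have h2 : X₀ - t ≠ 0 := sub_ne_zero.2 (Ne.symm ht.2)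
    have e1 : (X₀ - t) / η + 1 = (X - t) / η := by field_simp; rw [hη]; ring
    rw [e1, Real.log_div h1 hη0, Real.log_div h2 hη0, abs_mul,
      abs_of_nonneg (Real.rpow_nonneg (abs_nonneg _) β), abs_div,
      Real.div_rpow (abs_nonneg _) (abs_nonneg _), one_div_div]
    have h3 : |η| ^ β ≠ 0 := (Real.rpow_pos_of_pos (abs_pos.2 hη0) _).ne'
    field_simp
    congr 2
    ring
  refine ⟨(hI2.const_mul (|η| ^ β)).congr hae.symm, ?_⟩
  rw [integral_congr_ae hae, integral_const_mul, integral_sub_left_eq_self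
    (fun t => |(Real.log (t / η + 1) - Real.log (t / η) - 1 / (t / η)) * |t / η| ^ β|) volume X₀,
    Measure.integral_comp_div (fun t => |(Real.log (t + 1) - Real.log t - 1 / t) * |t| ^ β|)]
  rw [Real.rpow_add (abs_pos.2 hη0), Real.rpow_one, smul_eq_mul]
  exact le_of_eq (by ring)
end

section
open Filter Topology

/-- The logarithmic potential of `f` restricted to `[-δ, δ]`. -/
noncomputable def logPot (δ : ℝ) (f : ℝ → ℝ) (X : ℝ) : ℝ := ∫ t in -δ..δ, Real.log (X - t) * f t

/-- The finite Hilbert transform of `f` on `[-δ, δ]`, written with a regularized kernel. -/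
noncomputable def finHilbert (δ : ℝ) (f : ℝ → ℝ) (X : ℝ) : ℝ :=
  (∫ t in -δ..δ, (f t - f X) / (X - t)) + f X * (Real.log (δ + X) - Real.log (δ - X))

theorem intervalIntegrable_log_sub (X a b : ℝ) :
    IntervalIntegrable (fun t => Real.log (X - t)) volume a b := by
  simpa using (intervalIntegral.intervalIntegrable_log' (a := X - a) (b := X - b)).comp_sub_left X

theorem integral_log_sub (δ X : ℝ) : ∫ t in -δ..δ, Real.log (X - t) =
    (δ - X) * Real.log (δ - X) + (δ + X) * Real.log (δ + X) - 2 * δ := by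
  rw [intervalIntegral.integral_comp_sub_left (fun t => Real.log t) X, integral_log,
    ← Real.log_neg_eq_log (X - δ)]
  ring_nf

theorem continuousOn_of_abs_sub_le {β L : ℝ} (hβ : 0 < β) {f : ℝ → ℝ} {s : Set ℝ}
    (hf : ∀ x ∈ s, ∀ y ∈ s, |f x - f y| ≤ L * |x - y| ^ β) : ContinuousOn f s := by
  intro x hx
  have h2 : Tendsto (fun y => L * |y - x| ^ β) (𝓝[s] x) (𝓝 0) := by
    have : Continuous fun y => L * |y - x| ^ β :=
      continuous_const.mul ((continuous_abs.comp (continuous_id.sub continuous_const)).rpow_const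
        fun _ => Or.inr hβ.le)
    simpa [Real.zero_rpow hβ.ne'] using (this.tendsto x).mono_left nhdsWithin_le_nhds
  rw [ContinuousWithinAt, tendsto_iff_dist_tendsto_zero]
  refine squeeze_zero' (Eventually.of_forall fun _ => dist_nonneg) ?_ h2
  filter_upwards [self_mem_nhdsWithin] with y hy
  rw [Real.dist_eq]
  exact hf y hy x hx

theorem abs_taylor_le {s : Set ℝ} (hs : Convex ℝ s) {g g' g'' : ℝ → ℝ} {M : ℝ}
    (hg : ∀ x ∈ s, HasDerivAt g (g' x) x) (hg' : ∀ x ∈ s, HasDerivAt g' (g'' x) x)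
    (hM : ∀ x ∈ s, |g'' x| ≤ M) {x y : ℝ} (hx : x ∈ s) (hy : y ∈ s) :
    |g x - g y - (x - y) * g' y| ≤ M * |x - y| ^ 2 := by
  have h1 : ∀ z ∈ s, |g' z - g' y| ≤ M * |z - y| := fun z hz =>
    hs.norm_image_sub_le_of_norm_hasDerivWithin_le (fun u hu => (hg' u hu).hasDerivWithinAt)
      (fun u hu => hM u hu) hy hz
  have hseg : segment ℝ y x ⊆ s := hs.segment_subset hy hx
  have h2 := (convex_segment y x).norm_image_sub_le_of_norm_hasDerivWithin_le
    (f := fun z => g z - z * g' y) (f' := fun z => g' z - 1 * g' y) (C := M * |x - y|)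
    (fun u hu => ((hg u (hseg hu)).fun_sub ((hasDerivAt_id u).mul_const _)).hasDerivWithinAt)
    (fun u hu => ?_) (left_mem_segment ℝ y x) (right_mem_segment ℝ y x)
  · rw [Real.norm_eq_abs, Real.norm_eq_abs] at h2
    calc _ = |g x - x * g' y - (g y - y * g' y)| := by ring_nf
      _ ≤ _ := h2
      _ = _ := by ring
  · rw [one_mul, Real.norm_eq_abs]
    refine (h1 u (hseg hu)).trans ?_
    have hM0 : 0 ≤ M := (abs_nonneg _).trans (hM y hy)
    have h3 : |u - y| ≤ |x - y| := by
      rw [segment_eq_uIcc] at hu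
      exact abs_sub_left_of_mem_uIcc hu
    gcongr

section
variable {β δ L : ℝ} {f : ℝ → ℝ}

theorem intervalIntegrable_div_sub (hβ : 0 < β) (hδ : 0 < δ)
    (hf : ∀ x ∈ Icc (-δ) δ, ∀ y ∈ Icc (-δ) δ, |f x - f y| ≤ L * |x - y| ^ β) {X : ℝ}
    (hX : X ∈ Icc (-δ) δ) :
    IntervalIntegrable (fun t => (f t - f X) / (X - t)) volume (-δ) δ := by
  have hfc := continuousOn_of_abs_sub_le hβ hf
  rw [intervalIntegrable_iff_integrableOn_Icc_of_le (by linarith)]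
  have h1 : IntegrableOn (fun t => L * |X - t| ^ (β - 1)) (Icc (-δ) δ) := by
    rw [← intervalIntegrable_iff_integrableOn_Icc_of_le (by linarith)]
    have :=
      (intervalIntegrable_abs_rpow (r := β - 1) (by linarith) (X - -δ) (X - δ)).comp_sub_left X
    simp only [sub_sub_cancel] at this
    exact this.const_mul L
  refine h1.mono' ?_ ?_
  · exact ((hfc.sub continuousOn_const).aestronglyMeasurable measurableSet_Icc).mul
      (by fun_prop : Measurable fun t : ℝ => (X - t)⁻¹).aestronglyMeasurable
  · refine ae_restrict_of_forall_mem measurableSet_Icc fun t ht => ?_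
    rw [Real.norm_eq_abs, abs_div]
    rcases eq_or_ne X t with rfl | hne
    · have := hf 1
      simp only [sub_self, abs_zero, div_zero]
      have h2 := hf (-δ) ⟨le_rfl, by linarith⟩ δ ⟨by linarith, le_rfl⟩
      have hL : 0 ≤ L := by
        by_contra h
        push Not at h
        have : 0 < |(-δ) - δ| ^ β := Real.rpow_pos_of_pos (abs_pos.2 (by linarith)) _
        nlinarith [abs_nonneg (f (-δ) - f δ)]
      exact mul_nonneg hL (Real.rpow_nonneg le_rfl _)
    · have h3 : 0 < |X - t| := abs_pos.2 (sub_ne_zero.2 hne)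
      rw [div_le_iff₀ h3, Real.rpow_sub_one h3.ne']
      have := hf t ht X hX
      rw [abs_sub_comm t X] at this
      calc _ ≤ _ := this
        _ = _ := by field_simp

theorem logPot_expansion (hβ : 0 < β) (hβ1 : β < 1) (hδ : 0 < δ)
    (hf : ∀ x ∈ Icc (-δ) δ, ∀ y ∈ Icc (-δ) δ, |f x - f y| ≤ L * |x - y| ^ β) :
    ∃ C, 0 ≤ C ∧ ∀ X ∈ Ioo (-(δ / 2)) (δ / 2), ∀ X₀ ∈ Ioo (-(δ / 2)) (δ / 2),
      |logPot δ f X - logPot δ f X₀ - (X - X₀) * finHilbert δ f X₀| ≤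
        C * |X - X₀| ^ (1 + β) := by
  obtain ⟨κ, hκ, hK⟩ := exists_log_kernel_bound hβ hβ1
  have hfc := continuousOn_of_abs_sub_le hβ hf
  have hle : -δ ≤ δ := by linarith
  obtain ⟨B, hB⟩ := isCompact_Icc.exists_bound_of_continuousOn hfc
  have hB0 : 0 ≤ B := (norm_nonneg _).trans (hB 0 ⟨by linarith, hδ.le⟩)
  have hfc' : ContinuousOn f (uIcc (-δ) δ) := by rwa [uIcc_of_le hle]
  refine ⟨|L| * κ + B * (4 / δ * δ ^ (1 - β)), by positivity, fun X hX X₀ hX₀ => ?_⟩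
  rcases eq_or_ne X X₀ with rfl | hne
  · simp only [sub_self, zero_mul, abs_zero]
    positivity
  have hX₀' : X₀ ∈ Icc (-δ) δ := ⟨by linarith [hX₀.1], by linarith [hX₀.2]⟩
  obtain ⟨hKi, hKb⟩ := hK X X₀ hne
  set η := X - X₀ with hη
  have hηδ : |η| ≤ δ := by
    rw [abs_le]; constructor <;> linarith [hX.1, hX.2, hX₀.1, hX₀.2]
  have hη0 : 0 < |η| := abs_pos.2 (sub_ne_zero.2 hne)
  have i1 : ∀ Y : ℝ, IntervalIntegrable (fun t => Real.log (Y - t) * f t) volume (-δ) δ :=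
    fun Y => (intervalIntegrable_log_sub Y _ _).mul_continuousOn hfc'
  have i2 := intervalIntegrable_div_sub hβ hδ hf hX₀'
  have i3 := fun Y => intervalIntegrable_log_sub Y (-δ) δ
  have e1 : logPot δ f X - logPot δ f X₀ - η * finHilbert δ f X₀ =
      (∫ t in -δ..δ, (Real.log (X - t) - Real.log (X₀ - t) - η / (X₀ - t)) * (f t - f X₀)) +
      f X₀ * ((∫ t in -δ..δ, Real.log (X - t)) - (∫ t in -δ..δ, Real.log (X₀ - t)) -
        η * (Real.log (δ + X₀) - Real.log (δ - X₀))) := by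
    have e2 : (∫ t in -δ..δ, (Real.log (X - t) - Real.log (X₀ - t) - η / (X₀ - t)) *
        (f t - f X₀)) = ∫ t in -δ..δ, (((Real.log (X - t) * f t - Real.log (X₀ - t) * f t) -
          f X₀ * (Real.log (X - t) - Real.log (X₀ - t))) - η * ((f t - f X₀) / (X₀ - t))) := by
      congr 1; ext t; ring
    rw [e2, intervalIntegral.integral_sub (((i1 X).sub (i1 X₀)).sub
        (((i3 X).sub (i3 X₀)).const_mul _)) (i2.const_mul _),
      intervalIntegral.integral_sub ((i1 X).sub (i1 X₀)) (((i3 X).sub (i3 X₀)).const_mul _),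
      intervalIntegral.integral_sub (i1 X) (i1 X₀), intervalIntegral.integral_const_mul,
      intervalIntegral.integral_const_mul, intervalIntegral.integral_sub (i3 X) (i3 X₀)]
    unfold logPot finHilbert
    ring
  rw [e1]
  have b1 : |∫ t in -δ..δ, (Real.log (X - t) - Real.log (X₀ - t) - η / (X₀ - t)) *
      (f t - f X₀)| ≤ |L| * κ * |η| ^ (1 + β) := by
    rw [intervalIntegral.integral_of_le hle, ← integral_Icc_eq_integral_Ioc, ← Real.norm_eq_abs]
    refine (norm_integral_le_of_norm_le (hKi.const_mul |L|).integrableOn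
      (ae_restrict_of_forall_mem measurableSet_Icc fun t ht => ?_)).trans ?_
    · rw [norm_mul, Real.norm_eq_abs, Real.norm_eq_abs]
      have h1 := hf t ht X₀ hX₀'
      rw [abs_sub_comm t] at h1
      have h2 : |f t - f X₀| ≤ |L| * |X₀ - t| ^ β := h1.trans
        (mul_le_mul_of_nonneg_right (le_abs_self L) (Real.rpow_nonneg (abs_nonneg _) _))
      calc _ ≤ |Real.log (X - t) - Real.log (X₀ - t) - η / (X₀ - t)| * (|L| * |X₀ - t| ^ β) := by
            gcongr
        _ = _ := by ring
    · refine (setIntegral_le_integral (hKi.const_mul |L|)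
        (Eventually.of_forall fun t => ?_)).trans ?_
      · exact mul_nonneg (abs_nonneg _) (mul_nonneg (abs_nonneg _)
          (Real.rpow_nonneg (abs_nonneg _) _))
      · rw [integral_const_mul, mul_assoc]
        gcongr
  have b2 : |(∫ t in -δ..δ, Real.log (X - t)) - (∫ t in -δ..δ, Real.log (X₀ - t)) -
        η * (Real.log (δ + X₀) - Real.log (δ - X₀))| ≤ 4 / δ * δ ^ (1 - β) * |η| ^ (1 + β) := by
    rw [integral_log_sub, integral_log_sub]
    have h1 := abs_taylor_le (convex_Ioo (-(δ / 2)) (δ / 2))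
      (g := fun X => (δ - X) * Real.log (δ - X) + (δ + X) * Real.log (δ + X) - 2 * δ)
      (g' := fun X => Real.log (δ + X) - Real.log (δ - X))
      (g'' := fun X => 1 / (δ + X) + 1 / (δ - X)) (M := 4 / δ) ?_ ?_ ?_ hX hX₀
    · refine h1.trans ?_
      rw [mul_assoc]
      gcongr
      calc |X - X₀| ^ 2 = |η| ^ (1 - β) * |η| ^ (1 + β) := by
            rw [← Real.rpow_add hη0, ← Real.rpow_natCast]; congr 1; norm_num
        _ ≤ _ := by
          have := Real.rpow_nonneg hη0.le (1 + β)
          gcongr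
    · intro x hx
      have h2 : HasDerivAt (fun x => δ - x) (-1) x := by simpa using (hasDerivAt_id x).const_sub δ
      have h3 : HasDerivAt (fun x => δ + x) 1 x := by simpa using (hasDerivAt_id x).const_add δ
      have h4 : δ - x ≠ 0 := by linarith [hx.2]
      have h5 : δ + x ≠ 0 := by linarith [hx.1]
      refine (((h2.fun_mul (h2.log h4)).fun_add (h3.fun_mul (h3.log h5))).sub_const
        (2 * δ)).congr_deriv ?_
      field_simp
      ring
    · intro x hx
      have h2 : HasDerivAt (fun x => δ - x) (-1) x := by simpa using (hasDerivAt_id x).const_sub δ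
      have h3 : HasDerivAt (fun x => δ + x) 1 x := by simpa using (hasDerivAt_id x).const_add δ
      have h4 : δ - x ≠ 0 := by linarith [hx.2]
      have h5 : δ + x ≠ 0 := by linarith [hx.1]
      refine ((h3.log h5).fun_sub (h2.log h4)).congr_deriv ?_
      field_simp
      ring
    · intro x hx
      have h4 : δ / 2 ≤ δ - x := by linarith [hx.2]
      have h5 : δ / 2 ≤ δ + x := by linarith [hx.1]
      have hδ2 : 0 < δ / 2 := by linarith
      rw [abs_of_pos (by have := hδ2.trans_le h4; have := hδ2.trans_le h5; positivity)]
      calc 1 / (δ + x) + 1 / (δ - x) ≤ 1 / (δ / 2) + 1 / (δ / 2) :=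
            add_le_add (one_div_le_one_div_of_le hδ2 h5) (one_div_le_one_div_of_le hδ2 h4)
        _ = 4 / δ := by field_simp; norm_num
  have b3 : |f X₀| ≤ B := by simpa using hB X₀ hX₀'
  calc _ ≤ |L| * κ * |η| ^ (1 + β) + B * (4 / δ * δ ^ (1 - β) * |η| ^ (1 + β)) := by
        refine (abs_add_le _ _).trans (add_le_add b1 ?_)
        rw [abs_mul]
        gcongr
    _ = _ := by ring

theorem logPot_hasDerivAt (hβ : 0 < β) (hβ1 : β < 1) (hδ : 0 < δ)
    (hf : ∀ x ∈ Icc (-δ) δ, ∀ y ∈ Icc (-δ) δ, |f x - f y| ≤ L * |x - y| ^ β) :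
    (∀ X ∈ Ioo (-(δ / 2)) (δ / 2), HasDerivAt (logPot δ f) (finHilbert δ f X) X) ∧
    ∃ C, ∀ X ∈ Ioo (-(δ / 2)) (δ / 2), ∀ Y ∈ Ioo (-(δ / 2)) (δ / 2),
      |finHilbert δ f X - finHilbert δ f Y| ≤ C * |X - Y| ^ β := by
  obtain ⟨C, hC, h⟩ := logPot_expansion hβ hβ1 hδ hf
  constructor
  · intro X hX
    rw [hasDerivAt_iff_isLittleO]
    have h1 : (fun Y => logPot δ f Y - logPot δ f X - (Y - X) • finHilbert δ f X) =O[𝓝 X]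
        fun Y => |Y - X| ^ β * (Y - X) := by
      refine Asymptotics.IsBigO.of_bound C ?_
      filter_upwards [isOpen_Ioo.mem_nhds hX] with Y hY
      have h2 := h Y hY X hX
      rw [Real.norm_eq_abs, norm_mul, Real.norm_eq_abs, Real.norm_eq_abs,
        abs_of_nonneg (Real.rpow_nonneg (abs_nonneg _) _), smul_eq_mul]
      refine h2.trans (le_of_eq ?_)
      rw [Real.rpow_add_of_nonneg (abs_nonneg _) zero_le_one hβ.le, Real.rpow_one,
        mul_comm (|Y - X|)]
    refine h1.trans_isLittleO ?_
    have h2 : (fun Y : ℝ => |Y - X| ^ β) =o[𝓝 X] (fun _ => (1:ℝ)) := by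
      rw [Asymptotics.isLittleO_one_iff]
      have : Continuous fun Y : ℝ => |Y - X| ^ β :=
        (continuous_abs.comp (continuous_id.sub continuous_const)).rpow_const
          fun _ => Or.inr hβ.le
      simpa [Real.zero_rpow hβ.ne'] using this.tendsto X
    simpa using h2.mul_isBigO (Asymptotics.isBigO_refl (fun Y : ℝ => Y - X) (𝓝 X))
  · refine ⟨2 * C, fun X hX Y hY => ?_⟩
    rcases eq_or_ne X Y with rfl | hne
    · simp only [sub_self, abs_zero]
      exact mul_nonneg (by positivity) (Real.rpow_nonneg le_rfl _)
    have h1 := h X hX Y hY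
    have h2 := h Y hY X hX
    have h3 : 0 < |X - Y| := abs_pos.2 (sub_ne_zero.2 hne)
    rw [abs_sub_comm Y X] at h2
    have h4 : |(X - Y) * (finHilbert δ f X - finHilbert δ f Y)| ≤ 2 * C * |X - Y| ^ (1 + β) := by
      calc _ = |(logPot δ f X - logPot δ f Y - (X - Y) * finHilbert δ f Y) +
            (logPot δ f Y - logPot δ f X - (Y - X) * finHilbert δ f X)| := by congr 1; ring
        _ ≤ _ := abs_add_le _ _
        _ ≤ _ := by linarith
    rw [abs_mul, Real.rpow_add h3, Real.rpow_one] at h4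
    nlinarith

end
end

section
open Filter Topology

variable {β δ L : ℝ} {f : ℝ → ℝ}

/-- The product of a differentiable function vanishing at `X` with the logarithm is continuous. -/
theorem continuous_sub_mul_log {f : ℝ → ℝ} (hf : Continuous f) {X : ℝ}
    (hd : DifferentiableAt ℝ f X) :
    Continuous fun t => (f t - f X) * Real.log (X - t) := by
  have h1 : Continuous (dslope f X) := by
    rw [continuous_iff_continuousAt]
    intro t
    rcases eq_or_ne t X with rfl | hne
    · exact continuousAt_dslope_same.2 hd
    · exact (continuousAt_dslope_of_ne hne).2 hf.continuousAt
  have h2 : Continuous fun t : ℝ => (X - t) * Real.log (X - t) :=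
    Real.continuous_mul_log.comp (continuous_const.sub continuous_id)
  have h3 : (fun t => (f t - f X) * Real.log (X - t)) =
      fun t => -(dslope f X t) * ((X - t) * Real.log (X - t)) := by
    ext t
    have := sub_smul_dslope f X t
    rw [smul_eq_mul] at this
    rw [← this]
    ring
  rw [h3]
  exact h1.neg.mul h2

theorem finHilbert_eq_logPot_deriv {f f' : ℝ → ℝ} (hδ : 0 < δ) (hf : ∀ t, HasDerivAt f (f' t) t)
    (hf' : Continuous f') {X : ℝ}
    (hi : IntervalIntegrable (fun t => (f t - f X) / (X - t)) volume (-δ) δ) :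
    finHilbert δ f X = logPot δ f' X - f δ * Real.log (δ - X) + f (-δ) * Real.log (δ + X) := by
  have hfc : Continuous f := continuous_iff_continuousAt.2 fun x => (hf x).continuousAt
  have hi2 : IntervalIntegrable (fun t => Real.log (X - t) * f' t) volume (-δ) δ :=
    (intervalIntegrable_log_sub X _ _).mul_continuousOn hf'.continuousOn
  have key := MeasureTheory.integral_eq_of_hasDerivAt_off_countable_of_le
    (fun t => (f t - f X) * Real.log (X - t))
    (fun t => Real.log (X - t) * f' t - (f t - f X) / (X - t)) (a := -δ) (b := δ) (by linarith)
    (countable_singleton X)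
    (continuous_sub_mul_log hfc (hf X).differentiableAt).continuousOn
    (fun t ht => ?_) (hi2.sub hi)
  · rw [intervalIntegral.integral_sub hi2 hi, ← Real.log_neg_eq_log (X - δ)] at key
    unfold finHilbert logPot
    rw [show -(X - δ) = δ - X by ring, show X - -δ = δ + X by ring] at key
    linear_combination -key
  · have hne : X - t ≠ 0 := sub_ne_zero.2 (Ne.symm ht.2)
    have h1 : HasDerivAt (fun t => X - t) (-1) t := by simpa using (hasDerivAt_id t).const_sub X
    refine (((hf t).sub_const (f X)).fun_mul (h1.log hne)).congr_deriv ?_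
    field_simp
    ring

theorem abs_sub_le_rpow_of_lipschitz (hβ1 : β ≤ 1) {f : ℝ → ℝ} {s : Set ℝ} {M D : ℝ} (hM : 0 ≤ M)
    (hf : ∀ x ∈ s, ∀ y ∈ s, |f x - f y| ≤ M * |x - y|) (hD : ∀ x ∈ s, ∀ y ∈ s, |x - y| ≤ D) :
    ∀ x ∈ s, ∀ y ∈ s, |f x - f y| ≤ M * D ^ (1 - β) * |x - y| ^ β := by
  intro x hx y hy
  rcases eq_or_ne x y with rfl | hne
  · simp only [sub_self, abs_zero]
    exact mul_nonneg (mul_nonneg hM (Real.rpow_nonneg (by simpa using hD x hx x hx) _))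
      (Real.rpow_nonneg le_rfl _)
  · have h0 : 0 < |x - y| := abs_pos.2 (sub_ne_zero.2 hne)
    calc _ ≤ M * |x - y| := hf x hx y hy
      _ = M * (|x - y| ^ (1 - β) * |x - y| ^ β) := by rw [← Real.rpow_add h0]; simp
      _ ≤ M * (D ^ (1 - β) * |x - y| ^ β) := by
        have := hD x hx y hy
        have := Real.rpow_nonneg h0.le β
        gcongr
      _ = _ := by ring

theorem abs_sub_le_rpow_of_deriv (hβ1 : β ≤ 1) {f f' : ℝ → ℝ} {a b : ℝ} (hab : a ≤ b)
    (hf : ∀ t ∈ Icc a b, HasDerivAt f (f' t) t) (hf' : ContinuousOn f' (Icc a b)) :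
    ∃ L, ∀ x ∈ Icc a b, ∀ y ∈ Icc a b, |f x - f y| ≤ L * |x - y| ^ β := by
  obtain ⟨M, hM⟩ := isCompact_Icc.exists_bound_of_continuousOn hf'
  have hM0 : 0 ≤ M := (norm_nonneg _).trans (hM a ⟨le_rfl, hab⟩)
  refine ⟨_, abs_sub_le_rpow_of_lipschitz hβ1 (D := b - a) hM0 (fun x hx y hy => ?_)
    fun x hx y hy => ?_⟩
  · exact (convex_Icc a b).norm_image_sub_le_of_norm_hasDerivWithin_le
      (fun u hu => (hf u hu).hasDerivWithinAt) hM hy hx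
  · rw [abs_le]; constructor <;> linarith [hx.1, hx.2, hy.1, hy.2]

theorem ZeroHolder.exists_holder (hβ : 0 < β) (hβ1 : β ≤ 1) {n : ℕ} {h : ℝ → ℝ}
    (hh : ZeroHolder β n h) (hδ : 0 < δ) :
    ∃ L, ∀ x ∈ Icc (-δ) δ, ∀ y ∈ Icc (-δ) δ, |h x - h y| ≤ L * |x - y| ^ β := by
  cases n with
  | zero =>
    obtain ⟨-, C, hC, hc⟩ := hh
    refine ⟨C, fun x _ y _ => ?_⟩
    rcases le_total x y with hxy | hxy
    · rw [abs_sub_comm, abs_sub_comm x, abs_of_nonneg (sub_nonneg.2 hxy)]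
      exact hc x y hxy
    · rw [abs_of_nonneg (sub_nonneg.2 hxy)]
      exact hc y x hxy
  | succ n =>
    obtain ⟨-, h', hd, hh'⟩ := hh
    exact abs_sub_le_rpow_of_deriv hβ1 (by linarith) (fun t _ => hd t)
      (hh'.continuous hβ).continuousOn

/-- The logarithmic potential gains one derivative. -/
theorem ZeroHolder.derivChain_logPot (hβ : 0 < β) (hβ1 : β < 1) (hδ : 0 < δ) :
    ∀ {n : ℕ} {h : ℝ → ℝ}, ZeroHolder β n h → DerivChain (n + 1) β (logPot δ h) 0 (δ / 2)
  | 0, h, hh => by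
    obtain ⟨L, hL⟩ := hh.exists_holder hβ hβ1.le hδ
    obtain ⟨h1, C, hC⟩ := logPot_hasDerivAt hβ hβ1 hδ hL
    refine DerivChain.cons (f' := finHilbert δ h) (by simpa using h1)
      ⟨fun _ => finHilbert δ h, rfl, fun j hj => absurd hj (Nat.not_lt_zero j), C, ?_⟩
    simpa using hC
  | n + 1, h, hh => by
    obtain ⟨L, hL⟩ := hh.exists_holder hβ hβ1.le hδ
    obtain ⟨h1, -⟩ := logPot_hasDerivAt hβ hβ1 hδ hL
    have hz := hh.eq_zero
    obtain ⟨-, h', hd, hh'⟩ := hh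
    have ih := derivChain_logPot hβ hβ1 hδ hh'
    have hlog : DerivChain (n + 1) β (fun X => -h δ * Real.log (δ - X)) 0 (δ / 2) :=
      (HoloExt.const_mul (-h δ) (HoloExt.log_sub (le_refl δ))).derivChain hβ1.le (by linarith) _
    refine DerivChain.cons (f' := finHilbert δ h) (by simpa using h1) ?_
    refine (ih.add hlog).congr fun X hX => ?_
    rw [zero_sub, zero_add] at hX
    have hX' : X ∈ Ioo (-δ) δ := ⟨by linarith [hX.1], by linarith [hX.2]⟩
    rw [finHilbert_eq_logPot_deriv hδ hd (hh'.continuous hβ)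
      (intervalIntegrable_div_sub hβ hδ hL (Ioo_subset_Icc_self hX')), hz (-δ) (by linarith)]
    ring
end

section
open Filter Topology

/-- The real part of `(v + iε)⁻²`, up to sign the derivative of the conjugate Poisson kernel. -/
noncomputable def conjKernel (ε v : ℝ) : ℝ := (v ^ 2 - ε ^ 2) / (v ^ 2 + ε ^ 2) ^ 2

theorem continuous_conjKernel {ε : ℝ} (hε : 0 < ε) : Continuous (conjKernel ε) := by
  unfold conjKernel
  exact (by fun_prop : Continuous fun v : ℝ => v ^ 2 - ε ^ 2).div (by fun_prop)
    fun v => by positivity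

theorem abs_conjKernel_le (ε v : ℝ) : |conjKernel ε v| ≤ (v ^ 2 + ε ^ 2)⁻¹ := by
  unfold conjKernel
  rcases eq_or_ne (v ^ 2 + ε ^ 2) 0 with h | h
  · simp [h]
  have h0 : 0 < v ^ 2 + ε ^ 2 := lt_of_le_of_ne (by positivity) h.symm
  rw [abs_div, abs_of_nonneg (by positivity : (0:ℝ) ≤ (v ^ 2 + ε ^ 2) ^ 2),
    div_le_iff₀ (by positivity),
    pow_two (v ^ 2 + ε ^ 2), inv_mul_cancel_left₀ h]
  rw [abs_le]; constructor <;> nlinarith [sq_nonneg v, sq_nonneg ε]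

theorem exists_abs_conjKernel_le {ε : ℝ} (hε : 0 < ε) (x : ℝ) :
    ∃ C, ∀ y, |conjKernel ε (x - y)| ≤ C * (1 + y ^ 2)⁻¹ := by
  refine ⟨2 + (1 + 2 * x ^ 2) / ε ^ 2, fun y => (abs_conjKernel_le _ _).trans ?_⟩
  have h1 : 0 < (x - y) ^ 2 + ε ^ 2 := by positivity
  have h2 : (0:ℝ) < 1 + y ^ 2 := by positivity
  rw [← div_eq_mul_inv, inv_le_iff_one_le_mul₀ h1, div_mul_eq_mul_div, le_div_iff₀ h2, one_mul]
  have e : (2 + (1 + 2 * x ^ 2) / ε ^ 2) * ((x - y) ^ 2 + ε ^ 2) =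
    2 * (x - y) ^ 2 + 2 * ε ^ 2 + (1 + 2 * x ^ 2) + (1 + 2 * x ^ 2) / ε ^ 2 * (x - y) ^ 2 := by
    field_simp
    ring
  rw [e]
  have : 0 ≤ (1 + 2 * x ^ 2) / ε ^ 2 * (x - y) ^ 2 := by positivity
  nlinarith [sq_nonneg (2 * x - y), sq_nonneg ε]

theorem integrable_log_div_one_add_sq :
    Integrable fun v : ℝ => Real.log v * (1 + v ^ 2)⁻¹ := by
  have hm : Measurable fun v : ℝ => Real.log v * (1 + v ^ 2)⁻¹ := by fun_prop
  have h1 : IntegrableOn (fun v : ℝ => Real.log v * (1 + v ^ 2)⁻¹) (Icc (-1) 1) := by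
    rw [integrableOn_Icc_iff_integrableOn_Ioc,
      ← intervalIntegrable_iff_integrableOn_Ioc_of_le (by norm_num)]
    refine intervalIntegral.intervalIntegrable_log'.mul_continuousOn (Continuous.continuousOn ?_)
    exact (by fun_prop : Continuous fun v : ℝ => 1 + v ^ 2).inv₀ fun v => by positivity
  have h2 : IntegrableOn (fun v : ℝ => Real.log v * (1 + v ^ 2)⁻¹) (Icc (-1) 1)ᶜ := by
    have hd : Integrable fun v : ℝ => 4 * (1 + ‖v‖) ^ (-(3/2) : ℝ) :=
      (integrable_one_add_norm (by norm_num)).const_mul 4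
    refine Integrable.mono' hd.integrableOn hm.aestronglyMeasurable ?_
    refine (ae_restrict_iff' measurableSet_Icc.compl).2 (ae_of_all _ fun v hv => ?_)
    have hv1 : 1 < |v| := by
      by_contra! h
      exact hv (abs_le.1 h)
    have hv0 : 0 < |v| := by linarith
    have hl : |Real.log v| ≤ 2 * (1 + |v|) ^ (1 / 2 : ℝ) := by
      rw [← Real.log_abs, abs_of_nonneg (Real.log_nonneg hv1.le)]
      refine (Real.log_le_rpow_div hv0.le (by norm_num : (0:ℝ) < 1 / 2)).trans ?_
      have := Real.rpow_le_rpow hv0.le (by linarith : |v| ≤ 1 + |v|) (by norm_num : (0:ℝ) ≤ 1/2)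
      linarith
    have hi : (1 + v ^ 2)⁻¹ ≤ 2 * (1 + |v|) ^ (-2 : ℝ) := by
      rw [Real.rpow_neg (by positivity), ← div_eq_mul_inv, inv_le_iff_one_le_mul₀ (by positivity),
        div_mul_eq_mul_div, le_div_iff₀ (by positivity)]
      norm_cast
      nlinarith [sq_nonneg (|v| - 1), sq_abs v]
    rw [Real.norm_eq_abs, abs_mul, abs_of_nonneg (by positivity : (0:ℝ) ≤ (1 + v ^ 2)⁻¹)]
    calc _ ≤ (2 * (1 + |v|) ^ (1 / 2 : ℝ)) * (2 * (1 + |v|) ^ (-2 : ℝ)) := by gcongr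
      _ = 4 * ((1 + |v|) ^ (1 / 2 : ℝ) * (1 + |v|) ^ (-2 : ℝ)) := by ring
      _ = _ := by rw [← Real.rpow_add (by positivity)]; norm_num
  simpa using h1.union h2

theorem integral_log_mul_conjKernel {ε : ℝ} (hε : 0 < ε) (a : ℝ) :
    ∫ v, Real.log v * conjKernel ε (a - v) = Real.pi * ε / (a ^ 2 + ε ^ 2) := by
  -- an explicit primitive
  let q : ℝ → ℝ → ℝ := fun a v => (a - v) / ((a - v) ^ 2 + ε ^ 2)
  let F : ℝ → ℝ → ℝ := fun a v => (q a v - q a 0) * Real.log (0 - v) +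
    q a 0 / 2 * Real.log ((v - a) ^ 2 + ε ^ 2) +
    ε / (a ^ 2 + ε ^ 2) * Real.arctan ((v - a) / ε)
  have hS : ∀ u : ℝ, u ^ 2 + ε ^ 2 ≠ 0 := fun u => by positivity
  have hq : ∀ a v, HasDerivAt (q a) (conjKernel ε (a - v)) v := by
    intro a v
    have h1 : HasDerivAt (fun v => a - v) (-1) v := by simpa using (hasDerivAt_id v).const_sub a
    refine (h1.fun_div ((h1.fun_pow 2).add_const (ε ^ 2)) (hS _)).congr_deriv ?_
    unfold conjKernel
    congr 1
    push_cast; ring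
  have hint : Integrable fun v => Real.log v * conjKernel ε (a - v) := by
    obtain ⟨C, hC⟩ := exists_abs_conjKernel_le hε a
    refine Integrable.mono' (integrable_log_div_one_add_sq.norm.mul_const C) ?_
      (ae_of_all _ fun v => ?_)
    · exact (Real.measurable_log.mul ((continuous_conjKernel hε).measurable.comp
        (by fun_prop))).aestronglyMeasurable
    · rw [norm_mul, norm_mul, Real.norm_eq_abs (conjKernel _ _), mul_assoc]
      gcongr
      refine (hC v).trans (le_of_eq ?_)
      rw [mul_comm, Real.norm_of_nonneg (by positivity)]
  have hFc : Continuous (F a) := by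
    refine ((continuous_sub_mul_log (continuous_iff_continuousAt.2 fun x => (hq a x).continuousAt)
      (hq a 0).differentiableAt).add (continuous_const.mul ?_)).add (by fun_prop)
    exact (by fun_prop : Continuous fun v : ℝ => (v - a) ^ 2 + ε ^ 2).log fun v => hS _
  have hFd : ∀ v, v ≠ 0 → HasDerivAt (F a) (Real.log v * conjKernel ε (a - v)) v := by
    intro v hv
    have hl : HasDerivAt (fun v => Real.log (0 - v)) v⁻¹ v := by
      simpa [Real.log_neg_eq_log] using Real.hasDerivAt_log hv
    have h1 : HasDerivAt (fun v => v - a) 1 v := (hasDerivAt_id v).sub_const a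
    have h2 := ((h1.fun_pow 2).add_const (ε ^ 2)).log (hS (v - a))
    have h3 := (h1.div_const ε).arctan
    refine (((((hq a v).sub_const (q a 0)).fun_mul hl).fun_add (h2.const_mul (q a 0 / 2))).fun_add
      (h3.const_mul (ε / (a ^ 2 + ε ^ 2)))).congr_deriv ?_
    rw [zero_sub, Real.log_neg_eq_log, mul_comm (conjKernel _ _), add_assoc, add_assoc,
      add_eq_left]
    have e : (v - a) ^ 2 + ε ^ 2 = (a - v) ^ 2 + ε ^ 2 := by ring
    have h4 : 1 + ((v - a) / ε) ^ 2 = ((a - v) ^ 2 + ε ^ 2) / ε ^ 2 := by field_simp; ring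
    have := hS (a - v)
    have := hS a
    rw [h4, e]
    simp only [q, sub_zero]
    field_simp
    push_cast; ring
  have hsym : ∀ v, F a (-v) = - F (-a) v := by
    intro v
    simp only [F, q]
    rw [show (0:ℝ) - -v = v by ring, show (0:ℝ) - v = -v by ring, Real.log_neg_eq_log,
      show (-v - a) / ε = -((v - -a) / ε) by ring, Real.arctan_neg,
      show (-v - a) ^ 2 = (v - -a) ^ 2 by ring]
    ring
  have hlim : ∀ a, Tendsto (F a) atTop (𝓝 (ε / (a ^ 2 + ε ^ 2) * (Real.pi / 2))) := by
    intro a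
    have hat : Tendsto (fun v : ℝ => (v - a)) atTop atTop :=
      tendsto_atTop_add_const_right _ _ tendsto_id
    have hatan : Tendsto (fun v => Real.arctan ((v - a) / ε)) atTop (𝓝 (Real.pi / 2)) :=
      (Real.tendsto_arctan_atTop.mono_right nhdsWithin_le_nhds).comp (hat.atTop_div_const hε)
    have hinv : Tendsto (fun v : ℝ => v⁻¹) atTop (𝓝 0) := tendsto_inv_atTop_zero
    have hr : Tendsto (fun v : ℝ => (1 - a * v⁻¹) ^ 2 + ε ^ 2 * v⁻¹ ^ 2) atTop (𝓝 1) := by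
      have : Continuous fun t : ℝ => (1 - a * t) ^ 2 + ε ^ 2 * t ^ 2 := by fun_prop
      simpa [Function.comp_def] using (this.tendsto 0).comp hinv
    have hlv : Tendsto (fun v : ℝ => Real.log v * v⁻¹) atTop (𝓝 0) := by
      simpa [div_eq_mul_inv] using Real.isLittleO_log_id_atTop.tendsto_div_nhds_zero
    have hl1 : Tendsto (fun v : ℝ => (a * v⁻¹ - 1) / ((1 - a * v⁻¹) ^ 2 + ε ^ 2 * v⁻¹ ^ 2) *
        (Real.log v * v⁻¹)) atTop (𝓝 0) := by
      simpa using (((hinv.const_mul a).sub_const 1).div hr one_ne_zero).mul hlv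
    have hl2 : Tendsto (fun v : ℝ => q a 0 / 2 *
        Real.log ((1 - a * v⁻¹) ^ 2 + ε ^ 2 * v⁻¹ ^ 2)) atTop (𝓝 0) := by
      simpa using ((Real.continuousAt_log one_ne_zero).tendsto.comp hr).const_mul (q a 0 / 2)
    have := (hl1.add hl2).add (hatan.const_mul (ε / (a ^ 2 + ε ^ 2)))
    rw [add_zero, zero_add] at this
    refine this.congr' ?_
    filter_upwards [eventually_gt_atTop 0] with v hv
    have e1 : (1 - a * v⁻¹) ^ 2 + ε ^ 2 * v⁻¹ ^ 2 = ((v - a) ^ 2 + ε ^ 2) / v ^ 2 := by field_simp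
    have e2 : (a * v⁻¹ - 1) / ((1 - a * v⁻¹) ^ 2 + ε ^ 2 * v⁻¹ ^ 2) * (Real.log v * v⁻¹) =
        q a v * Real.log v := by
      have := hS (v - a)
      have := hS (a - v)
      simp only [q]
      rw [e1]
      field_simp
      ring
    rw [e2, e1, Real.log_div (hS _) (by positivity), Real.log_pow]
    simp only [F]
    rw [zero_sub, Real.log_neg_eq_log]
    push_cast; ring
  have hI := intervalIntegral_tendsto_integral hint tendsto_neg_atTop_atBot tendsto_id
  refine tendsto_nhds_unique hI ?_
  have h2 := (hlim a).add (hlim (-a))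
  refine Tendsto.congr' ?_ (h2.trans (le_of_eq ?_))
  · filter_upwards [eventually_ge_atTop 0] with n hn
    have := MeasureTheory.integral_eq_of_hasDerivAt_off_countable_of_le (F a)
      (fun v => Real.log v * conjKernel ε (a - v)) (by linarith : -n ≤ n) (countable_singleton 0)
      hFc.continuousOn (fun v hv => hFd v hv.2) hint.intervalIntegrable
    simp only [id]
    rw [this, hsym, sub_neg_eq_add]
  · congr 1; rw [neg_sq]; ring

variable {w : ℝ → ℝ} {M a ε : ℝ}

theorem integrable_of_bdd_support (hw : Measurable w) (hM : ∀ s, |w s| ≤ M)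
    (ha : ∀ s, a < |s| → w s = 0) : Integrable w := by
  have h : w = indicator (Icc (-a) a) w := by
    funext s
    by_cases hs : s ∈ Icc (-a) a
    · rw [indicator_of_mem hs]
    · rw [indicator_of_notMem hs]
      exact ha s (not_le.1 fun h => hs (abs_le.1 h))
  rw [h, integrable_indicator_iff measurableSet_Icc]
  exact Measure.integrableOn_of_bounded (M := M) (by simp) hw.aestronglyMeasurable
    (ae_of_all _ hM)

theorem integrable_log_sub_mul (s : ℝ) :
    Integrable (fun y : ℝ => Real.log (y - s) * (1 + y ^ 2)⁻¹) ∧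
      ∫ y, |Real.log (y - s) * (1 + y ^ 2)⁻¹| ≤
        (2 + 2 * s ^ 2) * ∫ v, |Real.log v * (1 + v ^ 2)⁻¹| := by
  have hb : ∀ y : ℝ, |Real.log (y - s) * (1 + y ^ 2)⁻¹| ≤
      (2 + 2 * s ^ 2) * |Real.log (y - s) * (1 + (y - s) ^ 2)⁻¹| := by
    intro y
    rw [abs_mul, abs_mul, abs_of_nonneg (by positivity : (0:ℝ) ≤ (1 + y ^ 2)⁻¹),
      abs_of_nonneg (by positivity : (0:ℝ) ≤ (1 + (y - s) ^ 2)⁻¹), mul_left_comm]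
    gcongr
    rw [← div_eq_mul_inv, inv_le_iff_one_le_mul₀ (by positivity), div_mul_eq_mul_div,
      le_div_iff₀ (by positivity)]
    nlinarith [sq_nonneg (y + s), mul_nonneg (sq_nonneg s) (sq_nonneg y)]
  have hi : Integrable fun y : ℝ =>
      (2 + 2 * s ^ 2) * |Real.log (y - s) * (1 + (y - s) ^ 2)⁻¹| :=
    ((integrable_log_div_one_add_sq.comp_sub_right s).abs).const_mul _
  have hm : Measurable fun y : ℝ => Real.log (y - s) * (1 + y ^ 2)⁻¹ := by fun_prop
  have h1 : Integrable fun y : ℝ => Real.log (y - s) * (1 + y ^ 2)⁻¹ :=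
    hi.mono' hm.aestronglyMeasurable (ae_of_all _ hb)
  refine ⟨h1, (integral_mono h1.abs hi hb).trans (le_of_eq ?_)⟩
  rw [integral_const_mul,
    integral_sub_right_eq_self (fun v => |Real.log v * (1 + v ^ 2)⁻¹|) s]

theorem integrable_prod_log_sub (hw : Measurable w) (hM : ∀ s, |w s| ≤ M)
    (ha : ∀ s, a < |s| → w s = 0) :
    Integrable (fun p : ℝ × ℝ => Real.log (p.1 - p.2) * w p.2 * (1 + p.1 ^ 2)⁻¹)
      (volume.prod volume) := by
  have hm : Measurable fun p : ℝ × ℝ => Real.log (p.1 - p.2) * w p.2 * (1 + p.1 ^ 2)⁻¹ := by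
    fun_prop
  have e : ∀ s y : ℝ, Real.log (y - s) * w s * (1 + y ^ 2)⁻¹ =
      w s * (Real.log (y - s) * (1 + y ^ 2)⁻¹) := fun s y => by ring
  refine (integrable_prod_iff' hm.aestronglyMeasurable).2 ⟨ae_of_all _ fun s => ?_, ?_⟩
  · simp only [e]
    exact (integrable_log_sub_mul s).1.const_mul _
  · refine Integrable.mono' (g := fun s => |w s| * ((2 + 2 * a ^ 2) *
      ∫ v, |Real.log v * (1 + v ^ 2)⁻¹|)) ((integrable_of_bdd_support hw hM ha).abs.mul_const _) ?_
      (ae_of_all _ fun s => ?_)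
    · exact (hm.norm.aestronglyMeasurable (μ := volume.prod volume)).prod_swap.integral_prod_right'
    · simp only [e, norm_mul (w s), integral_const_mul]
      rw [norm_mul, norm_norm, Real.norm_eq_abs]
      rcases le_or_gt |s| a with hs | hs
      · gcongr
        rw [Real.norm_of_nonneg (integral_nonneg fun _ => norm_nonneg _)]
        refine (integrable_log_sub_mul s).2.trans ?_
        have h0 : 0 ≤ ∫ v, |Real.log v * (1 + v ^ 2)⁻¹| := integral_nonneg fun _ => abs_nonneg _
        have : s ^ 2 ≤ a ^ 2 := sq_le_sq' (abs_le.1 hs).1 (abs_le.1 hs).2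
        gcongr
      · simp [ha s hs]

theorem integrable_logConv (hw : Measurable w) (hM : ∀ s, |w s| ≤ M)
    (ha : ∀ s, a < |s| → w s = 0) :
    Integrable fun y => (∫ s, Real.log (y - s) * w s) * (1 + y ^ 2)⁻¹ := by
  have := (integrable_prod_log_sub hw hM ha).integral_prod_left
  simpa only [integral_mul_const] using this

theorem integral_logConv_mul_conjKernel (hw : Measurable w) (hM : ∀ s, |w s| ≤ M)
    (ha : ∀ s, a < |s| → w s = 0) (hε : 0 < ε) (x : ℝ) :
    ∫ y, (∫ s, Real.log (y - s) * w s) * conjKernel ε (x - y) =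
      ∫ s, w s * (Real.pi * ε / ((x - s) ^ 2 + ε ^ 2)) := by
  obtain ⟨C, hC⟩ := exists_abs_conjKernel_le hε x
  have hm : Measurable fun p : ℝ × ℝ => Real.log (p.1 - p.2) * w p.2 * conjKernel ε (x - p.1) := by
    have := (continuous_conjKernel hε).measurable
    fun_prop
  have hi : Integrable (Function.uncurry fun y s =>
      Real.log (y - s) * w s * conjKernel ε (x - y)) (volume.prod volume) := by
    refine ((integrable_prod_log_sub hw hM ha).abs.const_mul C).mono' hm.aestronglyMeasurable
      (ae_of_all _ fun p => ?_)
    rw [Function.uncurry, norm_mul, abs_mul, ← mul_assoc, mul_comm C, mul_assoc, Real.norm_eq_abs,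
      Real.norm_eq_abs, abs_of_nonneg (by positivity : (0:ℝ) ≤ (1 + p.1 ^ 2)⁻¹)]
    gcongr
    exact hC _
  calc _ = ∫ y, ∫ s, Real.log (y - s) * w s * conjKernel ε (x - y) := by
        simp only [integral_mul_const]
    _ = ∫ s, ∫ y, Real.log (y - s) * w s * conjKernel ε (x - y) := integral_integral_swap hi
    _ = _ := by
      congr 1 with s
      have e : ∀ y, Real.log (y - s) * w s * conjKernel ε (x - y) =
          w s * (Real.log (y - s) * conjKernel ε ((x - s) - (y - s))) := fun y => by
        rw [sub_sub_sub_cancel_right]; ring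
      simp only [e, integral_const_mul]
      rw [integral_sub_right_eq_self (fun v => Real.log v * conjKernel ε ((x - s) - v)) s,
        integral_log_mul_conjKernel hε]

theorem tendsto_integral_poisson {x : ℝ} (hw : Integrable w) (hx : ContinuousAt w x) :
    Tendsto (fun ε => ∫ s, w s * (Real.pi * ε / ((x - s) ^ 2 + ε ^ 2))) (𝓝[>] 0)
      (𝓝 (Real.pi ^ 2 * w x)) := by
  have hpi := Real.pi_pos
  have key := tendsto_integral_comp_smul_smul_of_integrable' (μ := (volume : Measure ℝ))
    (φ := fun x : ℝ => Real.pi⁻¹ * (1 + x ^ 2)⁻¹) (fun x => by positivity)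
    (by rw [integral_const_mul, integral_univ_inv_one_add_sq, inv_mul_cancel₀ hpi.ne']) ?_ hw hx
  · have := (key.comp tendsto_inv_nhdsGT_zero).const_mul (Real.pi ^ 2)
    refine this.congr' ?_
    filter_upwards [self_mem_nhdsWithin] with ε (hε : 0 < ε)
    simp only [Function.comp, Module.finrank_self, smul_eq_mul]
    rw [← integral_const_mul]
    congr 1 with s
    have h1 : (x - s) ^ 2 + ε ^ 2 ≠ 0 := by positivity
    have h2 : 1 + (ε⁻¹ * (x - s)) ^ 2 = ((x - s) ^ 2 + ε ^ 2) / ε ^ 2 := by field_simp; ring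
    rw [h2]
    field_simp
  · have h0 : Tendsto (fun x : ℝ => Real.pi⁻¹ * ‖x‖⁻¹) (Bornology.cobounded ℝ) (𝓝 0) := by
      simpa using ((tendsto_inv_atTop_zero (𝕜 := ℝ)).comp
        (tendsto_norm_cobounded_atTop (E := ℝ))).const_mul Real.pi⁻¹
    refine squeeze_zero (fun x => by positivity) (fun x => ?_) h0
    simp only [Module.finrank_self, pow_one]
    rw [mul_left_comm]
    gcongr
    rcases eq_or_ne x 0 with rfl | hx
    · simp
    have hx0 : 0 < ‖x‖ := norm_pos_iff.2 hx
    rw [← div_eq_mul_inv, div_le_iff₀ (by positivity), ← sq_abs, ← Real.norm_eq_abs, mul_add,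
      pow_two, inv_mul_cancel_left₀ hx0.ne']
    have : 0 < ‖x‖⁻¹ := by positivity
    linarith

/-- Inversion of the logarithmic potential. -/
theorem tendsto_integral_logConv_mul_conjKernel {x : ℝ} (hw : Measurable w) (hM : ∀ s, |w s| ≤ M)
    (ha : ∀ s, a < |s| → w s = 0) (hx : ContinuousAt w x) :
    Tendsto (fun ε => ∫ y, (∫ s, Real.log (y - s) * w s) * conjKernel ε (x - y)) (𝓝[>] 0)
      (𝓝 (Real.pi ^ 2 * w x)) := by
  refine (tendsto_integral_poisson (integrable_of_bdd_support hw hM ha) hx).congr' ?_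
  filter_upwards [self_mem_nhdsWithin] with ε hε
  rw [integral_logConv_mul_conjKernel hw hM ha hε]
end

section
open Filter Topology
variable {w : ℝ → ℝ} {M a ρ x : ℝ}

theorem tendsto_conjKernel {v : ℝ} (hv : v ≠ 0) :
    Tendsto (fun ε => conjKernel ε v) (𝓝[>] 0) (𝓝 (v ^ 2)⁻¹) := by
  have h : ContinuousAt (fun ε => conjKernel ε v) 0 := by
    unfold conjKernel
    exact ContinuousAt.div (by fun_prop) (by fun_prop) (by positivity)
  have h1 := h.tendsto.mono_left (nhdsWithin_le_nhds (s := Ioi 0))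
  have e : conjKernel 0 v = (v ^ 2)⁻¹ := by
    unfold conjKernel
    field_simp
    ring
  rwa [e] at h1

theorem exists_inv_sq_sub_le (hx : x ∈ Ioo (-ρ) ρ) :
    ∃ C, ∀ y ∈ (Icc (-ρ) ρ)ᶜ, 0 < (x - y) ^ 2 ∧ ((x - y) ^ 2)⁻¹ ≤ C * (1 + y ^ 2)⁻¹ := by
  obtain ⟨d, hd, hd1, hd2⟩ : ∃ d > 0, d ≤ ρ - x ∧ d ≤ x + ρ :=
    ⟨min (ρ - x) (x + ρ), lt_min (by linarith [hx.2]) (by linarith [hx.1]), min_le_left _ _,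
      min_le_right _ _⟩
  refine ⟨2 + (1 + 2 * x ^ 2) / d ^ 2, fun y hy => ?_⟩
  have h1 : d ^ 2 ≤ (x - y) ^ 2 := by
    rcases lt_or_ge ρ y with h | h
    · nlinarith
    · have : y < -ρ := by
        by_contra! h'
        exact hy ⟨h', h⟩
      nlinarith
  have h0 : 0 < (x - y) ^ 2 := lt_of_lt_of_le (by positivity) h1
  refine ⟨h0, ?_⟩
  rw [← div_eq_mul_inv, inv_le_iff_one_le_mul₀ h0, div_mul_eq_mul_div,
    le_div_iff₀ (by positivity), one_mul, add_mul]
  have : (1 + 2 * x ^ 2) ≤ (1 + 2 * x ^ 2) / d ^ 2 * (x - y) ^ 2 := by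
    rw [div_mul_eq_mul_div, le_div_iff₀ (by positivity)]
    gcongr
  nlinarith [sq_nonneg (2 * x - y)]

theorem aestronglyMeasurable_of_mul_inv {U : ℝ → ℝ}
    (hU : Integrable fun y => U y * (1 + y ^ 2)⁻¹) : AEStronglyMeasurable U := by
  have : AEStronglyMeasurable fun y : ℝ => 1 + y ^ 2 := by fun_prop
  refine (hU.aestronglyMeasurable.mul this).congr (ae_of_all _ fun y => ?_)
  simp only [Pi.mul_apply]
  have : 1 + y ^ 2 ≠ 0 := by positivity
  field_simp

theorem tendsto_setIntegral_mul_conjKernel {U : ℝ → ℝ} (hx : x ∈ Ioo (-ρ) ρ)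
    (hU : Integrable fun y => U y * (1 + y ^ 2)⁻¹) :
    Tendsto (fun ε => ∫ y in (Icc (-ρ) ρ)ᶜ, U y * conjKernel ε (x - y)) (𝓝[>] 0)
      (𝓝 (∫ y in (Icc (-ρ) ρ)ᶜ, U y * ((x - y) ^ 2)⁻¹)) := by
  obtain ⟨C, hC⟩ := exists_inv_sq_sub_le hx
  refine tendsto_integral_filter_of_dominated_convergence
    (fun y => C * |U y * (1 + y ^ 2)⁻¹|) ?_ ?_ (hU.abs.const_mul _).integrableOn ?_
  · filter_upwards [self_mem_nhdsWithin] with ε hε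
    have := (continuous_conjKernel hε).comp
      (continuous_const.sub continuous_id : Continuous fun y => x - y)
    exact ((aestronglyMeasurable_of_mul_inv hU).mul this.aestronglyMeasurable).restrict
  · filter_upwards [self_mem_nhdsWithin] with ε hε
    refine (ae_restrict_iff' measurableSet_Icc.compl).2 (ae_of_all _ fun y hy => ?_)
    obtain ⟨h0, h1⟩ := hC y hy
    rw [norm_mul, abs_mul, mul_left_comm, Real.norm_eq_abs, Real.norm_eq_abs,
      abs_of_nonneg (by positivity : (0:ℝ) ≤ (1 + y ^ 2)⁻¹)]
    gcongr
    calc _ ≤ ((x - y) ^ 2 + ε ^ 2)⁻¹ := abs_conjKernel_le _ _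
      _ ≤ ((x - y) ^ 2)⁻¹ := by gcongr; nlinarith [sq_nonneg ε]
      _ ≤ _ := h1
  · refine (ae_restrict_iff' measurableSet_Icc.compl).2 (ae_of_all _ fun y hy => ?_)
    obtain ⟨h0, -⟩ := hC y hy
    exact (tendsto_conjKernel fun h => by simp [h] at h0).const_mul _

theorem hasDerivAt_half_log_sq_add {ε : ℝ} (hε : 0 < ε) (x y : ℝ) :
    HasDerivAt (fun y => Real.log ((x - y) ^ 2 + ε ^ 2) / 2)
      (-((x - y) / ((x - y) ^ 2 + ε ^ 2))) y := by
  have h1 : HasDerivAt (fun v => x - v) (-1) y := by simpa using (hasDerivAt_id y).const_sub x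
  have h0 : (x - y) ^ 2 + ε ^ 2 ≠ 0 := by positivity
  refine ((((h1.fun_pow 2).add_const (ε ^ 2)).log h0).div_const 2).congr_deriv ?_
  push_cast; field_simp

theorem hasDerivAt_conjPoisson {ε : ℝ} (hε : 0 < ε) (x y : ℝ) :
    HasDerivAt (fun y => (x - y) / ((x - y) ^ 2 + ε ^ 2)) (conjKernel ε (x - y)) y := by
  have h1 : HasDerivAt (fun v => x - v) (-1) y := by simpa using (hasDerivAt_id y).const_sub x
  have h0 : (x - y) ^ 2 + ε ^ 2 ≠ 0 := by positivity
  refine (h1.fun_div ((h1.fun_pow 2).add_const (ε ^ 2)) h0).congr_deriv ?_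
  unfold conjKernel
  congr 1
  push_cast; ring

theorem tendsto_half_log_sq_add {v : ℝ} (hv : v ≠ 0) :
    Tendsto (fun ε : ℝ => Real.log (v ^ 2 + ε ^ 2) / 2) (𝓝[>] 0) (𝓝 (Real.log v)) := by
  have h : ContinuousAt (fun ε : ℝ => Real.log (v ^ 2 + ε ^ 2) / 2) 0 :=
    (ContinuousAt.log (by fun_prop) (by positivity)).div_const 2
  have h1 := h.tendsto.mono_left (nhdsWithin_le_nhds (s := Ioi 0))
  simpa [Real.log_pow] using h1

theorem tendsto_integral_mul_half_log {f : ℝ → ℝ} (hρ : 0 < ρ)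
    (hf : ContinuousOn f (Icc (-ρ) ρ)) (x : ℝ) :
    Tendsto (fun ε : ℝ => ∫ y in -ρ..ρ, f y * (Real.log ((x - y) ^ 2 + ε ^ 2) / 2)) (𝓝[>] 0)
      (𝓝 (∫ y in -ρ..ρ, f y * Real.log (x - y))) := by
  have hle : -ρ ≤ ρ := by linarith
  rw [← uIcc_of_le hle] at hf
  have hlc : ∀ {c : ℝ}, 0 < c → Continuous fun y => Real.log ((x - y) ^ 2 + c ^ 2) / 2 :=
    fun {c} hc =>
    ((by fun_prop : Continuous fun y => (x - y) ^ 2 + c ^ 2).log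
      fun y => by positivity).div_const 2
  have hfm : AEStronglyMeasurable f (volume.restrict (uIoc (-ρ) ρ)) :=
    (hf.mono uIoc_subset_uIcc).aestronglyMeasurable measurableSet_uIoc
  refine intervalIntegral.tendsto_integral_filter_of_dominated_convergence
    (fun y => |f y| * (|Real.log (x - y)| + Real.log ((x - y) ^ 2 + 1 ^ 2) / 2)) ?_ ?_ ?_ ?_
  · filter_upwards [self_mem_nhdsWithin] with ε hε
    exact hfm.mul (hlc hε).aestronglyMeasurable
  · filter_upwards [self_mem_nhdsWithin, Ioo_mem_nhdsGT (zero_lt_one (α := ℝ))] with ε hε hε1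
    rw [mem_Ioi] at hε
    filter_upwards [compl_mem_ae_iff.2 (measure_singleton x)] with y hy _
    have hv : 0 < (x - y) ^ 2 := by
      have : x - y ≠ 0 := sub_ne_zero.2 (Ne.symm hy)
      positivity
    rw [norm_mul, Real.norm_eq_abs, Real.norm_eq_abs]
    gcongr
    have h1 : Real.log ((x - y) ^ 2) ≤ Real.log ((x - y) ^ 2 + ε ^ 2) :=
      Real.log_le_log hv (by nlinarith)
    have h2 : Real.log ((x - y) ^ 2 + ε ^ 2) ≤ Real.log ((x - y) ^ 2 + 1 ^ 2) :=
      Real.log_le_log (by positivity) (by nlinarith [hε1.2])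
    have h3 : 0 ≤ Real.log ((x - y) ^ 2 + 1 ^ 2) := Real.log_nonneg (by linarith)
    rw [Real.log_pow] at h1
    push_cast at h1
    have h4 := neg_abs_le (Real.log (x - y))
    have h5 := abs_nonneg (Real.log (x - y))
    generalize Real.log ((x - y) ^ 2 + 1 ^ 2) = A at *
    generalize Real.log ((x - y) ^ 2 + ε ^ 2) = B at *
    rw [abs_le]
    constructor <;> linarith
  · exact (((intervalIntegrable_log_sub x _ _).abs.add
      ((hlc one_pos).intervalIntegrable _ _)).continuousOn_mul hf.abs)
  · filter_upwards [compl_mem_ae_iff.2 (measure_singleton x)] with y hy _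
    exact (tendsto_half_log_sq_add (sub_ne_zero.2 (Ne.symm hy))).const_mul _

/-- If the logarithmic potential of `w` agrees on `(-ρ, ρ)` with a `C²` function `E`, then `w`
is recovered from `E` on `(-ρ, ρ)` and from the potential outside. -/
theorem logConv_inversion {E E' E'' : ℝ → ℝ} (hw : Measurable w) (hM : ∀ s, |w s| ≤ M)
    (ha : ∀ s, a < |s| → w s = 0)
    (hE : ∀ y ∈ Icc (-ρ) ρ, HasDerivAt E (E' y) y)
    (hE' : ∀ y ∈ Icc (-ρ) ρ, HasDerivAt E' (E'' y) y) (hE'' : ContinuousOn E'' (Icc (-ρ) ρ))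
    (hU : ∀ᵐ y, y ∈ Ioo (-ρ) ρ → ∫ s, Real.log (y - s) * w s = E y)
    (hx : x ∈ Ioo (-ρ) ρ) (hwx : ContinuousAt w x) :
    Real.pi ^ 2 * w x = (∫ y in (Icc (-ρ) ρ)ᶜ, (∫ s, Real.log (y - s) * w s) * ((x - y) ^ 2)⁻¹) +
      (E ρ * (x - ρ)⁻¹ - E (-ρ) * (x + ρ)⁻¹) +
      (E' ρ * Real.log (x - ρ) - E' (-ρ) * Real.log (x + ρ)) -
      ∫ y in -ρ..ρ, E'' y * Real.log (x - y) := by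
  have hρ : 0 < ρ := by linarith [hx.1, hx.2]
  have hle : -ρ ≤ ρ := by linarith
  have hm : ρ ∈ Icc (-ρ) ρ := ⟨hle, le_rfl⟩
  have hm' : -ρ ∈ Icc (-ρ) ρ := ⟨le_rfl, hle⟩
  set U : ℝ → ℝ := fun y => ∫ s, Real.log (y - s) * w s with hUdef
  have hUi : Integrable fun y => U y * (1 + y ^ 2)⁻¹ := integrable_logConv hw hM ha
  refine tendsto_nhds_unique (tendsto_integral_logConv_mul_conjKernel hw hM ha hwx) ?_
  have hq : ∀ {v : ℝ}, v ≠ 0 → Tendsto (fun ε : ℝ => v / (v ^ 2 + ε ^ 2)) (𝓝[>] 0) (𝓝 v⁻¹) := by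
    intro v hv
    have h : ContinuousAt (fun ε : ℝ => v / (v ^ 2 + ε ^ 2)) 0 :=
      ContinuousAt.div (by fun_prop) (by fun_prop) (by positivity)
    have h1 := h.tendsto.mono_left (nhdsWithin_le_nhds (s := Ioi 0))
    convert h1 using 2
    field_simp
    ring
  have hx1 : x - ρ ≠ 0 := by linarith [hx.2]
  have hx2 : x + ρ ≠ 0 := by linarith [hx.1]
  have hlim := (((tendsto_setIntegral_mul_conjKernel hx hUi).add
    (((hq hx1).const_mul (E ρ)).sub ((hq hx2).const_mul (E (-ρ))))).add
    (((tendsto_half_log_sq_add hx1).const_mul (E' ρ)).sub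
      ((tendsto_half_log_sq_add hx2).const_mul (E' (-ρ))))).sub
    (tendsto_integral_mul_half_log hρ hE'' x)
  refine hlim.congr' ?_
  filter_upwards [self_mem_nhdsWithin] with ε (hε : 0 < ε)
  have hint : Integrable fun y => U y * conjKernel ε (x - y) := by
    obtain ⟨C, hC⟩ := exists_abs_conjKernel_le hε x
    refine (hUi.abs.const_mul C).mono' ?_ (ae_of_all _ fun y => ?_)
    · have h1 : Continuous fun y : ℝ => conjKernel ε (x - y) :=
        (continuous_conjKernel hε).comp (by fun_prop)
      exact (aestronglyMeasurable_of_mul_inv hUi).mul h1.aestronglyMeasurable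
    · rw [norm_mul, abs_mul, mul_left_comm, Real.norm_eq_abs, Real.norm_eq_abs,
        abs_of_nonneg (by positivity : (0:ℝ) ≤ (1 + y ^ 2)⁻¹)]
      gcongr
      exact hC y
  have hin : ∫ y in Icc (-ρ) ρ, U y * conjKernel ε (x - y) =
      ∫ y in -ρ..ρ, E y * conjKernel ε (x - y) := by
    rw [intervalIntegral.integral_of_le hle, integral_Icc_eq_integral_Ioo,
      integral_Ioc_eq_integral_Ioo]
    refine setIntegral_congr_ae measurableSet_Ioo ?_
    filter_upwards [hU] with y hy hy'
    rw [← hy hy']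
  have hu : uIcc (-ρ) ρ = Icc (-ρ) ρ := uIcc_of_le hle
  have hE'c : ContinuousOn E' (Icc (-ρ) ρ) := fun y hy => (hE' y hy).continuousAt.continuousWithinAt
  have ibp1 := intervalIntegral.integral_mul_deriv_eq_deriv_mul (a := -ρ) (b := ρ)
    (u := E) (u' := E') (v := fun y => (x - y) / ((x - y) ^ 2 + ε ^ 2))
    (v' := fun y => conjKernel ε (x - y)) (hu ▸ hE) (fun y _ => hasDerivAt_conjPoisson hε x y)
    (ContinuousOn.intervalIntegrable (hu ▸ hE'c))
    (((continuous_conjKernel hε).comp (by fun_prop)).intervalIntegrable _ _)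
  have hcq : Continuous fun y : ℝ => -((x - y) / ((x - y) ^ 2 + ε ^ 2)) :=
    ((by fun_prop : Continuous fun y : ℝ => x - y).div (by fun_prop)
      fun y => by positivity).neg
  have ibp2 := intervalIntegral.integral_mul_deriv_eq_deriv_mul (a := -ρ) (b := ρ)
    (u := E') (u' := E'') (v := fun y => Real.log ((x - y) ^ 2 + ε ^ 2) / 2)
    (v' := fun y => -((x - y) / ((x - y) ^ 2 + ε ^ 2))) (hu ▸ hE')
    (fun y _ => hasDerivAt_half_log_sq_add hε x y)
    (ContinuousOn.intervalIntegrable (hu ▸ hE'')) (hcq.intervalIntegrable _ _)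
  simp only [mul_neg, intervalIntegral.integral_neg] at ibp2
  rw [← integral_add_compl measurableSet_Icc hint, hin]
  rw [show x - -ρ = x + ρ by ring] at ibp1 ibp2
  linear_combination -ibp1 - ibp2
end

section
open Filter Topology
variable {ρ x : ℝ}

theorem integral_two_mul_comp_sq (hρ : 0 ≤ ρ) (F : ℝ → ℝ) :
    ∫ y in 0..ρ, 2 * y * F (y ^ 2) = ∫ t in 0..ρ ^ 2, F t := by
  rw [intervalIntegral.integral_of_le hρ, intervalIntegral.integral_of_le (by positivity),
    integral_Ioc_eq_integral_Ioo, integral_Ioc_eq_integral_Ioo]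
  have him : (fun y : ℝ => y ^ 2) '' Ioo 0 ρ = Ioo 0 (ρ ^ 2) := by
    ext t
    constructor
    · rintro ⟨y, hy, rfl⟩
      exact ⟨by have := hy.1; positivity, by have := hy.1; have := hy.2; simp only; gcongr⟩
    · intro ht
      refine ⟨√t, ⟨Real.sqrt_pos.2 ht.1, ?_⟩, Real.sq_sqrt ht.1.le⟩
      rw [Real.sqrt_lt' (lt_of_le_of_ne hρ ?_)]
      · exact ht.2
      · rintro rfl
        have := ht.1.trans ht.2
        simp at this
  have hinj : InjOn (fun y : ℝ => y ^ 2) (Ioo 0 ρ) := fun y hy z hz h =>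
    (pow_left_inj₀ hy.1.le hz.1.le two_ne_zero).1 h
  rw [← him, integral_image_eq_integral_abs_deriv_smul measurableSet_Ioo
    (fun y _ => (hasDerivAt_pow 2 y).hasDerivWithinAt) hinj]
  refine setIntegral_congr_fun measurableSet_Ioo fun y hy => ?_
  have := hy.1
  simp [abs_of_pos this]

theorem ae_log_sq_sub (x : ℝ) : ∀ᵐ y : ℝ, Real.log (x - y) + Real.log (x + y) =
    Real.log (x ^ 2 - y ^ 2) := by
  filter_upwards [compl_mem_ae_iff.2 (measure_singleton x),
    compl_mem_ae_iff.2 (measure_singleton (-x))]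
    with y h1 h2
  rw [← Real.log_mul (sub_ne_zero.2 (Ne.symm h1))]
  · congr 1; ring
  · intro h
    exact h2 (by simp only [mem_singleton_iff]; linarith)

theorem intervalIntegrable_log_add (x a b : ℝ) :
    IntervalIntegrable (fun y => Real.log (x + y)) volume a b := by
  refine (intervalIntegrable_log_sub (-x) a b).congr_ae (ae_of_all _ fun y => ?_)
  simp only
  rw [← Real.log_neg_eq_log]
  congr 1; ring

theorem intervalIntegrable_log_sq_sub (x a b : ℝ) :
    IntervalIntegrable (fun y => Real.log (x ^ 2 - y ^ 2)) volume a b :=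
  ((intervalIntegrable_log_sub x a b).add (intervalIntegrable_log_add x a b)).congr_ae
    (ae_restrict_of_ae (ae_log_sq_sub x))

theorem integral_even_mul_log {e : ℝ → ℝ} (he : ∀ y, e (-y) = e y)
    (hi : IntervalIntegrable (fun y => e y * Real.log (x - y)) volume (-ρ) ρ)
    (hi0 : 0 ≤ ρ) :
    ∫ y in -ρ..ρ, e y * Real.log (x - y) = ∫ y in 0..ρ, e y * Real.log (x ^ 2 - y ^ 2) := by
  have hsub : ∀ {u v : ℝ}, u ∈ Icc (-ρ) ρ → v ∈ Icc (-ρ) ρ →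
      IntervalIntegrable (fun y => e y * Real.log (x - y)) volume u v := by
    intro u v hu hv
    refine hi.mono_set ?_
    rw [uIcc_of_le (by linarith : -ρ ≤ ρ)]
    exact uIcc_subset_Icc hu hv
  have h1 : IntervalIntegrable (fun y => e y * Real.log (x - y)) volume (-ρ) 0 :=
    hsub ⟨by linarith, by linarith⟩ ⟨by linarith, by linarith⟩
  have h2 : IntervalIntegrable (fun y => e y * Real.log (x - y)) volume 0 ρ :=
    hsub ⟨by linarith, by linarith⟩ ⟨by linarith, by linarith⟩
  have h3 : ∫ y in -ρ..0, e y * Real.log (x - y) = ∫ y in 0..ρ, e y * Real.log (x + y) := by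
    have := intervalIntegral.integral_comp_neg (a := 0) (b := ρ) (fun y => e y * Real.log (x - y))
    simp only [he, sub_neg_eq_add, neg_zero] at this
    exact this.symm
  have h4 : IntervalIntegrable (fun y => e y * Real.log (x + y)) volume 0 ρ := by
    have := (IntervalIntegrable.iff_comp_neg enorm_ne_top).1 h1.symm
    simpa [he, sub_neg_eq_add] using this
  rw [← intervalIntegral.integral_add_adjacent_intervals h1 h2, h3,
    ← intervalIntegral.integral_add h4 h2]
  refine intervalIntegral.integral_congr_ae ?_
  filter_upwards [ae_log_sq_sub x] with y hy _
  rw [← hy]; ring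

namespace HoloExt

theorem integral_mul_div (hρ : 0 < ρ) :
    HoloExt (ρ ^ 2 / 2) fun X => ∫ s in Ioc (0:ℝ) 1, 2 * ρ * X / (ρ ^ 2 - X * s ^ 2) := by
  have hne : ∀ z ∈ Metric.ball (0:ℂ) (ρ ^ 2 / 2), ∀ s ∈ Ioc (0:ℝ) 1,
      ρ ^ 2 / 2 ≤ ‖(ρ:ℂ) ^ 2 - z * (s:ℂ) ^ 2‖ := by
    intro z hz s hs
    rw [mem_ball_zero_iff] at hz
    have h1 : ‖z * (s:ℂ) ^ 2‖ ≤ ρ ^ 2 / 2 := by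
      rw [norm_mul, norm_pow, Complex.norm_real, Real.norm_of_nonneg hs.1.le]
      calc _ ≤ ρ ^ 2 / 2 * 1 ^ 2 := by
            have := hs.2
            have := hs.1
            gcongr
        _ = _ := by ring
    have h2 := norm_sub_norm_le ((ρ:ℂ) ^ 2) (z * (s:ℂ) ^ 2)
    rw [norm_pow, Complex.norm_real, Real.norm_of_nonneg hρ.le] at h2
    linarith
  have hne' : ∀ z ∈ Metric.ball (0:ℂ) (ρ ^ 2 / 2), ∀ s ∈ Ioc (0:ℝ) 1,
      (ρ:ℂ) ^ 2 - z * (s:ℂ) ^ 2 ≠ 0 := by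
    intro z hz s hs h
    have := hne z hz s hs
    rw [h, norm_zero] at this
    nlinarith
  refine HoloExt.integral (K := fun z s => 2 * (ρ:ℂ) * z / ((ρ:ℂ) ^ 2 - z * (s:ℂ) ^ 2))
    (b := fun _ => 2 * ρ) ?_ ?_ (integrable_const _) ?_ ?_
  · intro z hz
    exact (Measurable.div (by fun_prop) (by fun_prop)).aestronglyMeasurable
  · refine (ae_restrict_iff' measurableSet_Ioc).2 (ae_of_all _ fun s hs z hz => ?_)
    have h1 := hne z hz s hs
    rw [mem_ball_zero_iff] at hz
    rw [norm_div, div_le_iff₀ (lt_of_lt_of_le (by positivity) h1), norm_mul, norm_mul,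
      Complex.norm_real, Real.norm_of_nonneg hρ.le, Complex.norm_ofNat]
    gcongr
    exact hz.le.trans h1
  · refine (ae_restrict_iff' measurableSet_Ioc).2 (ae_of_all _ fun s hs => ?_)
    exact DifferentiableOn.div (by fun_prop) (by fun_prop) fun z hz => hne' z hz s hs
  · intro X _
    exact ae_of_all _ fun s => by push_cast; rfl

theorem integral_log_sq_sub (hρ : 0 < ρ) : ∃ g, HoloExt (ρ ^ 2 / 2) g ∧
    ∀ X ∈ Ioo 0 (ρ ^ 2 / 2), ∫ y in 0..ρ, Real.log (X - y ^ 2) = g X := by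
  have hδ : 0 < ρ ^ 2 := by positivity
  refine ⟨_, ((const_mul ρ (log_sub (r := ρ ^ 2 / 2) (a := ρ ^ 2) (by linarith))).add
    (integral_mul_div hρ)).sub (const _ (2 * ρ)), fun X hX => ?_⟩
  set x := √X with hx
  have hx0 : 0 < x := Real.sqrt_pos.2 hX.1
  have hxX : X = x ^ 2 := (Real.sq_sqrt hX.1.le).symm
  have hxρ : x < ρ := by
    rw [hx, Real.sqrt_lt' hρ]
    linarith [hX.2]
  have h1 := integral_even_mul_log (e := fun _ => 1) (x := x) (ρ := ρ) (fun _ => rfl)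
    (by simpa using intervalIntegrable_log_sub x _ _) hρ.le
  simp only [one_mul, integral_log_sub, ← hxX] at h1
  have h2 : ∫ s in Ioc (0:ℝ) 1, 2 * ρ * X / (ρ ^ 2 - X * s ^ 2) =
      x * (Real.log (ρ + x) - Real.log (ρ - x)) := by
    rw [← intervalIntegral.integral_of_le zero_le_one]
    have hpos : ∀ s ∈ uIcc (0:ℝ) 1, 0 < ρ + x * s ∧ 0 < ρ - x * s := by
      intro s hs
      rw [uIcc_of_le zero_le_one] at hs
      constructor <;> nlinarith [hs.1, hs.2]
    have hd : ∀ s ∈ uIcc (0:ℝ) 1, HasDerivAt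
        (fun s => x * (Real.log (ρ + x * s) - Real.log (ρ - x * s)))
        (2 * ρ * X / (ρ ^ 2 - X * s ^ 2)) s := by
      intro s hs
      obtain ⟨hp, hm⟩ := hpos s hs
      have h : HasDerivAt (fun y => x * y) (x * 1) s := (hasDerivAt_id s).const_mul x
      refine ((((h.const_add ρ).log hp.ne').fun_sub ((h.const_sub ρ).log hm.ne')).const_mul
        x).congr_deriv ?_
      have e : ρ ^ 2 - X * s ^ 2 = (ρ + x * s) * (ρ - x * s) := by rw [hxX]; ring
      have := hp.ne'
      have := hm.ne'
      rw [e, hxX]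
      field_simp
      ring
    rw [intervalIntegral.integral_eq_sub_of_hasDerivAt hd]
    · simp
    · refine ContinuousOn.intervalIntegrable (ContinuousOn.div (by fun_prop) (by fun_prop) ?_)
      intro s hs
      obtain ⟨hp, hm⟩ := hpos s hs
      have e : ρ ^ 2 - X * s ^ 2 = (ρ + x * s) * (ρ - x * s) := by rw [hxX]; ring
      rw [e]
      positivity
  have h3 : Real.log (ρ ^ 2 - X) = Real.log (ρ + x) + Real.log (ρ - x) := by
    rw [← Real.log_mul (by linarith) (by linarith), hxX]
    congr 1; ring
  rw [← h1, h2, h3]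
  ring

theorem integral_pow_mul_log_sq_sub (hρ : 0 < ρ) : ∀ j : ℕ, ∃ g, HoloExt (ρ ^ 2 / 2) g ∧
    ∀ X ∈ Ioo 0 (ρ ^ 2 / 2), ∫ y in 0..ρ, y ^ (2 * j) * Real.log (X - y ^ 2) = g X
  | 0 => by simpa using integral_log_sq_sub hρ
  | i + 1 => by
    obtain ⟨g, hg, hgX⟩ := integral_pow_mul_log_sq_sub hρ i
    have hδ : 0 < ρ ^ 2 := by positivity
    refine ⟨_, const_mul (2 * i + 3 : ℝ)⁻¹ ((((const_mul (2 * i + 1) (id _)).mul hg).sub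
      (const _ (2 * ρ ^ (2 * i + 3) / (2 * i + 3)))).add
      ((const_mul (ρ ^ (2 * i + 1)) ((const _ (ρ ^ 2)).sub (id _))).mul
      (log_sub (r := ρ ^ 2 / 2) (a := ρ ^ 2) (by linarith)))), fun X hX => ?_⟩
    set x := √X with hx
    have hxX : X = x ^ 2 := (Real.sq_sqrt hX.1.le).symm
    have hli : ∀ n, IntervalIntegrable (fun y => y ^ n * Real.log (X - y ^ 2)) volume 0 ρ := by
      intro n
      rw [hxX]
      exact (intervalIntegrable_log_sq_sub x 0 ρ).continuousOn_mul (by fun_prop)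
    have hpi : ∀ n, IntervalIntegrable (fun y : ℝ => y ^ n) volume 0 ρ := fun n =>
      (continuous_pow n).intervalIntegrable _ _
    have hc : Continuous fun y : ℝ => -y ^ (2 * i + 1) * ((X - y ^ 2) * Real.log (X - y ^ 2)) :=
      (by fun_prop : Continuous fun y : ℝ => -y ^ (2 * i + 1)).mul
        (Real.continuous_mul_log.comp (by fun_prop : Continuous fun y : ℝ => X - y ^ 2))
    have key := MeasureTheory.integral_eq_of_hasDerivAt_off_countable_of_le _
      (fun y => ((2 * i + 3) * (y ^ (2 * (i + 1)) * Real.log (X - y ^ 2)) -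
        (2 * i + 1) * X * (y ^ (2 * i) * Real.log (X - y ^ 2))) + 2 * y ^ (2 * i + 2)) hρ.le
      ((countable_singleton x)) hc.continuousOn (fun y hy => ?_)
      ((((hli _).const_mul _).sub ((hli _).const_mul _)).add ((hpi _).const_mul _))
    · rw [intervalIntegral.integral_add (((hli _).const_mul _).sub ((hli _).const_mul _))
        ((hpi _).const_mul _), intervalIntegral.integral_sub ((hli _).const_mul _)
        ((hli _).const_mul _), intervalIntegral.integral_const_mul,
        intervalIntegral.integral_const_mul, intervalIntegral.integral_const_mul, hgX X hX,
        integral_pow, ← neg_sub (ρ ^ 2) X, Real.log_neg_eq_log] at key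
      have h3 : (2 * i + 3 : ℝ) ≠ 0 := by positivity
      have h4 : ((2 * i + 2 : ℕ) : ℝ) + 1 = 2 * i + 3 := by push_cast; ring
      rw [h4, zero_pow (by lia), zero_pow (by lia)] at key
      rw [eq_comm, inv_mul_eq_iff_eq_mul₀ h3]
      linear_combination -key
    · have hne : X - y ^ 2 ≠ 0 := by
        intro h
        apply hy.2
        rw [mem_singleton_iff]
        refine (pow_left_inj₀ hy.1.1.le (Real.sqrt_nonneg X) two_ne_zero).1 ?_
        linarith
      have h1 : HasDerivAt (fun y => X - y ^ 2) (-(2 * y)) y := by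
        simpa using (hasDerivAt_pow 2 y).const_sub X
      refine ((hasDerivAt_pow (2 * i + 1) y).fun_neg.fun_mul
        (h1.fun_mul (h1.log hne))).congr_deriv ?_
      rw [mul_div_cancel₀ _ hne]
      push_cast
      rw [show 2 * (i + 1) = 2 * i + 2 by lia]
      ring

theorem integral_polynomial_mul_log (hρ : 0 < ρ) (S : Polynomial ℝ) : ∃ g, HoloExt (ρ ^ 2 / 2) g ∧
    ∀ X ∈ Ioo 0 (ρ ^ 2 / 2), ∫ y in 0..ρ, S.eval (y ^ 2) * Real.log (X - y ^ 2) = g X := by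
  induction S using Polynomial.induction_on' with
  | add p q hp hq =>
    obtain ⟨g, hg, hgX⟩ := hp
    obtain ⟨g', hg', hgX'⟩ := hq
    refine ⟨_, hg.add hg', fun X hX => ?_⟩
    have hli : ∀ p : Polynomial ℝ, IntervalIntegrable
        (fun y => p.eval (y ^ 2) * Real.log (X - y ^ 2)) volume 0 ρ := by
      intro p
      rw [(Real.sq_sqrt hX.1.le).symm]
      exact (intervalIntegrable_log_sq_sub _ 0 ρ).continuousOn_mul
        (p.continuous.comp (continuous_pow 2)).continuousOn
    rw [← hgX X hX, ← hgX' X hX, ← intervalIntegral.integral_add (hli p) (hli q)]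
    congr 1 with y
    rw [Polynomial.eval_add]; ring
  | monomial n c =>
    obtain ⟨g, hg, hgX⟩ := integral_pow_mul_log_sq_sub hρ n
    refine ⟨_, const_mul c hg, fun X hX => ?_⟩
    rw [← hgX X hX, ← intervalIntegral.integral_const_mul]
    congr 1 with y
    rw [Polynomial.eval_monomial, ← pow_mul]; ring

end HoloExt
end

section
open Filter Topology
variable {ρ x β : ℝ}

theorem integral_compl_even_mul_inv_sq {U : ℝ → ℝ} (hUe : ∀ y, U (-y) = U y)
    (hU : Integrable fun y => U y * (1 + y ^ 2)⁻¹) (hx : x ∈ Ioo (-ρ) ρ) :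
    ∫ y in (Icc (-ρ) ρ)ᶜ, U y * ((x - y) ^ 2)⁻¹ =
      ∫ y in (Icc (-ρ) ρ)ᶜ, U y * ((x ^ 2 + y ^ 2) / (x ^ 2 - y ^ 2) ^ 2) := by
  have hxn : -x ∈ Ioo (-ρ) ρ := ⟨by linarith [hx.2], by linarith [hx.1]⟩
  have hi : ∀ {x}, x ∈ Ioo (-ρ) ρ →
      IntegrableOn (fun y => U y * ((x - y) ^ 2)⁻¹) (Icc (-ρ) ρ)ᶜ := by
    intro x hx
    obtain ⟨C, hC⟩ := exists_inv_sq_sub_le hx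
    have hm : Measurable fun y : ℝ => ((x - y) ^ 2)⁻¹ := by fun_prop
    refine (hU.abs.const_mul C).integrableOn.mono'
      ((aestronglyMeasurable_of_mul_inv hU).mul hm.aestronglyMeasurable).restrict ?_
    refine (ae_restrict_iff' measurableSet_Icc.compl).2 (ae_of_all _ fun y hy => ?_)
    rw [norm_mul, abs_mul, mul_left_comm, Real.norm_eq_abs, Real.norm_eq_abs,
      abs_of_nonneg (by positivity : (0:ℝ) ≤ (1 + y ^ 2)⁻¹),
      abs_of_nonneg (by positivity : (0:ℝ) ≤ ((x - y) ^ 2)⁻¹)]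
    gcongr
    exact (hC y hy).2
  have hs : ∫ y in (Icc (-ρ) ρ)ᶜ, U y * ((x - y) ^ 2)⁻¹ =
      ∫ y in (Icc (-ρ) ρ)ᶜ, U y * ((-x - y) ^ 2)⁻¹ := by
    have := (Measure.measurePreserving_neg (volume : Measure ℝ)).setIntegral_preimage_emb
      (MeasurableEquiv.neg ℝ).measurableEmbedding (fun y => U y * ((x - y) ^ 2)⁻¹) (Icc (-ρ) ρ)ᶜ
    rw [preimage_compl, neg_preimage, neg_Icc, neg_neg] at this
    rw [← this]
    congr 1 with y
    rw [hUe, show (x - -y) ^ 2 = (-x - y) ^ 2 by ring]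
  have h2 := integral_add (hi hx) (hi hxn)
  rw [← hs, ← two_mul] at h2
  rw [eq_comm, ← mul_right_inj' (two_ne_zero (α := ℝ)), ← h2, ← integral_const_mul]
  refine setIntegral_congr_fun measurableSet_Icc.compl fun y hy => ?_
  have h3 := (exists_inv_sq_sub_le hx).choose_spec y hy |>.1
  have h4 := (exists_inv_sq_sub_le hxn).choose_spec y hy |>.1
  have h5 : x - y ≠ 0 := fun h => by simp [h] at h3
  have h6 : x + y ≠ 0 := fun h => by rw [show -x - y = -(x + y) by ring, h] at h4; simp at h4
  have e : (x ^ 2 - y ^ 2) = (x - y) * (x + y) := by ring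
  rw [e, show -x - y = -(x + y) by ring, neg_sq]
  field_simp
  ring

namespace HoloExt

theorem integral_compl {U : ℝ → ℝ} (hρ : 0 < ρ) (hU : Integrable fun y => U y * (1 + y ^ 2)⁻¹) :
    HoloExt (ρ ^ 2 / 2) fun X =>
      ∫ y in (Icc (-ρ) ρ)ᶜ, U y * ((X + y ^ 2) / (X - y ^ 2) ^ 2) := by
  have hy : ∀ y ∈ (Icc (-ρ) ρ)ᶜ, ρ ^ 2 ≤ y ^ 2 := by
    intro y hy
    by_contra! h
    have := abs_le.1 (abs_le_of_sq_le_sq h.le hρ.le)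
    exact hy this
  have hne : ∀ z ∈ Metric.ball (0:ℂ) (ρ ^ 2 / 2), ∀ y ∈ (Icc (-ρ) ρ)ᶜ,
      y ^ 2 / 2 ≤ ‖z - (y:ℂ) ^ 2‖ ∧ ‖z + (y:ℂ) ^ 2‖ ≤ 3 / 2 * y ^ 2 := by
    intro z hz y hy'
    rw [mem_ball_zero_iff] at hz
    have h0 := hy y hy'
    have h1 : ‖(y:ℂ) ^ 2‖ = y ^ 2 := by
      rw [norm_pow, Complex.norm_real, Real.norm_eq_abs, sq_abs]
    have h2 := norm_sub_norm_le ((y:ℂ) ^ 2) z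
    have h3 := norm_add_le z ((y:ℂ) ^ 2)
    rw [norm_sub_rev] at h2
    constructor <;> linarith
  have hne' : ∀ z ∈ Metric.ball (0:ℂ) (ρ ^ 2 / 2), ∀ y ∈ (Icc (-ρ) ρ)ᶜ,
      z - (y:ℂ) ^ 2 ≠ 0 := by
    intro z hz y hy' h
    have := (hne z hz y hy').1
    rw [h, norm_zero] at this
    nlinarith [hy y hy']
  refine HoloExt.integral (K := fun z y => (U y : ℂ) * ((z + (y:ℂ) ^ 2) / (z - (y:ℂ) ^ 2) ^ 2))
    (b := fun y => (6 * (1 / ρ ^ 2 + 1)) * |U y * (1 + y ^ 2)⁻¹|) ?_ ?_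
    (hU.abs.const_mul _).integrableOn ?_ ?_
  · intro z hz
    refine (AEStronglyMeasurable.mul ?_
      (Measurable.div (by fun_prop) (by fun_prop)).aestronglyMeasurable).restrict
    exact Complex.continuous_ofReal.comp_aestronglyMeasurable (aestronglyMeasurable_of_mul_inv hU)
  · refine (ae_restrict_iff' measurableSet_Icc.compl).2 (ae_of_all _ fun y hy' z hz => ?_)
    obtain ⟨h1, h2⟩ := hne z hz y hy'
    have h0 := hy y hy'
    have hy0 : 0 < y ^ 2 := lt_of_lt_of_le (by positivity) h0
    rw [norm_mul, abs_mul, mul_left_comm, Complex.norm_real, Real.norm_eq_abs,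
      abs_of_nonneg (by positivity : (0:ℝ) ≤ (1 + y ^ 2)⁻¹), norm_div, norm_pow]
    gcongr
    calc _ ≤ 3 / 2 * y ^ 2 / (y ^ 2 / 2) ^ 2 := by gcongr
      _ = 6 * (y ^ 2)⁻¹ := by field_simp; norm_num
      _ ≤ 6 * ((1 / ρ ^ 2 + 1) * (1 + y ^ 2)⁻¹) := by
        gcongr
        rw [← div_eq_mul_inv, inv_le_iff_one_le_mul₀ hy0, div_mul_eq_mul_div,
          le_div_iff₀ (by positivity), one_mul, add_mul, one_mul]
        gcongr
        rw [div_mul_eq_mul_div, one_mul, le_div_iff₀ (by positivity)]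
        linarith
      _ = _ := by ring
  · refine (ae_restrict_iff' measurableSet_Icc.compl).2 (ae_of_all _ fun y hy' => ?_)
    exact (DifferentiableOn.div (by fun_prop) (by fun_prop)
      fun z hz => pow_ne_zero 2 (hne' z hz y hy')).const_mul _
  · intro X _
    exact ae_of_all _ fun y => by push_cast; rfl

end HoloExt

theorem integral_deriv_mul_log {h h' : ℝ → ℝ} {δ X : ℝ} (hδ : 0 < δ)
    (hd : ∀ t, HasDerivAt h (h' t) t) (hh' : Continuous h') (h0 : ∀ t ≤ 0, h t = 0) :
    ∫ t in 0..δ, (h t + t * h' t) * Real.log (X - t) =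
      X * logPot δ h' X + (δ - X) * Real.log (δ - X) * h δ - ∫ t in 0..δ, h t := by
  have hc : Continuous h := continuous_iff_continuousAt.2 fun t => (hd t).continuousAt
  have h0' : ∀ t < 0, h' t = 0 := by
    intro t ht
    refine (hd t).unique ((hasDerivAt_const t (0:ℝ)).congr_of_eventuallyEq ?_)
    filter_upwards [eventually_lt_nhds ht] with s hs
    exact h0 s hs.le
  have hl : ∀ {f : ℝ → ℝ} {a b : ℝ}, Continuous f →
      IntervalIntegrable (fun t => Real.log (X - t) * f t) volume a b := fun hf =>
    (intervalIntegrable_log_sub X _ _).mul_continuousOn hf.continuousOn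
  have hlp : logPot δ h' X = ∫ t in 0..δ, Real.log (X - t) * h' t := by
    unfold logPot
    rw [← intervalIntegral.integral_add_adjacent_intervals (b := 0) (hl hh') (hl hh')]
    have : ∫ t in -δ..0, Real.log (X - t) * h' t = ∫ t in -δ..0, (0:ℝ) := by
      refine intervalIntegral.integral_congr_ae ?_
      filter_upwards [compl_mem_ae_iff.2 (measure_singleton (0:ℝ))] with t ht ht'
      rw [uIoc_of_le (by linarith)] at ht'
      rw [h0' t (lt_of_le_of_ne ht'.2 ht), mul_zero]
    rw [this]; simp
  have hcL : Continuous fun t : ℝ => -((X - t) * Real.log (X - t)) * h t :=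
    ((Real.continuous_mul_log.comp (by fun_prop : Continuous fun t : ℝ => X - t)).neg).mul hc
  have key := MeasureTheory.integral_eq_of_hasDerivAt_off_countable_of_le _
    (fun t => ((h t + t * h' t) * Real.log (X - t) + h t) - X * (Real.log (X - t) * h' t)) hδ.le
    (countable_singleton X) hcL.continuousOn (fun t ht => ?_) ?_
  · have e : ∀ t, (h t + t * h' t) * Real.log (X - t) = Real.log (X - t) * (h t + t * h' t) :=
      fun t => mul_comm _ _
    simp only [e] at key ⊢
    have hcc : Continuous fun t => h t + t * h' t := by fun_prop
    rw [intervalIntegral.integral_sub ((hl hcc).add (hc.intervalIntegrable _ _))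
      ((hl hh').const_mul _),
      intervalIntegral.integral_add (hl hcc) (hc.intervalIntegrable _ _),
      intervalIntegral.integral_const_mul, ← hlp, h0 0 le_rfl, mul_zero, sub_zero,
      ← neg_sub δ X, Real.log_neg_eq_log] at key
    linear_combination key
  · have hne : X - t ≠ 0 := sub_ne_zero.2 (Ne.symm ht.2)
    have h1 : HasDerivAt (fun t => X - t) (-1) t := by simpa using (hasDerivAt_id t).const_sub X
    refine ((h1.fun_mul (h1.log hne)).fun_neg.fun_mul (hd t)).congr_deriv ?_
    rw [mul_div_cancel₀ _ hne]
    ring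
  · refine IntervalIntegrable.sub (IntervalIntegrable.add ?_ (hc.intervalIntegrable _ _))
      ((hl hh').const_mul _)
    exact (intervalIntegrable_log_sub X _ _).continuousOn_mul (by fun_prop)
end

section
open Filter Topology
variable {ρ x β : ℝ}

/-- The even weight whose logarithmic potential at `y` is that of `φ 1_{(0,R)}` at `y²`. -/
noncomputable def evenWeight (φ : ℝ → ℝ) (R s : ℝ) : ℝ :=
  if s ^ 2 < R then 2 * |s| * φ (s ^ 2) else 0

section
variable {φ : ℝ → ℝ} {R : ℝ}

theorem measurable_evenWeight (hφ : Continuous φ) : Measurable (evenWeight φ R) := by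
  unfold evenWeight
  refine Measurable.ite (measurableSet_lt (by fun_prop) (by fun_prop)) ?_ measurable_const
  have := hφ.measurable
  exact Continuous.measurable (by fun_prop)

theorem exists_abs_evenWeight_le (hφ : Continuous φ) : ∃ M, ∀ s, |evenWeight φ R s| ≤ M := by
  obtain ⟨M, hM⟩ := (isCompact_Icc (a := -√R) (b := √R)).exists_bound_of_continuousOn
    (by fun_prop : Continuous fun s : ℝ => 2 * |s| * φ (s ^ 2)).continuousOn
  refine ⟨max M 0, fun s => ?_⟩
  unfold evenWeight
  split_ifs with h
  · exact le_max_of_le_left (hM s (abs_le.1 (Real.abs_le_sqrt h.le)))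
  · simp

theorem evenWeight_eq_zero (s : ℝ) (h : √R < |s|) : evenWeight φ R s = 0 := by
  unfold evenWeight
  rw [if_neg]
  intro h'
  exact absurd (Real.abs_le_sqrt h'.le) (not_le.2 h)

theorem evenWeight_eventuallyEq (hx : x ^ 2 < R) :
    evenWeight φ R =ᶠ[𝓝 x] fun s => 2 * |s| * φ (s ^ 2) := by
  have : ∀ᶠ s in 𝓝 x, s ^ 2 < R :=
    (by fun_prop : ContinuousAt (fun s : ℝ => s ^ 2) x).eventually (gt_mem_nhds hx)
  filter_upwards [this] with s hs
  simp [evenWeight, hs]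

theorem integral_log_mul_evenWeight (hφ : Continuous φ) (hR : 0 < R) (y : ℝ) :
    ∫ s, Real.log (y - s) * evenWeight φ R s = ∫ t in 0..R, Real.log (y ^ 2 - t) * φ t := by
  have hle : -√R ≤ √R := by linarith [Real.sqrt_nonneg R]
  have h1 : ∫ s, Real.log (y - s) * evenWeight φ R s =
      ∫ s in -√R..√R, (2 * |s| * φ (s ^ 2)) * Real.log (y - s) := by
    rw [intervalIntegral.integral_of_le hle, integral_Ioc_eq_integral_Ioo,
      ← integral_indicator measurableSet_Ioo]
    congr 1 with s
    by_cases hs : s ∈ Ioo (-√R) (√R)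
    · rw [indicator_of_mem hs, evenWeight, if_pos, mul_comm]
      rw [← sq_abs]
      exact (Real.lt_sqrt (abs_nonneg s)).1 (abs_lt.2 hs)
    · rw [indicator_of_notMem hs, evenWeight, if_neg, mul_zero]
      intro h
      exact hs (abs_lt.1 ((Real.lt_sqrt (abs_nonneg s)).2 (by rwa [sq_abs])))
  have hc : Continuous fun s : ℝ => 2 * |s| * φ (s ^ 2) := by fun_prop
  rw [h1, integral_even_mul_log (by simp)
    ((intervalIntegrable_log_sub y _ _).continuousOn_mul hc.continuousOn) (Real.sqrt_nonneg R)]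
  have h2 := integral_two_mul_comp_sq (Real.sqrt_nonneg R) fun t => Real.log (y ^ 2 - t) * φ t
  rw [Real.sq_sqrt hR.le] at h2
  rw [← h2]
  refine intervalIntegral.integral_congr fun s hs => ?_
  rw [uIcc_of_le (Real.sqrt_nonneg R)] at hs
  rw [abs_of_nonneg hs.1]
  ring

end

theorem SqrtHolder.exists_deriv_eq (hβ : 0 < β) (hβ1 : β < 1) {m : ℕ} {g : ℝ → ℝ}
    (hg : SqrtHolder β (m + 1) g) : ∃ g' h h' : ℝ → ℝ, (∀ t, HasDerivAt g (g' t) t) ∧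
      Continuous g' ∧ (∀ t ≤ 0, h t = 0) ∧ (∀ t, HasDerivAt h (h' t) t) ∧ ZeroHolder β m h' ∧
      ∀ y, 0 < y → 2 * g (y ^ 2) + 4 * y ^ 2 * g' (y ^ 2) =
        2 * y * (2 * (h (y ^ 2) + y ^ 2 * h' (y ^ 2))) := by
  have hz : ZeroHolder β (m + 1) (fun t => g t / (t ^ 0 * √t)) :=
    SqrtHolder.zeroHolder_div (n := m + 1) (a := 0) hβ hβ1.le hg
  have hh0 := hz.eq_zero
  obtain ⟨-, g', hg', hg1⟩ := hg
  obtain ⟨-, h', hh', hz'⟩ := hz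
  refine ⟨g', _, h', hg', hg1.continuous hβ, hh0, hh', hz', fun y hy => ?_⟩
  have hy2 : 0 < y ^ 2 := by positivity
  have hs : √(y ^ 2) = y := Real.sqrt_sq hy.le
  have h1 := (Real.hasDerivAt_sqrt hy2.ne').fun_mul (hh' (y ^ 2))
  have h2 : HasDerivAt g _ (y ^ 2) := h1.congr_of_eventuallyEq (by
    filter_upwards [eventually_gt_nhds hy2] with t ht
    have : √t ≠ 0 := (Real.sqrt_pos.2 ht).ne'
    simp only [pow_zero, one_mul]
    field_simp)
  rw [(hg' _).unique h2, hs]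
  simp only [pow_zero, one_mul]
  field_simp
  ring

/-- One-sided case: if the logarithmic potential of `φ 1_{(0,R)}` is smooth up to the end point
`0` and `φ 0 = 0`, then `φ / √` is smooth up to the end point. -/
theorem exists_sqrt_factor (hβ : 0 < β) (hβ1 : β < 1) {m : ℕ} {φ f : ℝ → ℝ} {R B : ℝ}
    (hφ : Continuous φ) (hR : 0 < R) (hRB : R ≤ B)
    (hf1 : β ≤ 1 / 2 → DerivChain (m + 2) (β + 1 / 2) f 0 R)
    (hf2 : 1 / 2 < β → DerivChain (m + 3) (β - 1 / 2) f 0 R)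
    (hpot : ∀ X ∈ Ioo 0 R, ∫ t in 0..B, Real.log (X - t) * φ t = f X) :
    ∃ r > 0, ∃ Q, DerivChain (m + 1) β Q 0 r ∧ ∀ X ∈ Ioo 0 r, φ X = √X * Q X := by
  obtain ⟨P, G, hG, hfe⟩ := SqrtHolder.decompose hβ hβ1 (half_pos hR) (half_lt_self hR) hf1 hf2
  obtain ⟨-, g, hGg, hg⟩ := hG
  obtain ⟨g', h, h', hg', hg'c, hh0, hh', hz', hrel⟩ := hg.exists_deriv_eq hβ hβ1
  have hgc : Continuous g := continuous_iff_continuousAt.2 fun t => (hg' t).continuousAt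
  have hR2 : 0 < R / 2 := half_pos hR
  set ρ := √(R / 2) with hρdef
  have hρ : 0 < ρ := Real.sqrt_pos.2 hR2
  have hρ2 : ρ ^ 2 = R / 2 := Real.sq_sqrt hR2.le
  have hle : -ρ ≤ ρ := by linarith
  set w := evenWeight φ B
  obtain ⟨M, hM⟩ := exists_abs_evenWeight_le (R := B) hφ
  have hwm : Measurable w := measurable_evenWeight hφ
  set U : ℝ → ℝ := fun y => ∫ s, Real.log (y - s) * w s with hUdef
  have hUi : Integrable fun y => U y * (1 + y ^ 2)⁻¹ :=
    integrable_logConv hwm hM evenWeight_eq_zero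
  have hUf : ∀ y, U y = ∫ t in 0..B, Real.log (y ^ 2 - t) * φ t :=
    integral_log_mul_evenWeight hφ (hR.trans_le hRB)
  have hUe : ∀ y, U (-y) = U y := fun y => by rw [hUf, hUf, neg_sq]
  -- the potential and its derivatives in the variable `y`
  let E : ℝ → ℝ := fun y => P.eval (y ^ 2) + G (y ^ 2)
  let E' : ℝ → ℝ := fun y => 2 * y * (P.derivative.eval (y ^ 2) + g (y ^ 2))
  let E'' : ℝ → ℝ := fun y => 2 * (P.derivative.eval (y ^ 2) + g (y ^ 2)) +
    4 * y ^ 2 * (P.derivative.derivative.eval (y ^ 2) + g' (y ^ 2))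
  have hsq : ∀ y : ℝ, HasDerivAt (fun y : ℝ => y ^ 2) (2 * y) y := fun y => by
    simpa using hasDerivAt_pow 2 y
  have hE : ∀ y, HasDerivAt E (E' y) y := fun y => by
    refine (((P.hasDerivAt (y ^ 2)).comp y (hsq y)).fun_add
      ((hGg (y ^ 2)).comp y (hsq y))).congr_deriv ?_
    simp only [E']; ring
  have hE' : ∀ y, HasDerivAt E' (E'' y) y := fun y => by
    refine (((hasDerivAt_id y).const_mul 2).fun_mul
      (((P.derivative.hasDerivAt (y ^ 2)).comp y (hsq y)).fun_add
      ((hg' (y ^ 2)).comp y (hsq y)))).congr_deriv ?_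
    simp only [E'', id, Function.comp]; ring
  have hE''c : Continuous E'' := by
    have h1 : ∀ p : Polynomial ℝ, Continuous fun y : ℝ => p.eval (y ^ 2) := fun p =>
      p.continuous.comp (continuous_pow 2)
    have h2 := h1 P.derivative
    have h3 := h1 P.derivative.derivative
    fun_prop
  have hUE : ∀ᵐ y, y ∈ Ioo (-ρ) ρ → U y = E y := by
    filter_upwards [compl_mem_ae_iff.2 (measure_singleton (0:ℝ))] with y hy hyρ
    have hy0 : 0 < y ^ 2 := by
      have : y ≠ 0 := hy
      positivity
    have hyR : y ^ 2 < R / 2 := by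
      rw [← hρ2]; exact sq_lt_sq' hyρ.1 hyρ.2
    rw [hUf, hpot _ ⟨hy0, by linarith⟩, hfe _ ⟨hy0.le, hyR.le⟩]
  obtain ⟨gP, hgP, hgPX⟩ := HoloExt.integral_polynomial_mul_log hρ
    (2 * P.derivative + 4 * Polynomial.X * P.derivative.derivative)
  -- the holomorphic part
  obtain ⟨A, hA, hAX⟩ : ∃ A, HoloExt (R / 4) A ∧ ∀ X ∈ Ioo 0 (R / 4),
      Real.pi ^ 2 * (2 * √X * φ X) = A X - 2 * (X * logPot (R / 2) h' X) := by
    have hr : R / 4 ≤ ρ ^ 2 := by rw [hρ2]; linarith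
    have hr' : R / 4 = ρ ^ 2 / 2 := by rw [hρ2]; ring
    have hlog := HoloExt.log_sub hr
    have hH := ((((HoloExt.integral_compl hρ hUi).add
      (HoloExt.const_mul (-(2 * ρ * E ρ)) (HoloExt.inv_sub (hr' ▸ hr)))).add
      (HoloExt.const_mul (E' ρ) (hr' ▸ hlog))).sub hgP).sub
      ((HoloExt.const_mul (2 * h (R / 2)) (((HoloExt.const _ (ρ ^ 2)).sub (HoloExt.id _)).mul
        (hr' ▸ hlog))).sub (HoloExt.const _ (2 * ∫ t in 0..R / 2, h t)))
    rw [← hr'] at hH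
    refine ⟨_, hH, fun X hX => ?_⟩
    set x := √X with hxdef
    have hx0 : 0 < x := Real.sqrt_pos.2 hX.1
    have hxX : X = x ^ 2 := (Real.sq_sqrt hX.1.le).symm
    have hxρ : x < ρ := Real.sqrt_lt_sqrt hX.1.le (by linarith [hX.2])
    have hx : x ∈ Ioo (-ρ) ρ := ⟨by linarith, hxρ⟩
    have hwe := evenWeight_eventuallyEq (φ := φ) (R := B) (x := x) (by linarith [hX.2])
    have hwc : ContinuousAt w x :=
      (by fun_prop : ContinuousAt (fun s : ℝ => 2 * |s| * φ (s ^ 2)) x).congr hwe.symm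
    have key := logConv_inversion hwm hM evenWeight_eq_zero (fun y _ => hE y) (fun y _ => hE' y)
      hE''c.continuousOn hUE hx hwc
    have hwx : w x = 2 * x * φ X := by
      have := hwe.eq_of_nhds
      simp only [abs_of_pos hx0, ← hxX] at this
      exact this
    have hEe : E (-ρ) = E ρ := by simp [E]
    have hEe' : E' (-ρ) = -E' ρ := by simp [E']
    have hout := integral_compl_even_mul_inv_sq hUe hUi hx
    rw [← hxX] at hout
    have hlog1 : Real.log (x - ρ) + Real.log (x + ρ) = Real.log (ρ ^ 2 - X) := by
      rw [← Real.log_neg_eq_log (x - ρ), ← Real.log_mul (by linarith) (by linarith), hxX]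
      congr 1; ring
    have hinv : (x - ρ)⁻¹ - (x + ρ)⁻¹ = -(2 * ρ) * (ρ ^ 2 - X)⁻¹ := by
      have h1 : x - ρ ≠ 0 := by linarith
      have h2 : x + ρ ≠ 0 := by linarith
      have h3 : ρ - x ≠ 0 := by linarith
      have e : ρ ^ 2 - X = (ρ - x) * (x + ρ) := by rw [hxX]; ring
      rw [e]
      field_simp
      ring
    have hii : ∀ {e : ℝ → ℝ} {u v : ℝ}, Continuous e →
        IntervalIntegrable (fun y => e y * Real.log (X - y ^ 2)) volume u v := fun he => by
      rw [hxX]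
      exact (intervalIntegrable_log_sq_sub x _ _).continuousOn_mul he.continuousOn
    have hsplit : ∫ y in -ρ..ρ, E'' y * Real.log (x - y) = gP X +
        2 * (X * logPot (R / 2) h' X + (R / 2 - X) * Real.log (R / 2 - X) * h (R / 2) -
          ∫ t in 0..R / 2, h t) := by
      rw [integral_even_mul_log (fun y => by simp [E''])
        ((intervalIntegrable_log_sub x _ _).continuousOn_mul hE''c.continuousOn) hρ.le, ← hxX,
        ← hgPX X (by rwa [← hr']), ← integral_deriv_mul_log hR2 hh' (hz'.continuous hβ) hh0,
        ← hρ2, ← intervalIntegral.integral_const_mul, ← integral_two_mul_comp_sq hρ.le]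
      have hc2 : Continuous fun y : ℝ => 2 * g (y ^ 2) + 4 * y ^ 2 * g' (y ^ 2) := by fun_prop
      have hcongr : ∫ y in 0..ρ, 2 * y * (2 * ((h (y ^ 2) + y ^ 2 * h' (y ^ 2)) *
          Real.log (X - y ^ 2))) = ∫ y in 0..ρ, (2 * g (y ^ 2) + 4 * y ^ 2 * g' (y ^ 2)) *
          Real.log (X - y ^ 2) := by
        refine intervalIntegral.integral_congr_ae (ae_of_all _ fun y hy => ?_)
        rw [uIoc_of_le hρ.le] at hy
        rw [hrel y hy.1]; ring
      have hcp : Continuous fun y : ℝ => Polynomial.eval (y ^ 2)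
          (2 * P.derivative + 4 * Polynomial.X * P.derivative.derivative) :=
        (Polynomial.continuous _).comp (continuous_pow 2)
      rw [hcongr, ← intervalIntegral.integral_add (hii hcp) (hii hc2)]
      congr 1 with y
      simp only [E'', Polynomial.eval_add, Polynomial.eval_mul, Polynomial.eval_X,
        Polynomial.eval_ofNat]
      ring
    rw [hwx, hout, hsplit, hEe, hEe'] at key
    rw [key, ← hlog1, hρ2]
    rw [hρ2] at hinv hlog1
    rw [← hlog1]
    linear_combination E ρ * hinv
  have hR4 : 0 < R / 4 := by linarith
  have hlp := hz'.derivChain_logPot hβ hβ1 hR2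
  rw [show R / 2 / 2 = R / 4 by ring] at hlp
  have hA0 : A 0 = 0 := by
    have h1 := (hA.continuousAt_zero hR4).tendsto.mono_left (nhdsWithin_le_nhds (s := Ioi 0))
    have h2 : ContinuousAt (logPot (R / 2) h') 0 :=
      (hlp.continuousOn hβ).continuousAt (Ioo_mem_nhds (by linarith) (by linarith))
    have h3 : ContinuousAt (fun X => Real.pi ^ 2 * (2 * √X * φ X) +
        2 * (X * logPot (R / 2) h' X)) 0 := by fun_prop
    have h4 := h3.tendsto.mono_left (nhdsWithin_le_nhds (s := Ioi 0))
    simp only [Real.sqrt_zero, mul_zero, zero_mul, add_zero] at h4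
    refine tendsto_nhds_unique h1 (h4.congr' ?_)
    filter_upwards [Ioo_mem_nhdsGT hR4] with X hX
    rw [hAX X hX]; ring
  obtain ⟨B, hB, hBX⟩ := hA.exists_eq_mul hR4 hA0
  have hr : R / 8 < R / 4 := by linarith
  refine ⟨R / 8, by linarith, _, DerivChain.const_mul (2 * Real.pi ^ 2)⁻¹
    ((hB.derivChain hβ1.le hr (m + 1)).add (DerivChain.const_mul (-2) (hlp.mono hr.le))),
    fun X hX => ?_⟩
  have hX4 : X ∈ Ioo 0 (R / 4) := ⟨hX.1, hX.2.trans hr⟩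
  have h1 := hAX X hX4
  rw [hBX X ⟨by linarith [hX.1], hX4.2⟩] at h1
  have hs : 0 < √X := Real.sqrt_pos.2 hX.1
  have hss : X = √X * √X := (Real.mul_self_sqrt hX.1.le).symm
  have hpi := Real.pi_pos.ne'
  have h2 : √X * (2 * Real.pi ^ 2 * φ X) = √X * (√X * (B X + -2 * logPot (R / 2) h' X)) := by
    linear_combination h1 + (B X + -2 * logPot (R / 2) h' X) * hss
  have h3 := mul_left_cancel₀ hs.ne' h2
  field_simp
  linear_combination h3
end

section
open Filter Topology
variable {ρ β : ℝ}

theorem DerivChain.exists_abs_sub_le {n : ℕ} {α γ p r r' : ℝ} {f : ℝ → ℝ} (hα : 0 < α)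
    (hγ : γ ≤ 1) (hr' : 0 < r') (hr : r' < r) (h0 : n = 0 → γ ≤ α) (hf : DerivChain n α f p r) :
    ∃ L, ∀ x ∈ Icc (p - r') (p + r'), ∀ y ∈ Icc (p - r') (p + r'),
      |f x - f y| ≤ L * |x - y| ^ γ := by
  have hs : Icc (p - r') (p + r') ⊆ Ioo (p - r) (p + r) :=
    Icc_subset_Ioo (by linarith) (by linarith)
  cases n with
  | zero =>
    obtain ⟨d, rfl, -, M, hM⟩ := hf
    refine ⟨|M| * (2 * r') ^ (α - γ), fun x hx y hy => ?_⟩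
    rcases eq_or_ne x y with rfl | hne
    · simp only [sub_self, abs_zero]
      positivity
    have hp : 0 < |x - y| := abs_pos.2 (sub_ne_zero.2 hne)
    have hle : |x - y| ≤ 2 * r' := abs_le.2 ⟨by linarith [hx.1, hy.2], by linarith [hx.2, hy.1]⟩
    calc _ ≤ M * |x - y| ^ α := hM x (hs hx) y (hs hy)
      _ ≤ |M| * |x - y| ^ α := by gcongr; exact le_abs_self M
      _ = |M| * |x - y| ^ (α - γ) * |x - y| ^ γ := by
        rw [mul_assoc, ← Real.rpow_add hp, sub_add_cancel]
      _ ≤ _ := by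
        gcongr
        exact sub_nonneg.2 (h0 rfl)
  | succ n =>
    obtain ⟨f', hf', hc⟩ := hf.exists_deriv
    exact abs_sub_le_rpow_of_deriv hγ (by linarith) (fun t ht => hf' t (hs ht))
      ((hc.continuousOn hα).mono hs)

theorem HoloExt.integral_compl_inv_sq {U : ℝ → ℝ} (hρ : 0 < ρ)
    (hU : Integrable fun y => U y * (1 + y ^ 2)⁻¹) :
    HoloExt (ρ / 2) fun x => ∫ y in (Icc (-ρ) ρ)ᶜ, U y * ((x - y) ^ 2)⁻¹ := by
  have hy : ∀ y ∈ (Icc (-ρ) ρ)ᶜ, ρ ≤ |y| := by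
    intro y hy
    by_contra! h
    exact hy (abs_le.1 h.le)
  have hne : ∀ z ∈ Metric.ball (0:ℂ) (ρ / 2), ∀ y ∈ (Icc (-ρ) ρ)ᶜ, |y| / 2 ≤ ‖z - (y:ℂ)‖ := by
    intro z hz y hy'
    rw [mem_ball_zero_iff] at hz
    have h0 := hy y hy'
    have h2 := norm_sub_norm_le (y:ℂ) z
    rw [norm_sub_rev, Complex.norm_real, Real.norm_eq_abs] at h2
    linarith
  have hne' : ∀ z ∈ Metric.ball (0:ℂ) (ρ / 2), ∀ y ∈ (Icc (-ρ) ρ)ᶜ, z - (y:ℂ) ≠ 0 := by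
    intro z hz y hy' h
    have := hne z hz y hy'
    rw [h, norm_zero] at this
    linarith [hy y hy']
  refine HoloExt.integral (K := fun z y => (U y : ℂ) * ((z - (y:ℂ)) ^ 2)⁻¹)
    (b := fun y => (4 * (1 / ρ ^ 2 + 1)) * |U y * (1 + y ^ 2)⁻¹|) ?_ ?_
    (hU.abs.const_mul _).integrableOn ?_ ?_
  · intro z hz
    refine (AEStronglyMeasurable.mul ?_
      (Measurable.inv (by fun_prop)).aestronglyMeasurable).restrict
    exact Complex.continuous_ofReal.comp_aestronglyMeasurable (aestronglyMeasurable_of_mul_inv hU)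
  · refine (ae_restrict_iff' measurableSet_Icc.compl).2 (ae_of_all _ fun y hy' z hz => ?_)
    have h1 := hne z hz y hy'
    have h0 : ρ ^ 2 ≤ y ^ 2 := by
      rw [← sq_abs y]
      have := hy y hy'
      gcongr
    have hy0 : 0 < y ^ 2 := lt_of_lt_of_le (by positivity) h0
    have hya : 0 < |y| := hρ.trans_le (hy y hy')
    rw [norm_mul, abs_mul, mul_left_comm, Complex.norm_real, Real.norm_eq_abs,
      abs_of_nonneg (by positivity : (0:ℝ) ≤ (1 + y ^ 2)⁻¹), norm_inv, norm_pow]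
    gcongr
    calc _ ≤ ((|y| / 2) ^ 2)⁻¹ := by gcongr
      _ = 4 * (y ^ 2)⁻¹ := by rw [div_pow, sq_abs]; field_simp; norm_num
      _ ≤ 4 * ((1 / ρ ^ 2 + 1) * (1 + y ^ 2)⁻¹) := by
        gcongr
        rw [← div_eq_mul_inv, inv_le_iff_one_le_mul₀ hy0, div_mul_eq_mul_div,
          le_div_iff₀ (by positivity), one_mul, add_mul, one_mul]
        gcongr
        rw [div_mul_eq_mul_div, one_mul, le_div_iff₀ (by positivity)]
        linarith
      _ = _ := by ring
  · refine (ae_restrict_iff' measurableSet_Icc.compl).2 (ae_of_all _ fun y hy' => ?_)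
    exact (DifferentiableOn.inv (by fun_prop)
      fun z hz => pow_ne_zero 2 (hne' z hz y hy')).const_mul _
  · intro X _
    exact ae_of_all _ fun y => by push_cast; rfl

theorem HoloExt.differentiableAt_zero {r : ℝ} {f : ℝ → ℝ} (hr : 0 < r) (hf : HoloExt r f) :
    DifferentiableAt ℝ f 0 := by
  obtain ⟨f', hf', -⟩ := (hf.derivChain le_rfl (half_lt_self hr) 1).exists_deriv
  exact (hf' 0 ⟨by linarith, by linarith⟩).differentiableAt

/-- Two-sided case: if the logarithmic potential of `φ 1_{(-R,R)}` is smooth on both sides of `0`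
then `φ` is differentiable at `0`. -/
theorem differentiableAt_of_logPot_eq (hβ : 0 < β) (hβ1 : β < 1) {m : ℕ} {φ f : ℝ → ℝ} {R B : ℝ}
    (hφ : Continuous φ) (hR : 0 < R) (hRB : R ≤ B)
    (hf1 : β ≤ 1 / 2 → DerivChain (m + 2) (β + 1 / 2) f 0 R)
    (hf2 : 1 / 2 < β → DerivChain (m + 3) (β - 1 / 2) f 0 R)
    (hpot : ∀ X ∈ Ioo (-R) R, X ≠ 0 → logPot B φ X = f X) : DifferentiableAt ℝ φ 0 := by
  obtain ⟨ρ, hρ, hρR⟩ : ∃ ρ, 0 < ρ ∧ ρ < R := ⟨R / 2, half_pos hR, half_lt_self hR⟩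
  obtain ⟨E', E'', hE, hE', L, hL⟩ : ∃ E' E'' : ℝ → ℝ, (∀ y ∈ Icc (-ρ) ρ, HasDerivAt f (E' y) y) ∧
      (∀ y ∈ Icc (-ρ) ρ, HasDerivAt E' (E'' y) y) ∧ ∃ L, ∀ x ∈ Icc (-ρ) ρ, ∀ y ∈ Icc (-ρ) ρ,
        |E'' x - E'' y| ≤ L * |x - y| ^ β := by
    have key : ∀ {n : ℕ} {α : ℝ}, 0 < α → (n = 0 → β ≤ α) → DerivChain (n + 2) α f 0 R →
        ∃ E' E'' : ℝ → ℝ, (∀ y ∈ Icc (-ρ) ρ, HasDerivAt f (E' y) y) ∧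
        (∀ y ∈ Icc (-ρ) ρ, HasDerivAt E' (E'' y) y) ∧ ∃ L, ∀ x ∈ Icc (-ρ) ρ, ∀ y ∈ Icc (-ρ) ρ,
        |E'' x - E'' y| ≤ L * |x - y| ^ β := by
      intro n α hα h0 hf
      obtain ⟨E', hE, hf'⟩ := hf.exists_deriv
      obtain ⟨E'', hE', hf''⟩ := hf'.exists_deriv
      have hL := hf''.exists_abs_sub_le hα hβ1.le hρ hρR h0
      have hs : Icc (-ρ) ρ ⊆ Ioo (0 - R) (0 + R) := Icc_subset_Ioo (by linarith) (by linarith)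
      simp only [zero_sub, zero_add] at hL
      exact ⟨E', E'', fun y hy => hE y (hs hy), fun y hy => hE' y (hs hy), hL⟩
    rcases le_or_gt β (1 / 2) with h | h
    · exact key (by linarith) (fun _ => by linarith) (hf1 h)
    · exact key (n := m + 1) (by linarith) (fun h => by omega) (hf2 h)
  set w := (Ioo (-B) B).indicator φ with hw
  have hwm : Measurable w := hφ.measurable.indicator measurableSet_Ioo
  obtain ⟨M, hM⟩ : ∃ M, ∀ s, |w s| ≤ M := by
    obtain ⟨M, hM⟩ := (isCompact_Icc (a := -B) (b := B)).exists_bound_of_continuousOn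
      hφ.continuousOn
    refine ⟨max M 0, fun s => ?_⟩
    by_cases hs : s ∈ Ioo (-B) B
    · rw [hw, indicator_of_mem hs]
      exact le_max_of_le_left (hM s (Ioo_subset_Icc_self hs))
    · rw [hw, indicator_of_notMem hs, abs_zero]
      exact le_max_right _ _
  have hw0 : ∀ s, B < |s| → w s = 0 := fun s hs => by
    rw [hw, indicator_of_notMem]
    exact fun h => (abs_lt.2 h).not_gt hs
  have hpw : ∀ y, ∫ s, Real.log (y - s) * w s = logPot B φ y := fun y => by
    rw [logPot, intervalIntegral.integral_of_le (by linarith), integral_Ioc_eq_integral_Ioo,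
      ← integral_indicator measurableSet_Ioo]
    congr 1 with s
    rw [hw, indicator_mul_right]
  have hU : ∀ᵐ y, y ∈ Ioo (-ρ) ρ → ∫ s, Real.log (y - s) * w s = f y := by
    filter_upwards [compl_mem_ae_iff.2 (measure_singleton (0:ℝ))] with y hy hyρ
    rw [hpw, hpot y ⟨by linarith [hyρ.1], by linarith [hyρ.2]⟩ hy]
  have hE''c := continuousOn_of_abs_sub_le hβ hL
  have hlog := HoloExt.log_sub (half_le_self hρ.le)
  have hinv := HoloExt.inv_sub (half_le_self hρ.le)
  have hH := (((HoloExt.integral_compl_inv_sq hρ (integrable_logConv hwm hM hw0)).add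
    ((HoloExt.const_mul (-f ρ) hinv).sub (HoloExt.const_mul (f (-ρ)) hinv.comp_neg))).add
    ((HoloExt.const_mul (E' ρ) hlog).sub (HoloExt.const_mul (E' (-ρ)) hlog.comp_neg)))
  have hD := ((hH.differentiableAt_zero (half_pos hρ)).fun_sub
    ((logPot_hasDerivAt hβ hβ1 hρ hL).1 0 ⟨by linarith, by linarith⟩).differentiableAt).const_mul
    (Real.pi ^ 2)⁻¹
  refine hD.congr_of_eventuallyEq ?_
  filter_upwards [Ioo_mem_nhds (neg_neg_of_pos hρ) hρ] with x hx
  have hxR : x ∈ Ioo (-B) B := ⟨by linarith [hx.1], by linarith [hx.2]⟩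
  have hwφ : w =ᶠ[𝓝 x] φ := by
    filter_upwards [isOpen_Ioo.mem_nhds hxR] with s hs
    rw [hw, indicator_of_mem hs]
  have key := logConv_inversion hwm hM hw0 hE hE' hE''c hU hx (hφ.continuousAt.congr hwφ.symm)
  have h1 : Real.log (x - ρ) = Real.log (ρ - x) := by rw [← Real.log_neg_eq_log, neg_sub]
  have h2 : (x - ρ)⁻¹ = -(ρ - x)⁻¹ := by rw [← neg_sub, inv_neg]
  have h3 : logPot ρ E'' x = ∫ y in -ρ..ρ, E'' y * Real.log (x - y) := by
    simp only [logPot, mul_comm]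
  rw [hwφ.eq_of_nhds, h1, h2, ← h3] at key
  rw [eq_inv_mul_iff_mul_eq₀ (by positivity), key]
  simp only [sub_neg_eq_add, add_comm ρ x]
  ring
end

section
open Filter Topology
variable {A B : ℝ} {g : ℝ → ℝ}

theorem integrable_log_mul_of_bdd_support (hg : Continuous g)
    (hA : ∀ s, A < |s| → g s = 0) (X : ℝ) :
    Integrable fun s => Real.log (X - s) * g s := by
  have h1 : IntervalIntegrable (fun s => Real.log (X - s) * g s) volume (-max A 0) (max A 0) :=
    (intervalIntegrable_log_sub X _ _).mul_continuousOn hg.continuousOn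
  rw [intervalIntegrable_iff_integrableOn_Icc_of_le (by linarith [le_max_right A 0])] at h1
  refine (integrableOn_iff_integrable_of_support_subset fun s hs => ?_).1 h1
  by_contra h
  refine hs ?_
  rw [mem_Icc, ← abs_le, not_le] at h
  simp only [hA s ((le_max_left A 0).trans_lt h), mul_zero]

/-- The part of the logarithmic potential coming from outside `[-B, B]` is real analytic
near `0`. -/
theorem HoloExt.integral_compl_log_sub_mul (hB : 0 < B) (hg : Continuous g)
    (hA : ∀ s, A < |s| → g s = 0) :
    HoloExt (B / 2) fun X => ∫ s in (Icc (-B) B)ᶜ, Real.log (X - s) * g s := by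
  have hs' : ∀ s ∈ (Icc (-B) B)ᶜ, B < |s| := by
    intro s hs
    by_contra! h
    exact hs (abs_le.1 h)
  have hle : ∀ z ∈ Metric.ball (0:ℂ) (B / 2), ∀ s ∈ (Icc (-B) B)ᶜ, ‖-(z / (s:ℂ))‖ ≤ 1 / 2 := by
    intro z hz s hs
    rw [mem_ball_zero_iff] at hz
    have h1 := hs' s hs
    rw [norm_neg, norm_div, Complex.norm_real, Real.norm_eq_abs, div_le_iff₀ (by linarith)]
    linarith
  refine HoloExt.integral
    (K := fun z s => ((Real.log s : ℂ) + Complex.log (1 + -(z / (s:ℂ)))) * (g s : ℂ))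
    (b := fun s => |Real.log (0 - s) * g s| + |g s|) ?_ ?_ ?_ ?_ ?_
  · intro z _
    refine (Measurable.mul (Measurable.add ?_ ?_) ?_).aestronglyMeasurable
    · exact Complex.measurable_ofReal.comp Real.measurable_log
    · exact Complex.measurable_log.comp (by fun_prop)
    · exact Complex.measurable_ofReal.comp hg.measurable
  · refine (ae_restrict_iff' measurableSet_Icc.compl).2 (ae_of_all _ fun s hs z hz => ?_)
    have h1 := hle z hz s hs
    have h2 := Complex.norm_log_one_add_half_le_self h1
    rw [zero_sub, Real.log_neg_eq_log, abs_mul, norm_mul, Complex.norm_real, Real.norm_eq_abs,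
      ← add_one_mul]
    gcongr
    refine (norm_add_le _ _).trans ?_
    rw [Complex.norm_real, Real.norm_eq_abs]
    linarith
  · have h1 : Integrable g := by
      refine hg.integrable_of_hasCompactSupport (HasCompactSupport.intro
        (isCompact_Icc (a := -A) (b := A)) fun s hs => hA s ?_)
      by_contra! h
      exact hs (abs_le.1 h)
    exact ((integrable_log_mul_of_bdd_support hg hA 0).abs.add h1.abs).integrableOn
  · refine (ae_restrict_iff' measurableSet_Icc.compl).2 (ae_of_all _ fun s hs => ?_)
    refine DifferentiableOn.mul_const (DifferentiableOn.const_add _ (DifferentiableOn.clog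
      (by fun_prop) fun z hz => ?_)) _
    exact Complex.mem_slitPlane_of_norm_lt_one ((hle z hz s hs).trans_lt (by norm_num))
  · intro X hX
    refine (ae_restrict_iff' measurableSet_Icc.compl).2 (ae_of_all _ fun s hs => ?_)
    have h1 := hs' s hs
    have hs0 : s ≠ 0 := abs_pos.1 (hB.trans h1)
    have h2 : |X / s| < 1 := by
      rw [abs_div, div_lt_one (hB.trans h1)]
      exact (abs_lt.2 hX).trans (by linarith)
    have h3 : 0 < 1 + -(X / s) := by linarith [(abs_lt.1 h2).2]
    have e : X - s = -(s * (1 + -(X / s))) := by field_simp; ring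
    rw [e, Real.log_neg_eq_log, Real.log_mul hs0 h3.ne']
    push_cast [Complex.ofReal_log h3.le]
    rfl

/-- Localization of a logarithmic potential, up to a real analytic error. -/
theorem exists_logPot_eq (hB : 0 < B) (hg : Continuous g) (hA : ∀ s, A < |s| → g s = 0)
    (ϑ κ : ℝ) : ∃ H, HoloExt (B / 2) H ∧ ∀ X, logPot B (fun s => ϑ * g s + κ) X =
      ϑ * (∫ s, Real.log (X - s) * g s) + H X := by
  have hl := HoloExt.log_sub (half_le_self hB.le)
  have hr := (HoloExt.const (B / 2) B).sub (HoloExt.id _)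
  have hL := ((hr.mul hl).add (hr.mul hl).comp_neg).sub (HoloExt.const _ (2 * B))
  refine ⟨_, (HoloExt.const_mul κ hL).sub
    (HoloExt.const_mul ϑ (HoloExt.integral_compl_log_sub_mul hB hg hA)), fun X => ?_⟩
  have h1 := integral_add_compl (measurableSet_Icc (a := -B) (b := B))
    (integrable_log_mul_of_bdd_support hg hA X)
  rw [integral_Icc_eq_integral_Ioc, ← intervalIntegral.integral_of_le (by linarith)] at h1
  have hi := (intervalIntegrable_log_sub X (-B) B).mul_continuousOn hg.continuousOn
  have h2 : logPot B (fun s => ϑ * g s + κ) X = ϑ * (∫ s in -B..B, Real.log (X - s) * g s) +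
      κ * ∫ s in -B..B, Real.log (X - s) := by
    rw [logPot, ← intervalIntegral.integral_const_mul, ← intervalIntegral.integral_const_mul,
      ← intervalIntegral.integral_add (hi.const_mul _)
        ((intervalIntegrable_log_sub X _ _).const_mul _)]
    congr 1 with s
    ring
  rw [h2, integral_log_sub, ← h1]
  simp only [sub_neg_eq_add]
  ring
end

section
open Filter Topology

/-- On each side of a point, a finite union of open intervals is either full or empty. -/
theorem eventually_mem_or_notMem_iUnion_Ioo {n : ℕ} (e f : Fin n → ℝ) (p : ℝ) {σ : ℝ}
    (hσ : σ = 1 ∨ σ = -1) :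
    (∀ᶠ X in 𝓝[>] (0:ℝ), p + σ * X ∈ ⋃ i, Ioo (e i) (f i)) ∨
      ∀ᶠ X in 𝓝[>] (0:ℝ), p + σ * X ∉ ⋃ i, Ioo (e i) (f i) := by
  have key : ∀ i, (∀ᶠ X in 𝓝[>] (0:ℝ), p + σ * X ∈ Ioo (e i) (f i)) ∨
      ∀ᶠ X in 𝓝[>] (0:ℝ), p + σ * X ∉ Ioo (e i) (f i) := by
    intro i
    have hlt : ∀ {d : ℝ}, 0 < d → ∀ᶠ X in 𝓝[>] (0:ℝ), 0 < X ∧ X < d := fun hd =>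
      Ioo_mem_nhdsGT hd
    have h0 : ∀ᶠ X in 𝓝[>] (0:ℝ), 0 < X := self_mem_nhdsWithin
    rcases hσ with rfl | rfl
    · rcases lt_or_ge p (e i) with h1 | h1
      · refine Or.inr ((hlt (sub_pos.2 h1)).mono fun X hX h => ?_)
        linarith [h.1, hX.2]
      · rcases lt_or_ge p (f i) with h2 | h2
        · refine Or.inl ((hlt (sub_pos.2 h2)).mono fun X hX => ⟨?_, ?_⟩) <;> linarith [hX.1, hX.2]
        · refine Or.inr (h0.mono fun X hX h => ?_)
          linarith [h.2]
    · rcases lt_or_ge (f i) p with h1 | h1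
      · refine Or.inr ((hlt (sub_pos.2 h1)).mono fun X hX h => ?_)
        linarith [h.2, hX.2]
      · rcases lt_or_ge (e i) p with h2 | h2
        · refine Or.inl ((hlt (sub_pos.2 h2)).mono fun X hX => ⟨?_, ?_⟩) <;> linarith [hX.1, hX.2]
        · refine Or.inr (h0.mono fun X hX h => ?_)
          linarith [h.1]
  by_cases h : ∃ i, ∀ᶠ X in 𝓝[>] (0:ℝ), p + σ * X ∈ Ioo (e i) (f i)
  · obtain ⟨i, hi⟩ := h
    exact Or.inl (hi.mono fun X hX => mem_iUnion.2 ⟨i, hX⟩)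
  · simp only [not_exists] at h
    have h' := eventually_all.2 fun i => (key i).resolve_left (h i)
    exact Or.inr (h'.mono fun X hX hm => by
      obtain ⟨i, hi⟩ := mem_iUnion.1 hm
      exact hX i hi)

theorem integral_comp_add_mul_of_sign {σ : ℝ} (hσ : σ = 1 ∨ σ = -1) (p : ℝ) (F : ℝ → ℝ) :
    ∫ s, F (p + σ * s) = ∫ t, F t := by
  rcases hσ with rfl | rfl
  · simpa using integral_add_left_eq_self F p
  · simpa [sub_eq_add_neg] using integral_sub_left_eq_self F volume p

section
variable {β σ p r c ϑ κ A : ℝ} {m : ℕ} {φ V : ℝ → ℝ}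

/-- The affine reparametrization at `p` of a localized potential: its smoothness. -/
theorem exists_logPot_comp_affine (hβ1 : β < 1) (hσ : σ = 1 ∨ σ = -1)
    (hφ : Continuous φ) (hA : ∀ s, A < |s| → φ s = 0) (hr : 0 < r)
    (hV1 : β ≤ 1 / 2 → DerivChain (m + 2) (β + 1 / 2) V p r)
    (hV2 : 1 / 2 < β → DerivChain (m + 3) (β - 1 / 2) V p r) (c ϑ κ : ℝ) :
    ∃ f, (β ≤ 1 / 2 → DerivChain (m + 2) (β + 1 / 2) f 0 r) ∧
      (1 / 2 < β → DerivChain (m + 3) (β - 1 / 2) f 0 r) ∧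
      ∀ X, ∫ t, Real.log (p + σ * X - t) * φ t = V (p + σ * X) - c →
        logPot (4 * r) (fun s => ϑ * φ (p + σ * s) + κ) X = f X := by
  have habs : |σ| = 1 := by rcases hσ with rfl | rfl <;> simp
  have hg : Continuous fun s => φ (p + σ * s) := by fun_prop
  have hA' : ∀ s, |p| + A < |s| → φ (p + σ * s) = 0 := fun s hs => hA _ (by
    have h1 : |σ * s| = |s| := by rw [abs_mul, habs, one_mul]
    have h2 := abs_sub_abs_le_abs_sub (σ * s) (-p)
    rw [abs_neg, h1, sub_neg_eq_add, add_comm (σ * s)] at h2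
    linarith)
  obtain ⟨H, hH, hHX⟩ := exists_logPot_eq (B := 4 * r) (by linarith) hg hA' ϑ κ
  have hH' : HoloExt (2 * r) fun X => H X + -(ϑ * c) := by
    rw [show 4 * r / 2 = 2 * r by ring] at hH
    exact hH.add (HoloExt.const _ _)
  have key : ∀ {n : ℕ} {α : ℝ}, α ≤ 1 → DerivChain n α V p r → DerivChain n α
      (fun X => ϑ * V (p + σ * (X - 0)) + (H X + -(ϑ * c))) 0 r := fun hα h =>
    ((DerivChain.comp_affine habs 0 h).const_mul ϑ).add (hH'.derivChain hα (by linarith) _)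
  refine ⟨_, fun h => key (by linarith) (hV1 h),
    fun h => key (by linarith) (hV2 h), fun X hX => ?_⟩
  rw [hHX, sub_zero]
  have h1 : ∫ s, Real.log (X - s) * φ (p + σ * s) = V (p + σ * X) - c := by
    rw [← hX, ← integral_comp_add_mul_of_sign hσ p fun t => Real.log (p + σ * X - t) * φ t]
    congr 1 with s
    congr 1
    rcases hσ with rfl | rfl
    · congr 1; ring
    · rw [← Real.log_neg_eq_log]; congr 1; ring
  rw [h1]
  ring


/-- A free boundary point with the contact set on both sides is incompatible with square root
growth. -/
theorem not_sqrt_growth (hβ : 0 < β) (hβ1 : β < 1) (hσ : σ = 1 ∨ σ = -1)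
    (hφ : Continuous φ) (hA : ∀ s, A < |s| → φ s = 0) (hr : 0 < r)
    (hV1 : β ≤ 1 / 2 → DerivChain (m + 2) (β + 1 / 2) V p r)
    (hV2 : 1 / 2 < β → DerivChain (m + 3) (β - 1 / 2) V p r)
    (hpot : ∀ X ∈ Ioo (-r) r, X ≠ 0 → ∫ t, Real.log (p + σ * X - t) * φ t = V (p + σ * X) - c)
    (hp : ϑ * φ p + κ = 0) {c₁ : ℝ} (hc₁ : 0 < c₁)
    (hgr : ∀ X ∈ Ioo 0 r, c₁ * √X ≤ ϑ * φ (p + σ * X) + κ) : False := by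
  obtain ⟨f, hf1, hf2, hf⟩ := exists_logPot_comp_affine hβ1 hσ hφ hA hr hV1 hV2 c ϑ κ
  have hd := differentiableAt_of_logPot_eq (φ := fun s => ϑ * φ (p + σ * s) + κ) hβ hβ1
    (by fun_prop) hr (by linarith : r ≤ 4 * r) hf1 hf2 fun X hX hX0 => hf X (hpot X hX hX0)
  have h1 := (hasDerivAt_iff_tendsto_slope_zero.1 hd.hasDerivAt).mono_left
    (nhdsWithin_mono 0 fun x (hx : 0 < x) => hx.ne')
  simp only [mul_zero, add_zero, zero_add, hp, sub_zero, smul_eq_mul] at h1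
  have h2 : Tendsto (fun X : ℝ => √X) (𝓝[>] 0) (𝓝 0) := by
    simpa using (Real.continuous_sqrt.tendsto 0).mono_left (nhdsWithin_le_nhds (s := Ioi 0))
  have h3 := h2.mul h1
  rw [zero_mul] at h3
  refine absurd (ge_of_tendsto h3 (b := c₁) ?_) (not_le.2 hc₁)
  filter_upwards [Ioo_mem_nhdsGT hr] with X hX
  have hs : 0 < √X := Real.sqrt_pos.2 hX.1
  have hss : √X * √X = X := Real.mul_self_sqrt hX.1.le
  have h4 := hgr X hX
  have h5 : √X * X⁻¹ = (√X)⁻¹ := by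
    conv_lhs => rw [← hss]
    rw [Real.sqrt_mul_self hs.le]
    field_simp
  rw [← mul_assoc, h5, le_inv_mul_iff₀ hs]
  linarith

/-- At a one-sided free boundary point the density is a square root times a smooth function. -/
theorem exists_sqrt_factor_of_potential (hβ : 0 < β) (hβ1 : β < 1) (hσ : σ = 1 ∨ σ = -1)
    (hφ : Continuous φ) (hA : ∀ s, A < |s| → φ s = 0) (hr : 0 < r)
    (hV1 : β ≤ 1 / 2 → DerivChain (m + 2) (β + 1 / 2) V p r)
    (hV2 : 1 / 2 < β → DerivChain (m + 3) (β - 1 / 2) V p r)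
    (hpot : ∀ X ∈ Ioo 0 r, ∫ t, Real.log (p + σ * X - t) * φ t = V (p + σ * X) - c)
    (hout : ∀ X ∈ Ioo (-r) 0, ϑ * φ (p + σ * X) + κ = 0) :
    ∃ r > 0, ∃ Q, DerivChain (m + 1) β Q 0 r ∧
      ∀ X ∈ Ioo 0 r, ϑ * φ (p + σ * X) + κ = √X * Q X := by
  have hr4 : 0 < r / 4 := by linarith
  have hr4' : r / 4 ≤ r := by linarith
  obtain ⟨f, hf1, hf2, hf⟩ := exists_logPot_comp_affine hβ1 hσ hφ hA hr4
    (fun h => (hV1 h).mono hr4') (fun h => (hV2 h).mono hr4') c ϑ κ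
  rw [mul_div_cancel₀ r four_ne_zero] at hf
  have hc : Continuous fun s => ϑ * φ (p + σ * s) + κ := by fun_prop
  refine exists_sqrt_factor hβ hβ1 hc hr4 hr4' hf1 hf2 fun X hX => ?_
  rw [← hf X (hpot X ⟨hX.1, hX.2.trans_le hr4'⟩), logPot,
    ← intervalIntegral.integral_add_adjacent_intervals (a := -r) (b := 0)
      ((intervalIntegrable_log_sub X _ _).mul_continuousOn hc.continuousOn)
      ((intervalIntegrable_log_sub X _ _).mul_continuousOn hc.continuousOn)]
  have h0 : ∫ t in -r..0, Real.log (X - t) * (ϑ * φ (p + σ * t) + κ) = 0 := by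
    rw [intervalIntegral.integral_of_le (by linarith), integral_Ioc_eq_integral_Ioo]
    refine setIntegral_eq_zero_of_forall_eq_zero fun t ht => ?_
    rw [hout t ht, mul_zero]
  rw [h0, zero_add]

end

end

section
open Filter Topology
variable {β θ p c ϑ κ A : ℝ} {m n : ℕ} {φ χ V : ℝ → ℝ} {U : Set ℝ} {e f : Fin n → ℝ}

/-- Regularity of the square root factor at a free boundary point, for `χ = φ` or `χ = θ - φ`. -/
theorem exists_ckAlphaOnIcc_sqrt_factor (hβ : 0 < β) (hβ1 : β < 1) (hθ : 0 < θ)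
    (hφ : Continuous φ) (hA : ∀ s, A < |s| → φ s = 0)
    (hχ : ∀ x, χ x = ϑ * φ x + κ) (hχ0 : ∀ x, 0 ≤ χ x)
    (hV1 : β ≤ 1 / 2 → CkAlphaLocOn (m + 2) (β + 1 / 2) V U)
    (hV2 : 1 / 2 < β → CkAlphaLocOn (m + 3) (β - 1 / 2) V U)
    (hB : {x | 0 < χ x ∧ χ x < θ} = ⋃ i, Ioo (e i) (f i))
    (hBU : closure {x | 0 < χ x ∧ χ x < θ} ⊆ U)
    (hpot : ∀ x, 0 < χ x → χ x < θ → ∫ t, Real.log (x - t) * φ t = V x - c)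
    (hp : p ∈ frontier {x | 0 < χ x})
    (hsq : ∃ r > 0, ∃ c₁ > 0, ∀ x, 0 < χ x → χ x < θ → |x - p| < r → c₁ * √|x - p| ≤ χ x) :
    ∃ r > 0, ∃ (Q : ℝ → ℝ) (c₁ c₂ : ℝ), 0 < c₁ ∧
      (∀ x ∈ Ioo (p - r) (p + r), c₁ ≤ Q x ∧ Q x ≤ c₂) ∧
      (∀ x, 0 < χ x → χ x < θ → |x - p| < r → χ x = Q x * √|x - p|) ∧
      CkAlphaOnIcc (m + 1) β (p - r) (p + r) Q := by
  have hχc : Continuous χ := by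
    rw [show χ = fun x => ϑ * φ x + κ from funext hχ]
    fun_prop
  have hopen : IsOpen {x | 0 < χ x} := isOpen_lt continuous_const hχc
  rw [hopen.frontier_eq] at hp
  have hp0 : χ p = 0 := le_antisymm (not_lt.1 hp.2) (hχ0 p)
  have hlt : {x | χ x < θ} ∈ 𝓝 p :=
    (isOpen_lt hχc continuous_const).mem_nhds (by simpa [hp0] using hθ)
  have hpB : p ∈ closure {x | 0 < χ x ∧ χ x < θ} := by
    rw [mem_closure_iff_nhds]
    intro t ht
    obtain ⟨x, ⟨hx1, hx2⟩, hx3⟩ := mem_closure_iff_nhds.1 hp.1 _ (inter_mem ht hlt)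
    exact ⟨x, hx1, hx3, hx2⟩
  obtain ⟨r₀, hr₀, hV1', hV2'⟩ : ∃ r > 0, (β ≤ 1 / 2 → DerivChain (m + 2) (β + 1 / 2) V p r) ∧
      (1 / 2 < β → DerivChain (m + 3) (β - 1 / 2) V p r) := by
    rcases le_or_gt β (1 / 2) with h | h
    · obtain ⟨r, hr, -, hc⟩ := DerivChain.of_ckAlphaLocOn (hV1 h) (hBU hpB)
      exact ⟨r, hr, fun _ => hc, fun h' => absurd h' (not_lt.2 h)⟩
    · obtain ⟨r, hr, -, hc⟩ := DerivChain.of_ckAlphaLocOn (hV2 h) (hBU hpB)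
      exact ⟨r, hr, fun h' => absurd h (not_lt.2 h'), fun _ => hc⟩
  obtain ⟨r₁, hr₁, c₁, hc₁, hgr⟩ := hsq
  have hside : ∀ {σ : ℝ}, σ = 1 ∨ σ = -1 →
      ∃ r > 0, (∀ X ∈ Ioo 0 r, 0 < χ (p + σ * X) ∧ χ (p + σ * X) < θ) ∨
        ∀ X ∈ Ioo 0 r, χ (p + σ * X) = 0 := by
    intro σ hσ
    have hlt' : ∀ᶠ X in 𝓝[>] (0:ℝ), χ (p + σ * X) < θ := by
      have : Tendsto (fun X => p + σ * X) (𝓝 0) (𝓝 p) := by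
        simpa using (by fun_prop : Continuous fun X => p + σ * X).tendsto 0
      exact (this.mono_left nhdsWithin_le_nhds).eventually hlt
    rcases eventually_mem_or_notMem_iUnion_Ioo e f p hσ with h | h
    · rw [← hB] at h
      obtain ⟨r, hr, hrs⟩ := mem_nhdsGT_iff_exists_Ioo_subset.1 h
      exact ⟨r, hr, Or.inl hrs⟩
    · rw [← hB] at h
      obtain ⟨r, hr, hrs⟩ := mem_nhdsGT_iff_exists_Ioo_subset.1 (h.and hlt')
      refine ⟨r, hr, Or.inr fun X hX => le_antisymm (not_lt.1 fun h0 => ?_) (hχ0 _)⟩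
      exact (hrs hX).1 ⟨h0, (hrs hX).2⟩
  have key : ∀ {σ r : ℝ}, σ = 1 ∨ σ = -1 → 0 < r → r ≤ r₀ → r ≤ r₁ →
      (∀ X ∈ Ioo 0 r, 0 < χ (p + σ * X) ∧ χ (p + σ * X) < θ) →
      (∀ X ∈ Ioo (-r) 0, χ (p + σ * X) = 0) →
      ∃ r > 0, ∃ (Q : ℝ → ℝ) (c₁ c₂ : ℝ), 0 < c₁ ∧
      (∀ x ∈ Ioo (p - r) (p + r), c₁ ≤ Q x ∧ Q x ≤ c₂) ∧
      (∀ x, 0 < χ x → χ x < θ → |x - p| < r → χ x = Q x * √|x - p|) ∧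
      CkAlphaOnIcc (m + 1) β (p - r) (p + r) Q := by
    intro σ r hσ hr hrr₀ hrr₁ hin hout
    have habs : |σ| = 1 := by rcases hσ with rfl | rfl <;> simp
    have hσσ : σ * σ = 1 := by rcases hσ with rfl | rfl <;> simp
    obtain ⟨r₂, hr₂, Q, hQ, hQX⟩ := exists_sqrt_factor_of_potential hβ hβ1 hσ hφ hA hr
      (fun h => (hV1' h).mono hrr₀) (fun h => (hV2' h).mono hrr₀)
      (fun X hX => hpot _ (hin X hX).1 (hin X hX).2) (fun X hX => by rw [← hχ, hout X hX])
    simp only [← hχ] at hQX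
    have hQc : ContinuousAt Q 0 :=
      (hQ.continuousOn hβ).continuousAt (Ioo_mem_nhds (by linarith) (by linarith))
    have hQ0 : c₁ ≤ Q 0 := by
      refine ge_of_tendsto (hQc.tendsto.mono_left (nhdsWithin_le_nhds (s := Ioi 0))) ?_
      filter_upwards [Ioo_mem_nhdsGT hr, Ioo_mem_nhdsGT hr₂] with X hX hX2
      have h1 := hgr _ (hin X hX).1 (hin X hX).2
      rw [add_sub_cancel_left, abs_mul, habs, one_mul, abs_of_pos hX.1, hQX X hX2, mul_comm] at h1
      exact le_of_mul_le_mul_left (h1 (hX.2.trans_le hrr₁)) (Real.sqrt_pos.2 hX.1)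
    obtain ⟨r₃, hr₃, hb⟩ := Metric.mem_nhds_iff.1 (hQc.preimage_mem_nhds
      (Icc_mem_nhds (by linarith : c₁ / 2 < Q 0) (lt_add_one (Q 0))))
    obtain ⟨s, hs, hsr, hs2, hs3⟩ : ∃ s > 0, s < r ∧ s < r₂ ∧ s < r₃ := by
      refine ⟨min r (min r₂ r₃) / 2, by positivity, ?_, ?_, ?_⟩
      all_goals
        refine (half_lt_self (by positivity)).trans_le ?_
        simp
    obtain ⟨q, hq, hqc⟩ := (DerivChain.comp_affine habs p hQ).ckAlphaOnIcc hβ hs hs2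
    refine ⟨s, hs, q, c₁ / 2, Q 0 + 1, by linarith, fun x hx => ?_, fun x hx1 hx2 hxs => ?_, hqc⟩
    · rw [hq x (Ioo_subset_Icc_self hx), zero_add]
      refine hb ?_
      rw [mem_ball_zero_iff, norm_mul, Real.norm_eq_abs, habs, one_mul, Real.norm_eq_abs, abs_lt]
      constructor <;> linarith [hx.1, hx.2]
    · have hxs' := abs_lt.1 hxs
      rw [hq x ⟨by linarith [hxs'.1], by linarith [hxs'.2]⟩, zero_add]
      have hx : p + σ * (σ * (x - p)) = x := by rw [← mul_assoc, hσσ]; ring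
      have hX : |σ * (x - p)| = |x - p| := by rw [abs_mul, habs, one_mul]
      generalize σ * (x - p) = X at hx hX
      rw [← hX] at hxs ⊢
      rw [abs_lt] at hxs
      rcases lt_trichotomy X 0 with h | h | h
      · have := hout X ⟨by linarith, h⟩
        rw [hx] at this
        exact absurd hx1 (by rw [this]; exact lt_irrefl _)
      · rw [h, mul_zero, add_zero] at hx
        exact absurd hx1 (by rw [← hx, hp0]; exact lt_irrefl _)
      · rw [abs_of_pos h, mul_comm, ← hQX X ⟨h, by linarith⟩, hx]
  obtain ⟨r, hr, h1⟩ := hside (Or.inl rfl)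
  obtain ⟨r', hr', h2⟩ := hside (Or.inr rfl)
  simp only [one_mul, neg_one_mul, ← sub_eq_add_neg] at h1 h2
  obtain ⟨s, hs, hs0, hs1, hsr, hsr'⟩ : ∃ s > 0, s ≤ r₀ ∧ s ≤ r₁ ∧ s ≤ r ∧ s ≤ r' :=
    ⟨min (min r₀ r₁) (min r r'), by positivity, by simp, by simp, by simp, by simp⟩
  have hneg : ∀ {X}, X ∈ Ioo (-s) 0 → -X ∈ Ioo 0 s := fun {X} hX =>
    ⟨by linarith [hX.2], by linarith [hX.1]⟩
  have hsub : Ioo 0 s ⊆ Ioo 0 r := Ioo_subset_Ioo_right hsr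
  have hsub' : Ioo 0 s ⊆ Ioo 0 r' := Ioo_subset_Ioo_right hsr'
  rcases h1 with h1 | h1 <;> rcases h2 with h2 | h2
  · exfalso
    refine not_sqrt_growth (c := c) (σ := 1) hβ hβ1 (Or.inl rfl) hφ hA hs
      (fun h => (hV1' h).mono hs0) (fun h => (hV2' h).mono hs0) (fun X hX hX0 => ?_)
      ((hχ p).symm.trans hp0) hc₁ fun X hX => ?_
    · rw [one_mul]
      rcases lt_or_gt_of_ne hX0 with h | h
      · have := h2 _ (hsub' (hneg ⟨hX.1, h⟩))
        rw [sub_neg_eq_add] at this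
        exact hpot _ this.1 this.2
      · have := h1 X (hsub ⟨h, hX.2⟩)
        exact hpot _ this.1 this.2
    · have h3 := h1 X (hsub hX)
      have h4 := hgr _ h3.1 h3.2
      rw [add_sub_cancel_left, abs_of_pos hX.1] at h4
      rw [← hχ, one_mul]
      exact h4 (hX.2.trans_le hs1)
  · refine key (σ := 1) (Or.inl rfl) hs hs0 hs1 (fun X hX => ?_) fun X hX => ?_
    · rw [one_mul]
      exact h1 X (hsub hX)
    · rw [one_mul, ← h2 _ (hsub' (hneg hX)), sub_neg_eq_add]
  · refine key (σ := -1) (Or.inr rfl) hs hs0 hs1 (fun X hX => ?_) fun X hX => ?_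
    · rw [neg_one_mul, ← sub_eq_add_neg]
      exact h2 X (hsub' hX)
    · rw [neg_one_mul, ← h1 _ (hsub (hneg hX))]
  · exfalso
    obtain ⟨x, hx, hx0, -⟩ := mem_closure_iff_nhds.1 hpB _ (Metric.ball_mem_nhds p hs)
    rw [Metric.mem_ball, Real.dist_eq, abs_lt] at hx
    rcases lt_trichotomy x p with h | h | h
    · have := h2 (p - x) (hsub' ⟨by linarith, by linarith⟩)
      rw [sub_sub_cancel] at this
      exact hx0.ne' this
    · rw [h, hp0] at hx0
      exact lt_irrefl _ hx0
    · have := h1 (x - p) (hsub ⟨by linarith, by linarith⟩)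
      rw [add_sub_cancel] at this
      exact hx0.ne' this
end

/-- Higher regularity for the discrete model: if `V` is continuous on
`K = ∪ₕ [aₕ,bₕ]`, of class `C^{k+1/2+β}_loc` inside, and the minimizer `μ = ψℋ¹` of `E_V`
over `𝓜_{1,θ}(K)` is regular (with continuous representative `φ`, potential `u = dpot φ c`,
contact set equal to the closure of `{0 < φ < θ}`, `{0 < φ < θ}` a finite union of open
intervals compactly contained in `∪ₕ (aₕ,bₕ)`, and square-root behavior
`φ = Q₋√|x−p₋|`, `θ − φ = Q₊√|x−p₊|` near free boundary points), then near each free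
boundary point the functions `Q₋` and `Q₊` can be chosen of class `C^{k−1,β}`. -/
theorem statement3
    (N : ℕ) (hN : 0 < N) (a b : Fin N → ℝ) (hab : ∀ h, a h < b h)
    (hdisj : ∀ i j, i ≠ j → Disjoint (Set.Icc (a i) (b i)) (Set.Icc (a j) (b j)))
    (K : Set ℝ) (hK : K = ⋃ h, Set.Icc (a h) (b h))
    (θ : ℝ) (hθ : 0 < θ) (hθK : 1 < θ * (volume K).toReal)
    (k : ℕ) (hk : 2 ≤ k) (β : ℝ) (hβ : β ∈ Set.Ioo (0:ℝ) 1)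
    (V : ℝ → ℝ) (hVc : ContinuousOn V K)
    (hV₁ : β ≤ 1/2 → CkAlphaLocOn k (β + 1/2) V (⋃ h, Set.Ioo (a h) (b h)))
    (hV₂ : 1/2 < β → CkAlphaLocOn (k+1) (β - 1/2) V (⋃ h, Set.Ioo (a h) (b h)))
    (ψ : ℝ → ℝ) (hmin : MinimizesD V K θ 1 ψ)
    (φ : ℝ → ℝ) (hφc : Continuous φ) (hφψ : φ =ᵐ[volume] ψ)
    (c : ℝ)
    (hEL₁ : ∀ x ∈ K, φ x < θ → -V x ≤ dpot φ c x 0)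
    (hEL₂ : ∀ x : ℝ, 0 < φ x → dpot φ c x 0 ≤ -V x)
    (hcontact : {x : ℝ | x ∈ K ∧ dpot φ c x 0 = -V x}
      = closure {x : ℝ | 0 < φ x ∧ φ x < θ})
    (hbands : ∃ (m : ℕ) (e f : Fin m → ℝ),
      (∀ i, e i < f i) ∧
      (∀ i j, i ≠ j → Disjoint (Set.Ioo (e i) (f i)) (Set.Ioo (e j) (f j))) ∧
      {x : ℝ | 0 < φ x ∧ φ x < θ} = ⋃ i, Set.Ioo (e i) (f i) ∧
      closure {x : ℝ | 0 < φ x ∧ φ x < θ} ⊆ ⋃ h, Set.Ioo (a h) (b h))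
    (hsqrtMinus : ∀ p ∈ frontier {x : ℝ | 0 < φ x}, ∃ r > 0, ∃ (Q : ℝ → ℝ) (c₁ c₂ : ℝ),
      0 < c₁ ∧ (∀ x ∈ Set.Ioo (p - r) (p + r), c₁ ≤ Q x ∧ Q x ≤ c₂) ∧
      (∀ x : ℝ, 0 < φ x → φ x < θ → |x - p| < r → φ x = Q x * Real.sqrt |x - p|))
    (hsqrtPlus : ∀ p ∈ frontier {x : ℝ | φ x < θ}, ∃ r > 0, ∃ (Q : ℝ → ℝ) (c₁ c₂ : ℝ),
      0 < c₁ ∧ (∀ x ∈ Set.Ioo (p - r) (p + r), c₁ ≤ Q x ∧ Q x ≤ c₂) ∧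
      (∀ x : ℝ, 0 < φ x → φ x < θ → |x - p| < r → θ - φ x = Q x * Real.sqrt |x - p|)) :
    (∀ p ∈ frontier {x : ℝ | 0 < φ x}, ∃ r > 0, ∃ (Q : ℝ → ℝ) (c₁ c₂ : ℝ),
      0 < c₁ ∧ (∀ x ∈ Set.Ioo (p - r) (p + r), c₁ ≤ Q x ∧ Q x ≤ c₂) ∧
      (∀ x : ℝ, 0 < φ x → φ x < θ → |x - p| < r → φ x = Q x * Real.sqrt |x - p|) ∧
      CkAlphaOnIcc (k-1) β (p - r) (p + r) Q) ∧
    (∀ p ∈ frontier {x : ℝ | φ x < θ}, ∃ r > 0, ∃ (Q : ℝ → ℝ) (c₁ c₂ : ℝ),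
      0 < c₁ ∧ (∀ x ∈ Set.Ioo (p - r) (p + r), c₁ ≤ Q x ∧ Q x ≤ c₂) ∧
      (∀ x : ℝ, 0 < φ x → φ x < θ → |x - p| < r → θ - φ x = Q x * Real.sqrt |x - p|) ∧
      CkAlphaOnIcc (k-1) β (p - r) (p + r) Q) := by
  obtain ⟨m, rfl⟩ : ∃ m, k = m + 2 := ⟨k - 2, by omega⟩
  obtain ⟨n, e, f, -, -, hB, hBU⟩ := hbands
  obtain ⟨⟨-, hψ, hψK, -⟩, -⟩ := hmin
  have hφ0 : ∀ x, 0 ≤ φ x := by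
    have h1 : ∀ᵐ x, 0 ≤ φ x := by filter_upwards [hφψ, hψ] with x h1 h2 using h1 ▸ h2.1
    have h : {x | φ x < 0} = ∅ := (isOpen_lt hφc continuous_const).eq_empty_of_measure_zero
      (measure_mono_null (fun x hx => not_le.2 hx) (ae_iff.1 h1))
    exact fun x => not_lt.1 (eq_empty_iff_forall_notMem.1 h x)
  have hφθ : ∀ x, φ x ≤ θ := by
    have h1 : ∀ᵐ x, φ x ≤ θ := by filter_upwards [hφψ, hψ] with x h1 h2 using h1 ▸ h2.2
    have h : {x | θ < φ x} = ∅ := (isOpen_lt continuous_const hφc).eq_empty_of_measure_zero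
      (measure_mono_null (fun x hx => not_le.2 hx) (ae_iff.1 h1))
    exact fun x => not_lt.1 (eq_empty_iff_forall_notMem.1 h x)
  obtain ⟨A, hA⟩ : ∃ A, ∀ x ∈ K, |x| ≤ A := by
    have hKc : IsCompact K := hK ▸ isCompact_iUnion fun h => isCompact_Icc
    exact hKc.exists_bound_of_continuousOn continuousOn_id
  have hφA : ∀ x, A < |x| → φ x = 0 := by
    have h1 : ∀ᵐ x, x ∉ K → φ x = 0 := by
      filter_upwards [hφψ, hψK] with x h1 h2 hx using h1.trans (h2 hx)
    have h : {x | A < |x|} ∩ {x | φ x ≠ 0} = ∅ :=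
      ((isOpen_lt continuous_const continuous_abs).inter
        (isOpen_ne_fun hφc continuous_const)).eq_empty_of_measure_zero
      (measure_mono_null (fun x hx (h : x ∉ K → φ x = 0) =>
        hx.2 (h fun hxK => not_le.2 hx.1 (hA x hxK))) (ae_iff.1 h1))
    exact fun x hx => by_contra fun h0 => eq_empty_iff_forall_notMem.1 h x ⟨hx, h0⟩
  have hpot : ∀ x, 0 < φ x → φ x < θ → ∫ t, Real.log (x - t) * φ t = V x - c := by
    intro x h0 h1
    have hxU := hBU (subset_closure ⟨h0, h1⟩)
    have hxK : x ∈ K := by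
      rw [hK]
      exact iUnion_mono (fun h => Ioo_subset_Icc_self) hxU
    have h2 := le_antisymm (hEL₂ x h0) (hEL₁ x hxK h1)
    simp only [dpot, ne_eq, OfNat.ofNat_ne_zero, not_false_eq_true, zero_pow, add_zero,
      Real.sqrt_sq_eq_abs, Real.log_abs] at h2
    linarith
  have hlow : ∀ {χ : ℝ → ℝ} {p : ℝ}, (∃ r > 0, ∃ (Q : ℝ → ℝ) (c₁ c₂ : ℝ), 0 < c₁ ∧
      (∀ x ∈ Set.Ioo (p - r) (p + r), c₁ ≤ Q x ∧ Q x ≤ c₂) ∧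
      (∀ x : ℝ, 0 < φ x → φ x < θ → |x - p| < r → χ x = Q x * Real.sqrt |x - p|)) →
      ∃ r > 0, ∃ c₁ > 0, ∀ x, 0 < φ x → φ x < θ → |x - p| < r → c₁ * √|x - p| ≤ χ x := by
    rintro χ p ⟨r, hr, Q, c₁, c₂, hc₁, hQ, hχ⟩
    refine ⟨r, hr, c₁, hc₁, fun x h0 h1 hx => ?_⟩
    rw [hχ x h0 h1 hx]
    have hx' := abs_lt.1 hx
    gcongr
    exact (hQ x ⟨by linarith, by linarith⟩).1
  have hiff : ∀ x, (0 < θ - φ x ∧ θ - φ x < θ) ↔ (0 < φ x ∧ φ x < θ) := fun x => by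
    rw [sub_pos, sub_lt_self_iff, and_comm]
  have hset : {x | φ x < θ} = {x | 0 < θ - φ x} := by simp only [sub_pos]
  rw [show m + 2 - 1 = m + 1 by omega]
  constructor
  · intro p hp
    exact exists_ckAlphaOnIcc_sqrt_factor hβ.1 hβ.2 hθ hφc hφA (χ := φ) (ϑ := 1) (κ := 0)
      (fun x => by ring) hφ0 hV₁ hV₂ hB hBU hpot hp (hlow (hsqrtMinus p hp))
  · intro p hp
    have h := hlow (hsqrtPlus p hp)
    rw [hset] at hp
    simp only [← hiff] at hB hBU
    obtain ⟨r, hr, Q, c₁, c₂, hc₁, hQ, hQφ, hQk⟩ := exists_ckAlphaOnIcc_sqrt_factor hβ.1 hβ.2 hθ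
      hφc hφA (χ := fun x => θ - φ x) (ϑ := -1) (κ := θ) (fun x => by ring)
      (fun x => sub_nonneg.2 (hφθ x)) hV₁ hV₂ hB hBU
      (fun x h0 h1 => hpot x ((hiff x).1 ⟨h0, h1⟩).1 ((hiff x).1 ⟨h0, h1⟩).2) hp
      (by
        obtain ⟨r, hr, c₁, hc₁, h⟩ := h
        exact ⟨r, hr, c₁, hc₁, fun x h0 h1 => h x ((hiff x).1 ⟨h0, h1⟩).1
          ((hiff x).1 ⟨h0, h1⟩).2⟩)
    exact ⟨r, hr, Q, c₁, c₂, hc₁, hQ, fun x h0 h1 => hQφ x ((hiff x).2 ⟨h0, h1⟩).1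
      ((hiff x).2 ⟨h0, h1⟩).2, hQk⟩
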